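/- arXiv:1109.5492 — 3 statements merged into one kernel-verified Lean document; each statement's English description precedes it below -/
import Mathlib

section
/- Let n ≥ 0 be an integer and b, c > 0. Then for every s ∈ ℂ with Re(s) > 0, the Laplace transform of the 2-D nonreflecting boundary kernel σ_n converges absolutely and satisfies L[σ_n](s) = s/c + 1/(2b) + (s/c)·K̃_n'(s b/c)/K̃_n(s b/c). -/
open MeasureTheory

noncomputable section

/-- Modified Bessel function of the second kind of integer order `n`, for real argument. -/
def besselK (n : ℕ) (x : ℝ) : ℝ :=
  ∫ t in Set.Ioi (0:ℝ), Real.exp (-x * Real.cosh t) * Real.cosh (n * t)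

/-- Modified Bessel function of the first kind of integer order `n`. -/
def besselI (n : ℕ) (x : ℝ) : ℝ :=
  ∑' k : ℕ, (x/2)^(n+2*k) / (Nat.factorial k * Nat.factorial (n+k))

/-- `M_n = n` for even `n`, `n-1` for odd `n`. -/
def Mn (n : ℕ) : ℕ := if Even n then n else n - 1

/-- The half-integer-order modified Bessel function `K_{n+1/2}` on the slit plane,
using the principal branch of the square root. -/
def Khalf (n : ℕ) (z : ℂ) : ℂ :=
  ((Real.pi : ℂ) / (2*z)) ^ ((1:ℂ)/2) * Complex.exp (-z) *
    ∑ k ∈ Finset.range (n+1),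
      ((n+k).factorial : ℂ) / ((k.factorial : ℂ) * ((n-k).factorial : ℂ) * (2*z)^k)

/-- The polynomial `p_n(z) = Σ_{k=0}^n [(n+k)!/(k!(n-k)!)] (2z)^{n-k}`. -/
def pPoly (n : ℕ) : Polynomial ℂ :=
  ∑ k ∈ Finset.range (n+1),
    Polynomial.C (((n+k).factorial : ℂ) / ((k.factorial : ℂ) * ((n-k).factorial : ℂ)))
      * (2 • Polynomial.X) ^ (n-k)

/-- Modified spherical Bessel function `k_n(z) = √(2/(π z)) K_{n+1/2}(z)`. -/
def sphk (n : ℕ) (z : ℂ) : ℂ := ((2:ℂ)/((Real.pi : ℂ) * z)) ^ ((1:ℂ)/2) * Khalf n z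

/-- Laplace transform. -/
def laplace (f : ℝ → ℂ) (s : ℂ) : ℂ := ∫ t in Set.Ioi (0:ℝ), Complex.exp (-s * t) * f t

/-- Convolution on `[0,∞)`. -/
def conv (f g : ℝ → ℂ) (t : ℝ) : ℂ := ∫ τ in (0:ℝ)..t, f (t - τ) * g τ

/-- The 3-D nonreflecting boundary kernel `σ_{n+1/2}` built from the roots `Z` of `p_n`. -/
def sigma3 {n : ℕ} (b c : ℝ) (Z : Fin n → ℂ) (t : ℝ) : ℂ :=
  ((c:ℂ)/(b:ℂ)^2) * ∑ j, Z j * Complex.exp ((c:ℂ) * t * Z j / b)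

/-- The 3-D nonreflecting boundary kernel `ω_{n+1/2}` built from the roots `Z` of `p_n`. -/
def omega3 {n : ℕ} (b c : ℝ) (Z : Fin n → ℂ) (t : ℝ) : ℂ :=
  -(c:ℂ)/b + ((c:ℂ)/b) * ∑ j, (Complex.exp ((c:ℂ) * t * Z j / b) - 1)

/-- The 2-D nonreflecting boundary kernel `σ_n`, built from the zeros `Z` of (the analytic
continuation of) `K_n`. -/
def sigma2 (n : ℕ) (b c : ℝ) {m : ℕ} (Z : Fin m → ℂ) (t : ℝ) : ℂ :=
  ((c:ℂ)/(b:ℂ)^2) * (∑ j, Z j * Complex.exp ((c:ℂ) * t * Z j / b)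
    + (-1:ℂ)^n * ((∫ r in Set.Ioi (0:ℝ),
        Real.exp (-c*t*r/b) / ((besselK n r)^2 + Real.pi^2 * (besselI n r)^2) : ℝ) : ℂ))

/-- The 2-D nonreflecting boundary kernel `ω_n`. -/
def omega2 (n : ℕ) (b c : ℝ) {m : ℕ} (Z : Fin m → ℂ) (t : ℝ) : ℂ :=
  -(c:ℂ)/(2*b) + ((c:ℂ)/b) * (∑ j, (Complex.exp ((c:ℂ) * t * Z j / b) - 1)
    + (-1:ℂ)^n * ((∫ r in Set.Ioi (0:ℝ),
        (1 - Real.exp (-c*t*r/b)) / (r * ((besselK n r)^2 + Real.pi^2 * (besselI n r)^2)) : ℝ) : ℂ))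

end

namespace BesselKernel

open Filter Topology Set

/-! ### Integrals against `exp (-r cosh t)` -/

/-- At most exponential growth on the nonnegative half-line. -/
def ExpGrowth (f : ℝ → ℝ) : Prop := ∃ C m : ℝ, ∀ t, 0 ≤ t → |f t| ≤ C * Real.exp (m * t)

theorem ExpGrowth.mul {f g : ℝ → ℝ} (hf : ExpGrowth f) (hg : ExpGrowth g) :
    ExpGrowth (fun t => f t * g t) := by
  obtain ⟨C, m, hf⟩ := hf
  obtain ⟨D, k, hg⟩ := hg
  refine ⟨C * D, m + k, fun t ht => ?_⟩
  rw [abs_mul, add_mul, Real.exp_add]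
  calc |f t| * |g t| ≤ (C * Real.exp (m * t)) * (D * Real.exp (k * t)) :=
        mul_le_mul (hf t ht) (hg t ht) (abs_nonneg _) ((abs_nonneg _).trans (hf t ht))
    _ = _ := by ring

theorem ExpGrowth.add {f g : ℝ → ℝ} (hf : ExpGrowth f) (hg : ExpGrowth g) :
    ExpGrowth (fun t => f t + g t) := by
  obtain ⟨C, m, hf⟩ := hf
  obtain ⟨D, k, hg⟩ := hg
  have hC : 0 ≤ C := by simpa using (abs_nonneg _).trans (hf 0 le_rfl)
  have hD : 0 ≤ D := by simpa using (abs_nonneg _).trans (hg 0 le_rfl)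
  refine ⟨C + D, max m k, fun t ht => ?_⟩
  have h1 : Real.exp (m * t) ≤ Real.exp (max m k * t) :=
    Real.exp_le_exp.2 (mul_le_mul_of_nonneg_right (le_max_left _ _) ht)
  have h2 : Real.exp (k * t) ≤ Real.exp (max m k * t) :=
    Real.exp_le_exp.2 (mul_le_mul_of_nonneg_right (le_max_right _ _) ht)
  calc |f t + g t| ≤ |f t| + |g t| := abs_add_le _ _
    _ ≤ C * Real.exp (m * t) + D * Real.exp (k * t) := add_le_add (hf t ht) (hg t ht)
    _ ≤ C * Real.exp (max m k * t) + D * Real.exp (max m k * t) := by gcongr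
    _ = _ := by ring

theorem expGrowth_of_bounded {f : ℝ → ℝ} (C : ℝ) (h : ∀ t, 0 ≤ t → |f t| ≤ C) : ExpGrowth f :=
  ⟨C, 0, fun t ht => by simpa using h t ht⟩

theorem expGrowth_const (c : ℝ) : ExpGrowth (fun _ => c) :=
  expGrowth_of_bounded |c| fun _ _ => le_rfl

theorem expGrowth_cosh (n : ℝ) (hn : 0 ≤ n) : ExpGrowth (fun t => Real.cosh (n * t)) := by
  refine ⟨1, n, fun t ht => ?_⟩
  rw [abs_of_pos (Real.cosh_pos _), one_mul, Real.cosh_eq]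
  have : Real.exp (-(n * t)) ≤ Real.exp (n * t) :=
    Real.exp_le_exp.2 (by nlinarith [mul_nonneg hn ht])
  linarith

theorem expGrowth_sinh (n : ℝ) (hn : 0 ≤ n) : ExpGrowth (fun t => Real.sinh (n * t)) := by
  obtain ⟨C, m, h⟩ := expGrowth_cosh n hn
  refine ⟨C, m, fun t ht => le_trans ?_ (h t ht)⟩
  rw [abs_of_pos (Real.cosh_pos _), abs_le]
  have h1 := Real.cosh_sq (n * t)
  constructor <;> nlinarith [Real.cosh_pos (n * t)]

theorem exp_neg_mul_cosh_le (r m : ℝ) (hr : 0 < r) :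
    ∃ A : ℝ, 0 < A ∧ ∀ t, 0 ≤ t → Real.exp (-r * Real.cosh t) * Real.exp (m * t) ≤
      A * Real.exp (-t) := by
  refine ⟨Real.exp ((m + 1) ^ 2 / r), Real.exp_pos _, fun t ht => ?_⟩
  rw [← Real.exp_add, ← Real.exp_add, Real.exp_le_exp]
  have h1 := Real.quadratic_le_exp_of_nonneg ht
  have h2 := Real.exp_pos (-t)
  have h3 : t ^ 2 / 4 ≤ Real.cosh t := by rw [Real.cosh_eq]; linarith
  have h4 : (m + 1) * t ≤ r * (t ^ 2 / 4) + (m + 1) ^ 2 / r := by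
    have : r * (t ^ 2 / 4) + (m + 1) ^ 2 / r - (m + 1) * t = (r * t / 2 - (m + 1)) ^ 2 / r := by
      field_simp; ring
    have : 0 ≤ (r * t / 2 - (m + 1)) ^ 2 / r := by positivity
    linarith
  nlinarith [mul_le_mul_of_nonneg_left h3 hr.le]

theorem integrableOn_exp_neg_mul_cosh {r : ℝ} (hr : 0 < r) {f : ℝ → ℝ} (hf : Continuous f)
    (hg : ExpGrowth f) : IntegrableOn (fun t => Real.exp (-r * Real.cosh t) * f t) (Ioi 0) := by
  obtain ⟨C, m, hg⟩ := hg
  obtain ⟨A, hA, h⟩ := exp_neg_mul_cosh_le r m hr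
  have hC : 0 ≤ C := by simpa using (abs_nonneg _).trans (hg 0 le_rfl)
  refine Integrable.mono' ((integrableOn_exp_neg_Ioi 0).const_mul (C * A)) ?_ ?_
  · exact (Continuous.mul (by fun_prop) hf).aestronglyMeasurable
  · refine (ae_restrict_mem measurableSet_Ioi).mono fun t ht => ?_
    have ht' : 0 ≤ t := le_of_lt ht
    rw [Real.norm_eq_abs, abs_mul, Real.abs_exp]
    calc Real.exp (-r * Real.cosh t) * |f t|
        ≤ Real.exp (-r * Real.cosh t) * (C * Real.exp (m * t)) := by
          gcongr; exact hg t ht'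
      _ = C * (Real.exp (-r * Real.cosh t) * Real.exp (m * t)) := by ring
      _ ≤ C * (A * Real.exp (-t)) := mul_le_mul_of_nonneg_left (h t ht') hC
      _ = _ := by ring

theorem tendsto_exp_neg_mul_cosh {r : ℝ} (hr : 0 < r) {f : ℝ → ℝ} (hg : ExpGrowth f) :
    Tendsto (fun t => Real.exp (-r * Real.cosh t) * f t) atTop (𝓝 0) := by
  obtain ⟨C, m, hg⟩ := hg
  obtain ⟨A, hA, h⟩ := exp_neg_mul_cosh_le r m hr
  have hC : 0 ≤ C := by simpa using (abs_nonneg _).trans (hg 0 le_rfl)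
  have h0 : Tendsto (fun t => C * A * Real.exp (-t)) atTop (𝓝 0) := by
    simpa using (Real.tendsto_exp_neg_atTop_nhds_zero).const_mul (C * A)
  refine squeeze_zero_norm' ?_ h0
  filter_upwards [eventually_ge_atTop 0] with t ht'
  rw [Real.norm_eq_abs, abs_mul, Real.abs_exp]
  calc Real.exp (-r * Real.cosh t) * |f t|
      ≤ Real.exp (-r * Real.cosh t) * (C * Real.exp (m * t)) := by
        gcongr; exact hg t ht'
    _ = C * (Real.exp (-r * Real.cosh t) * Real.exp (m * t)) := by ring
    _ ≤ C * (A * Real.exp (-t)) := mul_le_mul_of_nonneg_left (h t ht') hC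
    _ = _ := by ring

/-- Integration by parts against `exp (-r cosh t)`. -/
theorem integral_sinh_mul_eq {r : ℝ} (hr : 0 < r) {g g' : ℝ → ℝ}
    (hd : ∀ t, HasDerivAt g (g' t) t) (hc : Continuous g')
    (hg : ExpGrowth g) (hg' : ExpGrowth g') :
    r * ∫ t in Ioi (0:ℝ), Real.exp (-r * Real.cosh t) * (Real.sinh t * g t) =
      Real.exp (-r) * g 0 + ∫ t in Ioi (0:ℝ), Real.exp (-r * Real.cosh t) * g' t := by
  have hgc : Continuous g := continuous_iff_continuousAt.2 fun t => (hd t).continuousAt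
  have hs : ExpGrowth Real.sinh := by simpa using expGrowth_sinh 1 zero_le_one
  have i1 : IntegrableOn (fun t => Real.exp (-r * Real.cosh t) * (Real.sinh t * g t)) (Ioi 0) :=
    integrableOn_exp_neg_mul_cosh hr (Real.continuous_sinh.mul hgc) (hs.mul hg)
  have i2 := integrableOn_exp_neg_mul_cosh hr hc hg'
  have key := integral_Ioi_of_hasDerivAt_of_tendsto' (a := 0)
    (f := fun t => Real.exp (-r * Real.cosh t) * g t)
    (f' := fun t => Real.exp (-r * Real.cosh t) * g' t
      - r * (Real.exp (-r * Real.cosh t) * (Real.sinh t * g t))) (m := 0)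
    (fun t _ => by
      have := (((Real.hasDerivAt_cosh t).const_mul (-r)).exp).mul (hd t)
      convert! this using 1
      ring)
    (i2.sub (i1.const_mul r)) (tendsto_exp_neg_mul_cosh hr hg)
  rw [integral_sub i2 (i1.const_mul r), integral_const_mul] at key
  simp only [Real.cosh_zero, mul_one] at key
  linarith

/-! ### The functions `K_n` on the positive half-line -/

theorem integrableOn_besselK {r : ℝ} (hr : 0 < r) (n : ℕ) :
    IntegrableOn (fun t => Real.exp (-r * Real.cosh t) * Real.cosh (n * t)) (Ioi 0) :=
  integrableOn_exp_neg_mul_cosh hr (by fun_prop) (expGrowth_cosh n n.cast_nonneg)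

theorem integrableOn_cosh_mul {r : ℝ} (hr : 0 < r) (n : ℕ) :
    IntegrableOn (fun t => Real.exp (-r * Real.cosh t) * (Real.cosh t * Real.cosh (n * t)))
      (Ioi 0) := by
  refine integrableOn_exp_neg_mul_cosh hr (by fun_prop) (ExpGrowth.mul ?_ ?_)
  · simpa using expGrowth_cosh 1 zero_le_one
  · exact expGrowth_cosh n n.cast_nonneg

theorem integrableOn_sinh_mul {r : ℝ} (hr : 0 < r) (n : ℕ) :
    IntegrableOn (fun t => Real.exp (-r * Real.cosh t) * (Real.sinh t * Real.sinh (n * t)))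
      (Ioi 0) := by
  refine integrableOn_exp_neg_mul_cosh hr (by fun_prop) (ExpGrowth.mul ?_ ?_)
  · simpa using expGrowth_sinh 1 zero_le_one
  · exact expGrowth_sinh n n.cast_nonneg

theorem integral_sinh_mul_sinh {r : ℝ} (hr : 0 < r) (n : ℕ) :
    ∫ t in Ioi (0:ℝ), Real.exp (-r * Real.cosh t) * (Real.sinh t * Real.sinh (n * t)) =
      n / r * besselK n r := by
  have := integral_sinh_mul_eq hr (g := fun t => Real.sinh (n * t))
    (g' := fun t => Real.cosh (n * t) * n)
    (fun t => by
      simpa using! (Real.hasDerivAt_sinh (n * t)).comp t ((hasDerivAt_id t).const_mul (n:ℝ)))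
    (by fun_prop) (expGrowth_sinh n n.cast_nonneg)
    ((expGrowth_cosh n n.cast_nonneg).mul (expGrowth_const n))
  simp only [mul_zero, Real.sinh_zero, zero_add, ← mul_assoc, integral_mul_const] at this
  rw [besselK, div_mul_eq_mul_div, eq_div_iff hr.ne']
  simp only [← mul_assoc]
  linarith

theorem hasDerivAt_besselK_integral {r : ℝ} (hr : 0 < r) (n : ℕ) :
    HasDerivAt (besselK n)
      (-∫ t in Ioi (0:ℝ), Real.exp (-r * Real.cosh t) * (Real.cosh t * Real.cosh (n * t))) r := by
  have := (hasDerivAt_integral_of_dominated_loc_of_deriv_le (μ := volume.restrict (Ioi (0:ℝ)))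
    (F := fun x t => Real.exp (-x * Real.cosh t) * Real.cosh (n * t))
    (F' := fun x t => -(Real.exp (-x * Real.cosh t) * (Real.cosh t * Real.cosh (n * t))))
    (x₀ := r) (s := Ioi (r / 2))
    (bound := fun t => Real.exp (-(r / 2) * Real.cosh t) * (Real.cosh t * Real.cosh (n * t)))
    (Ioi_mem_nhds (by linarith))
    (Eventually.of_forall fun x => Continuous.aestronglyMeasurable (by fun_prop))
    (integrableOn_besselK hr n) (Continuous.aestronglyMeasurable (by fun_prop))
    (Eventually.of_forall fun t x hx => ?_) (integrableOn_cosh_mul (half_pos hr) n)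
    (Eventually.of_forall fun t x _ => ?_)).2
  · rw [integral_neg] at this
    exact this
  · have h1 := Real.cosh_pos t
    have h2 := Real.cosh_pos (n * t)
    rw [norm_neg, Real.norm_eq_abs, abs_of_pos (by positivity)]
    have hx' : r / 2 < x := hx
    gcongr
  · have := (((hasDerivAt_id x).neg.mul_const (Real.cosh t)).exp).mul_const (Real.cosh (n * t))
    convert! this using 1
    simp; ring

theorem hasDerivAt_besselK {r : ℝ} (hr : 0 < r) (n : ℕ) :
    HasDerivAt (besselK n) (n / r * besselK n r - besselK (n + 1) r) r := by
  convert hasDerivAt_besselK_integral hr n using 1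
  rw [← integral_sinh_mul_sinh hr n, besselK, eq_neg_iff_add_eq_zero, sub_add_eq_add_sub,
    sub_eq_zero, ← integral_add (integrableOn_sinh_mul hr n) (integrableOn_cosh_mul hr n)]
  refine integral_congr_ae (Eventually.of_forall fun t => ?_)
  have : ((n + 1 : ℕ) : ℝ) * t = n * t + t := by push_cast; ring
  simp only [this, Real.cosh_add]
  ring

theorem hasDerivAt_besselK_succ {r : ℝ} (hr : 0 < r) (n : ℕ) :
    HasDerivAt (besselK (n + 1)) (-besselK n r - (n + 1) / r * besselK (n + 1) r) r := by
  convert hasDerivAt_besselK_integral hr (n + 1) using 1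
  have h := integral_sinh_mul_sinh hr (n + 1)
  push_cast at h
  rw [← h, besselK, eq_neg_iff_add_eq_zero, sub_add_eq_add_sub, sub_eq_zero, neg_add_eq_iff_eq_add]
  have i1 := integrableOn_sinh_mul hr (n + 1)
  have i2 := integrableOn_besselK hr n
  push_cast at i1
  rw [← integral_add i2 i1]
  refine integral_congr_ae (Eventually.of_forall fun t => ?_)
  have : (n : ℝ) * t = ((n + 1 : ℝ) * t) - t := by ring
  simp only [this, Real.cosh_sub]
  push_cast
  ring

theorem besselK_add_two {r : ℝ} (hr : 0 < r) (n : ℕ) :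
    besselK (n + 2) r = besselK n r + 2 * (n + 1) / r * besselK (n + 1) r := by
  have h := (hasDerivAt_besselK hr (n + 1)).unique (hasDerivAt_besselK_succ hr n)
  push_cast at h
  have : besselK (n + 1 + 1) r = besselK (n + 2) r := rfl
  rw [this] at h
  have h2 : 2 * ((n:ℝ) + 1) / r = (n + 1) / r + (n + 1) / r := by ring
  rw [h2]
  linarith

theorem besselK_pos {r : ℝ} (hr : 0 < r) (n : ℕ) : 0 < besselK n r := by
  rw [besselK, setIntegral_pos_iff_support_of_nonneg_ae _ (integrableOn_besselK hr n)]
  · have : Function.support (fun t : ℝ => Real.exp (-r * Real.cosh t) * Real.cosh (n * t)) = univ :=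
      eq_univ_of_forall fun t => (mul_pos (Real.exp_pos _) (Real.cosh_pos _)).ne'
    rw [this]; simp
  · exact Eventually.of_forall fun t => (mul_pos (Real.exp_pos _) (Real.cosh_pos _)).le

theorem besselK_le_succ {r : ℝ} (hr : 0 < r) (n : ℕ) : besselK n r ≤ besselK (n + 1) r := by
  refine setIntegral_mono_on (integrableOn_besselK hr n) (integrableOn_besselK hr (n + 1))
    measurableSet_Ioi fun t ht => ?_
  have ht' : (0:ℝ) < t := ht
  refine mul_le_mul_of_nonneg_left (Real.cosh_le_cosh.2 ?_) (Real.exp_pos _).le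
  rw [abs_of_nonneg (by positivity), abs_of_nonneg (by positivity)]
  gcongr; simp

theorem besselK_anti {x y : ℝ} (hx : 0 < x) (hxy : x ≤ y) (n : ℕ) :
    besselK n y ≤ besselK n x := by
  refine setIntegral_mono_on (integrableOn_besselK (hx.trans_le hxy) n) (integrableOn_besselK hx n)
    measurableSet_Ioi fun t _ => ?_
  have := Real.cosh_pos t
  have := Real.cosh_pos (n * t)
  gcongr

/-! ### Limits of `K_n` and of the ratios `K_{n+1} / K_n` -/

theorem mul_besselK_one_bounds {r : ℝ} (hr : 0 < r) :
    Real.exp (-r) ≤ r * besselK 1 r ∧ r * besselK 1 r ≤ Real.exp (-r) + r := by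
  have h := integral_sinh_mul_eq hr (g := fun _ => 1) (g' := fun _ => 0)
    (fun t => hasDerivAt_const _ _) continuous_const (expGrowth_const 1) (expGrowth_const 0)
  simp only [mul_one, mul_zero, integral_zero, add_zero] at h
  have i1 := integrableOn_exp_neg_mul_cosh hr Real.continuous_sinh
    (by simpa using expGrowth_sinh 1 zero_le_one)
  have i2 := integrableOn_besselK hr 1
  simp only [Nat.cast_one, one_mul] at i2
  have h2 : besselK 1 r - ∫ t in Ioi (0:ℝ), Real.exp (-r * Real.cosh t) * Real.sinh t =
      ∫ t in Ioi (0:ℝ), Real.exp (-r * Real.cosh t) * Real.exp (-t) := by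
    simp only [besselK, Nat.cast_one, one_mul]
    rw [← integral_sub i2 i1]
    simp only [← mul_sub, Real.cosh_sub_sinh]
  have h3 : 0 ≤ ∫ t in Ioi (0:ℝ), Real.exp (-r * Real.cosh t) * Real.exp (-t) :=
    integral_nonneg fun t => by positivity
  have h4 : ∫ t in Ioi (0:ℝ), Real.exp (-r * Real.cosh t) * Real.exp (-t) ≤
      ∫ t in Ioi (0:ℝ), Real.exp (-t) := by
    refine setIntegral_mono_on ?_ (integrableOn_exp_neg_Ioi 0) measurableSet_Ioi fun t _ => ?_
    · exact integrableOn_exp_neg_mul_cosh hr (by fun_prop)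
        ⟨1, -1, fun t _ => by simp⟩
    · have : Real.exp (-r * Real.cosh t) ≤ 1 :=
        Real.exp_le_one_iff.2 (by nlinarith [Real.cosh_pos t])
      nlinarith [Real.exp_pos (-t)]
  have h5 : ∫ t in Ioi (0:ℝ), Real.exp (-t) = 1 := by simpa using integral_exp_neg_Ioi 0
  constructor <;> nlinarith

theorem tendsto_mul_besselK_one :
    Tendsto (fun r => r * besselK 1 r) (𝓝[>] 0) (𝓝 1) := by
  have h1 : Tendsto (fun r : ℝ => Real.exp (-r)) (𝓝[>] 0) (𝓝 1) := by
    have : Tendsto (fun r : ℝ => Real.exp (-r)) (𝓝 0) (𝓝 (Real.exp (-0))) :=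
      (by fun_prop : Continuous fun r : ℝ => Real.exp (-r)).tendsto 0
    rw [neg_zero, Real.exp_zero] at this
    exact this.mono_left nhdsWithin_le_nhds
  have h2 : Tendsto (fun r : ℝ => Real.exp (-r) + r) (𝓝[>] 0) (𝓝 1) := by
    simpa using h1.add (tendsto_id.mono_left nhdsWithin_le_nhds : Tendsto id (𝓝[>] (0:ℝ)) (𝓝 0))
  refine tendsto_of_tendsto_of_tendsto_of_le_of_le' h1 h2 ?_ ?_ <;>
  · filter_upwards [self_mem_nhdsWithin] with r hr
    first
    | exact (mul_besselK_one_bounds hr).1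
    | exact (mul_besselK_one_bounds hr).2

theorem tendsto_ratio_zero {n : ℕ} (hn : n ≠ 0) :
    Tendsto (fun r => r * besselK (n + 1) r / besselK n r) (𝓝[>] 0) (𝓝 (2 * n)) := by
  obtain ⟨m, rfl⟩ := Nat.exists_eq_succ_of_ne_zero hn
  have h0 : Tendsto (fun r : ℝ => r) (𝓝[>] 0) (𝓝 0) := tendsto_id.mono_left nhdsWithin_le_nhds
  rw [tendsto_iff_norm_sub_tendsto_zero]
  refine squeeze_zero' (Eventually.of_forall fun _ => norm_nonneg _) ?_ h0
  filter_upwards [self_mem_nhdsWithin] with r hr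
  have hr' : 0 < r := hr
  have hp := besselK_pos hr' (m + 1)
  have hp0 := besselK_pos hr' m
  have : r * besselK (m.succ + 1) r / besselK m.succ r - 2 * (m.succ : ℕ) =
      r * (besselK m r / besselK (m + 1) r) := by
    have h2 : besselK (m.succ + 1) r = _ := besselK_add_two hr' m
    rw [h2, Nat.succ_eq_add_one]
    push_cast
    field_simp
    ring
  rw [this, Real.norm_eq_abs, abs_of_nonneg (by positivity)]
  have h3 : besselK m r / besselK (m + 1) r ≤ 1 := (div_le_one hp).2 (besselK_le_succ hr' m)
  nlinarith

theorem tendsto_besselK_zero_atTop : Tendsto (besselK 0) (𝓝[>] 0) atTop := by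
  refine tendsto_atTop.2 fun M => ?_
  set T := |M| * Real.exp 1 with hT
  have hT0 : 0 ≤ T := by positivity
  have hc := Real.cosh_pos T
  filter_upwards [Ioo_mem_nhdsGT (show (0:ℝ) < 1 / Real.cosh T by positivity)] with r hr
  have i := integrableOn_besselK hr.1 0
  have h1 : ∫ t in Ioc 0 T, Real.exp (-1) ≤
      ∫ t in Ioc 0 T, Real.exp (-r * Real.cosh t) * Real.cosh ((0:ℕ) * t) := by
    refine setIntegral_mono_on (integrableOn_const (by simp)) (i.mono_set Ioc_subset_Ioi_self)
      measurableSet_Ioc fun t ht => ?_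
    have h2 : Real.cosh t ≤ Real.cosh T := by
      rw [Real.cosh_le_cosh, abs_of_pos ht.1, abs_of_nonneg hT0]; exact ht.2
    have h3 := (lt_div_iff₀ hc).1 hr.2
    have h4 : r * Real.cosh t ≤ r * Real.cosh T := mul_le_mul_of_nonneg_left h2 hr.1.le
    simp only [Nat.cast_zero, zero_mul, Real.cosh_zero, mul_one]
    exact Real.exp_le_exp.2 (by linarith)
  have h2 : ∫ t in Ioc 0 T, Real.exp (-r * Real.cosh t) * Real.cosh ((0:ℕ) * t) ≤ besselK 0 r :=
    setIntegral_mono_set i (Eventually.of_forall fun t =>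
      (mul_pos (Real.exp_pos _) (Real.cosh_pos _)).le) Ioc_subset_Ioi_self.eventuallyLE
  have h3 : ∫ t in Ioc 0 T, Real.exp (-1) = |M| := by
    rw [setIntegral_const, Measure.real, Real.volume_Ioc, sub_zero, ENNReal.toReal_ofReal hT0, hT,
      smul_eq_mul, mul_assoc, ← Real.exp_add]
    simp
  linarith [le_abs_self M]

theorem ratio_zero_bounds {r : ℝ} (hr : 0 < r) :
    -(1 / (8 * r)) ≤ r * (besselK 1 r / besselK 0 r) - r - 1 / 2 ∧
      r * (besselK 1 r / besselK 0 r) - r - 1 / 2 ≤ 0 := by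
  have hK := besselK_pos hr 0
  have hpos : ∀ t : ℝ, 0 < 1 + Real.cosh t := fun t => by linarith [Real.cosh_pos t]
  have hb : ∀ t : ℝ, |1 / (1 + Real.cosh t)| ≤ 1 := fun t => by
    rw [abs_of_pos (one_div_pos.2 (hpos t)), div_le_one (hpos t)]
    linarith [Real.cosh_pos t]
  have hcont : Continuous fun t : ℝ => 1 / (1 + Real.cosh t) :=
    continuous_const.div (by fun_prop) fun t => (hpos t).ne'
  have h := integral_sinh_mul_eq hr (g := fun t => Real.sinh t * (1 / (1 + Real.cosh t)))
    (g' := fun t => 1 / (1 + Real.cosh t))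
    (fun t => by
      have h1 := (Real.hasDerivAt_sinh t).mul
        ((hasDerivAt_const t (1:ℝ)).div ((Real.hasDerivAt_cosh t).const_add 1) (hpos t).ne')
      convert! h1 using 1
      have := Real.cosh_sq t
      have := (hpos t).ne'
      simp only [Pi.div_apply]
      field_simp
      nlinarith)
    hcont
    (ExpGrowth.mul (by simpa using expGrowth_sinh 1 zero_le_one)
      (expGrowth_of_bounded 1 fun t _ => hb t))
    (expGrowth_of_bounded 1 fun t _ => hb t)
  have i0 := integrableOn_exp_neg_mul_cosh hr continuous_const (expGrowth_const 1)
  have i1 := integrableOn_exp_neg_mul_cosh hr Real.continuous_cosh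
    (by simpa using expGrowth_cosh 1 zero_le_one)
  have i2 := integrableOn_exp_neg_mul_cosh hr hcont (expGrowth_of_bounded 1 fun t _ => hb t)
  have e0 : besselK 0 r = ∫ t in Ioi (0:ℝ), Real.exp (-r * Real.cosh t) * 1 := by simp [besselK]
  have e1 : besselK 1 r = ∫ t in Ioi (0:ℝ), Real.exp (-r * Real.cosh t) * Real.cosh t := by
    simp [besselK]
  have e2 : ∫ t in Ioi (0:ℝ), Real.exp (-r * Real.cosh t) *
      (Real.sinh t * (Real.sinh t * (1 / (1 + Real.cosh t)))) = besselK 1 r - besselK 0 r := by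
    rw [e0, e1, ← integral_sub i1 i0]
    refine integral_congr_ae (Eventually.of_forall fun t => ?_)
    have := Real.cosh_sq t
    have := (hpos t).ne'
    field_simp
    nlinarith
  rw [e2] at h
  simp only [Real.sinh_zero, zero_mul, mul_zero, zero_add] at h
  set J := ∫ t in Ioi (0:ℝ), Real.exp (-r * Real.cosh t) * (1 / (1 + Real.cosh t)) with hJ
  have hJ1 : J ≤ 1 / 2 * besselK 0 r := by
    rw [e0, ← integral_const_mul]
    refine setIntegral_mono i2 (i0.const_mul _) fun t => ?_
    have : 1 / (1 + Real.cosh t) ≤ 1 / 2 :=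
      one_div_le_one_div_of_le two_pos (by linarith [Real.one_le_cosh t])
    nlinarith [Real.exp_pos (-r * Real.cosh t)]
  have hJ2 : 1 / 2 * besselK 0 r - J ≤ 1 / 4 * (besselK 1 r - besselK 0 r) := by
    rw [e0, e1, ← integral_sub i1 i0, ← integral_const_mul, ← integral_const_mul,
      ← integral_sub (i0.const_mul _) i2]
    refine setIntegral_mono ((i0.const_mul _).sub i2) ((i1.sub i0).const_mul _) fun t => ?_
    have h1 : 1 / 2 - 1 / (1 + Real.cosh t) ≤ 1 / 4 * (Real.cosh t - 1) := by
      have h2 := Real.one_le_cosh t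
      have : 1 / 4 * (Real.cosh t - 1) - (1 / 2 - 1 / (1 + Real.cosh t)) =
          (Real.cosh t - 1) ^ 2 / (4 * (1 + Real.cosh t)) := by
        have := (hpos t).ne'
        field_simp
        ring
      have : 0 ≤ (Real.cosh t - 1) ^ 2 / (4 * (1 + Real.cosh t)) := by
        have := hpos t
        positivity
      linarith
    have := mul_le_mul_of_nonneg_left h1 (Real.exp_pos (-r * Real.cosh t)).le
    simp only []
    linarith
  have e3 : r * (besselK 1 r / besselK 0 r) - r - 1 / 2 =
      (J - 1 / 2 * besselK 0 r) / besselK 0 r := by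
    rw [← h]; field_simp
  rw [e3]
  constructor
  · rw [le_div_iff₀ hK]
    have h3 : besselK 1 r - besselK 0 r ≤ 1 / 2 * besselK 0 r / r := by
      rw [le_div_iff₀ hr]; linarith
    have h4 : -(1 / (8 * r)) * besselK 0 r = -(1 / 4 * (1 / 2 * besselK 0 r / r)) := by
      field_simp; norm_num
    rw [h4]
    linarith
  · exact div_nonpos_of_nonpos_of_nonneg (by linarith) hK.le

theorem tendsto_ratio_atTop (n : ℕ) :
    Tendsto (fun r => r * (besselK (n + 1) r / besselK n r) - r - (n + 1 / 2)) atTop (𝓝 0) := by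
  induction n with
  | zero =>
    have h1 : Tendsto (fun r : ℝ => -(1 / (8 * r))) atTop (𝓝 0) := by
      have := (tendsto_inv_atTop_zero (𝕜 := ℝ)).const_mul (-(1 / 8))
      rw [mul_zero] at this
      refine this.congr fun r => ?_
      rw [one_div, one_div, mul_inv]; ring
    refine tendsto_of_tendsto_of_tendsto_of_le_of_le' h1 tendsto_const_nhds ?_ ?_ <;>
    · filter_upwards [eventually_gt_atTop 0] with r hr
      have := ratio_zero_bounds hr
      norm_num at this ⊢
      linarith
  | succ n ih =>
    set q : ℝ → ℝ := fun r => besselK (n + 1) r / besselK n r with hq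
    have hinv := tendsto_inv_atTop_zero (𝕜 := ℝ)
    have hq1 : Tendsto q atTop (𝓝 1) := by
      have := (ih.add_const ((n:ℝ) + 1 / 2)).mul hinv
      simp only [mul_zero] at this
      have := this.add_const 1
      rw [zero_add] at this
      refine this.congr' ?_
      filter_upwards [eventually_gt_atTop 0] with r hr
      field_simp
      ring
    have h2 : Tendsto (fun r => -(r * q r - r - (n + 1 / 2) + (n + 1 / 2)) / q r + (n + 1 / 2))
        atTop (𝓝 (-(0 + (n + 1 / 2)) / 1 + (n + 1 / 2))) :=
      ((ih.add_const _).neg.div hq1 one_ne_zero).add_const _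
    have h0 : -(0 + ((n:ℝ) + 1 / 2)) / 1 + (n + 1 / 2) = 0 := by ring
    rw [h0] at h2
    refine h2.congr' ?_
    filter_upwards [eventually_gt_atTop 0] with r hr
    have hp := besselK_pos hr n
    have hp1 := besselK_pos hr (n + 1)
    have h3 : besselK (n + 1 + 1) r = _ := besselK_add_two hr n
    rw [h3, hq]
    push_cast
    field_simp
    ring

/-! ### Power series with coefficients bounded by `C / k!` -/

/-- The coefficients `a k` are `O(1 / k!)`. -/
def FactBdd (a : ℕ → ℂ) : Prop := ∃ C : ℝ, ∀ k, ‖a k‖ ≤ C / k.factorial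

/-- The sum of the power series with coefficients `a`. -/
noncomputable def pser (a : ℕ → ℂ) (w : ℂ) : ℂ := ∑' k, a k * w ^ k

/-- Coefficients of the derivative of a power series. -/
def dcoef (a : ℕ → ℂ) (k : ℕ) : ℂ := (k + 1) * a (k + 1)

/-- Coefficients of `w` times a power series. -/
def shiftCoef (a : ℕ → ℂ) : ℕ → ℂ
  | 0 => 0
  | k + 1 => a k

theorem FactBdd.dcoef {a : ℕ → ℂ} (ha : FactBdd a) : FactBdd (dcoef a) := by
  obtain ⟨C, hC⟩ := ha
  refine ⟨C, fun k => ?_⟩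
  have h : ‖((k:ℂ) + 1)‖ = (k:ℝ) + 1 := by
    have : ((k:ℂ) + 1) = ((k + 1 : ℕ) : ℂ) := by push_cast; rfl
    rw [this, Complex.norm_natCast]; push_cast; rfl
  rw [BesselKernel.dcoef, norm_mul, h]
  calc ((k:ℝ) + 1) * ‖a (k + 1)‖ ≤ (k + 1) * (C / (k + 1).factorial) := by
        gcongr; exact hC _
    _ = C / k.factorial := by
        rw [Nat.factorial_succ]; push_cast
        have : (k.factorial : ℝ) ≠ 0 := by positivity
        have : (k : ℝ) + 1 ≠ 0 := by positivity
        field_simp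

theorem FactBdd.summable {a : ℕ → ℂ} (ha : FactBdd a) (w : ℂ) :
    Summable fun k => a k * w ^ k := by
  obtain ⟨C, hC⟩ := ha
  refine Summable.of_norm_bounded ((Real.summable_pow_div_factorial ‖w‖).mul_left C) fun k => ?_
  rw [norm_mul, norm_pow]
  calc ‖a k‖ * ‖w‖ ^ k ≤ C / k.factorial * ‖w‖ ^ k := by gcongr; exact hC k
    _ = _ := by ring

theorem FactBdd.hasDerivAt {a : ℕ → ℂ} (ha : FactBdd a) (w : ℂ) :
    HasDerivAt (pser a) (pser (BesselKernel.dcoef a) w) w := by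
  obtain ⟨C, hC⟩ := id ha
  set R := ‖w‖ + 1
  have hu : Summable fun k : ℕ => C * (R ^ k / k.factorial) :=
    (Real.summable_pow_div_factorial R).mul_left C
  have hd : ∀ i : ℕ, DifferentiableOn ℂ (fun w : ℂ => a i * w ^ i) (Metric.ball 0 R) :=
    fun i => by fun_prop
  have hle : ∀ (i : ℕ) (w : ℂ), w ∈ Metric.ball (0:ℂ) R →
      ‖a i * w ^ i‖ ≤ C * (R ^ i / i.factorial) := fun i z hz => by
    have hz' : ‖z‖ ≤ R := by simpa using (mem_ball_zero_iff.1 hz).le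
    rw [norm_mul, norm_pow]
    have hC0 : 0 ≤ C / i.factorial := (norm_nonneg _).trans (hC i)
    calc ‖a i‖ * ‖z‖ ^ i ≤ C / i.factorial * R ^ i := by gcongr; exact hC i
      _ = _ := by ring
  have hw : w ∈ Metric.ball (0:ℂ) R := by simp [R]
  have h1 := Complex.hasSum_deriv_of_summable_norm hu hd Metric.isOpen_ball hle hw
  have h2 := (Complex.differentiableOn_tsum_of_summable_norm hu hd Metric.isOpen_ball hle
    ).differentiableAt (Metric.isOpen_ball.mem_nhds hw)
  have h3 : HasSum (fun i : ℕ => deriv (fun z : ℂ => a (i + 1) * z ^ (i + 1)) w)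
      (deriv (fun z : ℂ => ∑' i : ℕ, a i * z ^ i) w) := by
    rw [hasSum_nat_add_iff (f := fun i : ℕ => deriv (fun z : ℂ => a i * z ^ i) w)]
    simpa using h1
  have h4 : deriv (fun z : ℂ => ∑' i : ℕ, a i * z ^ i) w = pser (BesselKernel.dcoef a) w := by
    rw [← h3.tsum_eq, pser]
    refine tsum_congr fun k => ?_
    simp [BesselKernel.dcoef]
    ring
  rw [← h4]
  exact h2.hasDerivAt

theorem pser_zero (a : ℕ → ℂ) : pser a 0 = a 0 := by
  rw [pser, tsum_eq_single 0 fun k hk => by simp [hk]]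
  simp

theorem mul_pser {a : ℕ → ℂ} (ha : FactBdd a) (w : ℂ) : w * pser a w = pser (shiftCoef a) w := by
  have h : Summable fun k => shiftCoef a k * w ^ k := by
    rw [← summable_nat_add_iff 1]
    refine ((ha.summable w).mul_left w).congr fun k => ?_
    simp [shiftCoef]; ring
  rw [pser, pser, h.tsum_eq_zero_add, ← tsum_mul_left]
  simp only [shiftCoef, zero_mul, zero_add]
  exact tsum_congr fun k => by ring

theorem summable_shiftCoef {a : ℕ → ℂ} (ha : FactBdd a) (w : ℂ) :
    Summable fun k => shiftCoef a k * w ^ k := by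
  rw [← summable_nat_add_iff 1]
  refine ((ha.summable w).mul_left w).congr fun k => ?_
  simp [shiftCoef]; ring

/-! ### Entire Bessel functions in the logarithmic variable -/

/-- Coefficients of `I_n` as a power series in `(x / 2) ^ 2`, up to the factor `(x / 2) ^ n`. -/
noncomputable def coefI (n k : ℕ) : ℂ := 1 / (k.factorial * (n + k).factorial)

/-- Coefficients of the analytic part of `K_0` as a power series in `(x / 2) ^ 2`. -/
noncomputable def coefS (k : ℕ) : ℂ := (harmonic k : ℂ) / (k.factorial * k.factorial)

theorem factBdd_coefI (n : ℕ) : FactBdd (coefI n) := by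
  refine ⟨1, fun k => ?_⟩
  rw [coefI, norm_div, norm_one, norm_mul, Complex.norm_natCast, Complex.norm_natCast]
  have h1 : (1:ℝ) ≤ (n + k).factorial := by
    exact_mod_cast Nat.one_le_iff_ne_zero.2 (Nat.factorial_ne_zero _)
  have h2 : (0:ℝ) < k.factorial := by positivity
  gcongr
  nlinarith

theorem factBdd_coefS : FactBdd coefS := by
  have hH : ∀ k : ℕ, ‖(harmonic k : ℂ)‖ ≤ k.factorial := by
    intro k
    induction k with
    | zero => simp
    | succ k ih =>
      rcases k with _ | k
      · simp [harmonic_succ]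
      · have h1 : (harmonic (k + 1 + 1) : ℂ) = harmonic (k + 1) + ((k + 1 + 1 : ℕ) : ℂ)⁻¹ := by
          rw [harmonic_succ]; push_cast; rfl
        rw [h1]
        have h2 : ‖((k + 1 + 1 : ℕ) : ℂ)⁻¹‖ ≤ 1 := by
          rw [norm_inv, Complex.norm_natCast]
          exact inv_le_one_of_one_le₀ (by exact_mod_cast Nat.le_add_left 1 _)
        have h3 : (1:ℝ) ≤ (k + 1).factorial := by
          exact_mod_cast Nat.one_le_iff_ne_zero.2 (Nat.factorial_ne_zero _)
        have h4 : (((k + 1 + 1).factorial : ℕ) : ℝ) = (k + 1 + 1) * (k + 1).factorial := by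
          rw [Nat.factorial_succ]; push_cast; rfl
        rw [h4]
        have := norm_add_le (harmonic (k + 1) : ℂ) (((k + 1 + 1 : ℕ) : ℂ)⁻¹)
        have hk : (0:ℝ) ≤ k := k.cast_nonneg
        nlinarith
  refine ⟨1, fun k => ?_⟩
  rw [coefS, norm_div, norm_mul, Complex.norm_natCast]
  have h2 : (0:ℝ) < k.factorial := by positivity
  rw [div_le_div_iff₀ (by positivity) h2, one_mul]
  gcongr
  exact hH k

theorem dcoef_coefI (n : ℕ) : dcoef (coefI n) = coefI (n + 1) := by
  funext k
  have h : n + (k + 1) = n + 1 + k := by ring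
  have h1 : (k.factorial : ℂ) ≠ 0 := by exact_mod_cast Nat.factorial_ne_zero _
  have h2 : ((n + 1 + k).factorial : ℂ) ≠ 0 := by exact_mod_cast Nat.factorial_ne_zero _
  have h3 : (k : ℂ) + 1 ≠ 0 := by exact_mod_cast Nat.succ_ne_zero k
  rw [dcoef, coefI, coefI, h, Nat.factorial_succ]
  push_cast
  field_simp

theorem pser_coefI_recurrence (n : ℕ) (w : ℂ) :
    w * pser (coefI (n + 2)) w + (n + 1) * pser (coefI (n + 1)) w = pser (coefI n) w := by
  rw [mul_pser (factBdd_coefI _), pser, pser, pser, ← tsum_mul_left,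
    ← (summable_shiftCoef (factBdd_coefI _) w).tsum_add
      (((factBdd_coefI (n + 1)).summable w).mul_left _)]
  refine tsum_congr fun k => ?_
  rw [← mul_assoc, ← add_mul]
  congr 1
  rcases k with _ | k
  · have h2 : (n.factorial : ℂ) ≠ 0 := by exact_mod_cast Nat.factorial_ne_zero _
    have h3 : (n : ℂ) + 1 ≠ 0 := by exact_mod_cast Nat.succ_ne_zero n
    simp [shiftCoef, coefI, Nat.factorial_succ]
    field_simp
  · have h : n + 1 + (k + 1) = n + (k + 1) + 1 := by ring
    have h' : n + 2 + k = n + (k + 1) + 1 := by ring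
    have h1 : (k.factorial : ℂ) ≠ 0 := by exact_mod_cast Nat.factorial_ne_zero _
    have h2 : ((n + (k + 1)).factorial : ℂ) ≠ 0 := by exact_mod_cast Nat.factorial_ne_zero _
    have h3 : (k : ℂ) + 1 ≠ 0 := by exact_mod_cast Nat.succ_ne_zero k
    have h4 : (n : ℂ) + (k + 1) + 1 ≠ 0 := by exact_mod_cast Nat.succ_ne_zero (n + (k + 1))
    simp only [shiftCoef, coefI]
    rw [h, h', Nat.factorial_succ k, Nat.factorial_succ (n + (k + 1))]
    push_cast
    field_simp
    ring

theorem pser_coefS_ode (w : ℂ) :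
    pser (dcoef coefS) w + w * pser (dcoef (dcoef coefS)) w =
      pser coefS w + pser (coefI 1) w := by
  have hS := factBdd_coefS
  rw [mul_pser hS.dcoef.dcoef, pser, pser, pser, pser,
    ← (hS.dcoef.summable w).tsum_add (summable_shiftCoef hS.dcoef.dcoef w),
    ← (hS.summable w).tsum_add ((factBdd_coefI 1).summable w)]
  refine tsum_congr fun k => ?_
  rw [← add_mul, ← add_mul]
  congr 1
  have key : ((k:ℂ) + 1) * dcoef coefS k = coefS k + coefI 1 k := by
    have h : 1 + k = k + 1 := by ring
    have h1 : (k.factorial : ℂ) ≠ 0 := by exact_mod_cast Nat.factorial_ne_zero _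
    have h3 : (k : ℂ) + 1 ≠ 0 := by exact_mod_cast Nat.succ_ne_zero k
    rw [dcoef, coefS, coefS, coefI, h, harmonic_succ, Nat.factorial_succ]
    push_cast
    field_simp
  rw [← key]
  rcases k with _ | k
  · simp [shiftCoef]
  · simp only [shiftCoef]
    rw [dcoef.eq_def (dcoef coefS)]
    push_cast
    ring

/-- `I_n (exp ζ)`. -/
noncomputable def logI (n : ℕ) (ζ : ℂ) : ℂ :=
  (Complex.exp ζ / 2) ^ n * pser (coefI n) ((Complex.exp ζ / 2) ^ 2)

theorem logI_ofReal (n : ℕ) (x : ℝ) : logI n x = (besselI n (Real.exp x) : ℂ) := by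
  rw [logI, pser, besselI, Complex.ofReal_tsum, ← tsum_mul_left]
  refine tsum_congr fun k => ?_
  rw [coefI]
  push_cast
  rw [pow_add, pow_mul]
  ring

theorem hasDerivAt_half_exp (ζ : ℂ) :
    HasDerivAt (fun ζ : ℂ => Complex.exp ζ / 2) (Complex.exp ζ / 2) ζ :=
  (Complex.hasDerivAt_exp ζ).div_const 2

theorem hasDerivAt_pser_half_exp {a : ℕ → ℂ} (ha : FactBdd a) (ζ : ℂ) :
    HasDerivAt (fun ζ => pser a ((Complex.exp ζ / 2) ^ 2))
      (2 * (Complex.exp ζ / 2) ^ 2 * pser (dcoef a) ((Complex.exp ζ / 2) ^ 2)) ζ := by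
  have := (ha.hasDerivAt ((Complex.exp ζ / 2) ^ 2)).comp ζ ((hasDerivAt_half_exp ζ).pow 2)
  convert! this using 1
  ring

theorem hasDerivAt_logI (n : ℕ) (ζ : ℂ) :
    HasDerivAt (logI n) (n * logI n ζ + Complex.exp ζ * logI (n + 1) ζ) ζ := by
  have := ((hasDerivAt_half_exp ζ).pow n).mul (hasDerivAt_pser_half_exp (factBdd_coefI n) ζ)
  rw [dcoef_coefI] at this
  convert! this using 1
  rw [logI, logI]
  rcases n with _ | n
  · simp; ring
  · simp only [Pi.pow_apply, Nat.add_sub_cancel]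
    push_cast
    ring

theorem hasDerivAt_logI_succ (n : ℕ) (ζ : ℂ) :
    HasDerivAt (logI (n + 1)) (-(n + 1) * logI (n + 1) ζ + Complex.exp ζ * logI n ζ) ζ := by
  convert hasDerivAt_logI (n + 1) ζ using 1
  have h := pser_coefI_recurrence n ((Complex.exp ζ / 2) ^ 2)
  rw [logI, logI, logI, ← h]
  push_cast
  ring

theorem exp_add_pi_mul_I' (ζ : ℂ) : Complex.exp (ζ + Real.pi * Complex.I) = -Complex.exp ζ := by
  rw [Complex.exp_add, Complex.exp_pi_mul_I]; ring

theorem logI_add_pi (n : ℕ) (ζ : ℂ) :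
    logI n (ζ + Real.pi * Complex.I) = (-1) ^ n * logI n ζ := by
  rw [logI, logI, exp_add_pi_mul_I', neg_div, neg_sq, neg_pow]
  ring

theorem logI_add_two (n : ℕ) (ζ : ℂ) :
    logI (n + 2) ζ = logI n ζ - 2 * (n + 1) * Complex.exp (-ζ) * logI (n + 1) ζ := by
  have h := (hasDerivAt_logI (n + 1) ζ).unique (hasDerivAt_logI_succ n ζ)
  have he : Complex.exp (-ζ) * Complex.exp ζ = 1 := by rw [← Complex.exp_add]; simp
  push_cast at h
  have h2 : logI (n + 2) ζ = logI (n + 1 + 1) ζ := rfl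
  linear_combination Complex.exp (-ζ) * h + (logI n ζ - logI (n + 2) ζ) * he

/-- `K_0 (exp ζ)` up to a multiple of `I_0 (exp ζ)`. -/
noncomputable def preK (ζ : ℂ) : ℂ :=
  -ζ * logI 0 ζ + pser coefS ((Complex.exp ζ / 2) ^ 2)

/-- `K_1 (exp ζ)` up to a multiple of `I_1 (exp ζ)`. -/
noncomputable def preK₁ (ζ : ℂ) : ℂ :=
  Complex.exp (-ζ) * logI 0 ζ + ζ * logI 1 ζ
    - Complex.exp ζ / 2 * pser (dcoef coefS) ((Complex.exp ζ / 2) ^ 2)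

theorem hasDerivAt_preK (ζ : ℂ) : HasDerivAt preK (-Complex.exp ζ * preK₁ ζ) ζ := by
  have := ((hasDerivAt_id ζ).neg.mul (hasDerivAt_logI 0 ζ)).add
    (hasDerivAt_pser_half_exp factBdd_coefS ζ)
  convert! this using 1
  have he : Complex.exp (-ζ) * Complex.exp ζ = 1 := by rw [← Complex.exp_add]; simp
  simp only [preK₁, Pi.neg_apply, id]
  push_cast
  linear_combination (-logI 0 ζ) * he

theorem hasDerivAt_preK₁ (ζ : ℂ) :
    HasDerivAt preK₁ (-preK₁ ζ - Complex.exp ζ * preK ζ) ζ := by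
  have := ((((hasDerivAt_id ζ).neg.cexp).mul (hasDerivAt_logI 0 ζ)).add
    ((hasDerivAt_id ζ).mul (hasDerivAt_logI_succ 0 ζ))).sub
    ((hasDerivAt_half_exp ζ).mul (hasDerivAt_pser_half_exp factBdd_coefS.dcoef ζ))
  convert! this using 1
  have he : Complex.exp (-ζ) * Complex.exp ζ = 1 := by rw [← Complex.exp_add]; simp
  have h := pser_coefS_ode ((Complex.exp ζ / 2) ^ 2)
  have h1 : logI 1 ζ = Complex.exp ζ / 2 * pser (coefI 1) ((Complex.exp ζ / 2) ^ 2) := by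
    rw [logI, pow_one]
  simp only [preK₁, preK, Pi.neg_apply, id, zero_add]
  push_cast
  linear_combination (-logI 1 ζ) * he - 2 * h1 + Complex.exp ζ * h

/-- The candidate for `K_n (exp ζ)`, with an undetermined multiple `κ` of `I_n`. -/
noncomputable def logK (κ : ℂ) : ℕ → ℂ → ℂ
  | 0, ζ => preK ζ + κ * logI 0 ζ
  | 1, ζ => preK₁ ζ - κ * logI 1 ζ
  | n + 2, ζ => logK κ n ζ + 2 * (n + 1) * Complex.exp (-ζ) * logK κ (n + 1) ζ

theorem hasDerivAt_logK_pair (κ : ℂ) (n : ℕ) (ζ : ℂ) :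
    HasDerivAt (logK κ n) (n * logK κ n ζ - Complex.exp ζ * logK κ (n + 1) ζ) ζ ∧
    HasDerivAt (logK κ (n + 1))
      (-(n + 1) * logK κ (n + 1) ζ - Complex.exp ζ * logK κ n ζ) ζ := by
  induction n with
  | zero =>
    constructor
    · have := (hasDerivAt_preK ζ).add ((hasDerivAt_logI 0 ζ).const_mul κ)
      convert! this using 1
      simp only [logK, zero_add]; push_cast; ring
    · have := (hasDerivAt_preK₁ ζ).sub ((hasDerivAt_logI_succ 0 ζ).const_mul κ)
      convert! this using 1
      simp only [logK, zero_add]; push_cast; ring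
  | succ n ih =>
    obtain ⟨h0, h1⟩ := ih
    have he : Complex.exp (-ζ) * Complex.exp ζ = 1 := by rw [← Complex.exp_add]; simp
    constructor
    · convert h1 using 1
      simp only [logK]; push_cast
      linear_combination (-2 * (n + 1) * logK κ (n + 1) ζ) * he
    · have := h0.add ((((hasDerivAt_id ζ).neg.cexp).const_mul (2 * (n + 1) : ℂ)).mul h1)
      convert! this using 1
      simp only [logK, id, Pi.neg_apply]; push_cast
      linear_combination (2 * (n + 1) * logK κ n ζ) * he

theorem hasDerivAt_logK (κ : ℂ) (n : ℕ) (ζ : ℂ) :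
    HasDerivAt (logK κ n) (n * logK κ n ζ - Complex.exp ζ * logK κ (n + 1) ζ) ζ :=
  (hasDerivAt_logK_pair κ n ζ).1

theorem hasDerivAt_logK_succ (κ : ℂ) (n : ℕ) (ζ : ℂ) :
    HasDerivAt (logK κ (n + 1)) (-(n + 1) * logK κ (n + 1) ζ - Complex.exp ζ * logK κ n ζ) ζ :=
  (hasDerivAt_logK_pair κ n ζ).2

theorem logK_add_pi (κ : ℂ) (n : ℕ) (ζ : ℂ) :
    logK κ n (ζ + Real.pi * Complex.I) =
      (-1) ^ n * logK κ n ζ - Real.pi * Complex.I * logI n ζ := by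
  have hm : Complex.exp (-(ζ + Real.pi * Complex.I)) = -Complex.exp (-ζ) := by
    rw [neg_add, Complex.exp_add, Complex.exp_neg (Real.pi * Complex.I), Complex.exp_pi_mul_I]
    norm_num
  induction n using Nat.twoStepInduction with
  | zero =>
    simp only [logK, preK, logI_add_pi, exp_add_pi_mul_I', neg_div, neg_sq]
    ring
  | one =>
    simp only [logK, preK₁, logI_add_pi, exp_add_pi_mul_I', neg_div, neg_sq, hm]
    ring
  | more n h0 h1 =>
    rw [logI_add_two]
    simp only [logK]
    rw [h0, h1, hm]
    ring

theorem logK_sub_pi (κ : ℂ) (n : ℕ) (ζ : ℂ) :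
    logK κ n (ζ - Real.pi * Complex.I) =
      (-1) ^ n * logK κ n ζ + Real.pi * Complex.I * logI n ζ := by
  have h := logK_add_pi κ n (ζ - Real.pi * Complex.I)
  have h2 := logI_add_pi n (ζ - Real.pi * Complex.I)
  rw [sub_add_cancel] at h h2
  have h3 : ((-1:ℂ) ^ n) * (-1) ^ n = 1 := by rw [← mul_pow]; norm_num
  rw [h, h2]
  linear_combination (-logK κ n (ζ - Real.pi * Complex.I)) * h3

/-- The Wronskian relation, in recurrence form. -/
theorem logK_mul_logI_const (κ : ℂ) (n : ℕ) (ζ : ℂ) :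
    logK κ n ζ * logI (n + 1) ζ + logK κ (n + 1) ζ * logI n ζ =
      logK κ 0 ζ * logI 1 ζ + logK κ 1 ζ * logI 0 ζ := by
  induction n with
  | zero => rfl
  | succ n ih =>
    rw [← ih, logI_add_two]
    have : logK κ (n + 1 + 1) ζ =
      logK κ n ζ + 2 * (n + 1) * Complex.exp (-ζ) * logK κ (n + 1) ζ := by rw [logK]
    rw [this]
    ring

theorem logI_zero_eq (ζ : ℂ) : logI 0 ζ = pser (coefI 0) ((Complex.exp ζ / 2) ^ 2) := by
  rw [logI, pow_zero, one_mul]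

theorem logI_one_eq (ζ : ℂ) :
    logI 1 ζ = Complex.exp ζ / 2 * pser (coefI 1) ((Complex.exp ζ / 2) ^ 2) := by
  rw [logI, pow_one]

theorem FactBdd.continuous {a : ℕ → ℂ} (ha : FactBdd a) : Continuous (pser a) :=
  continuous_iff_continuousAt.2 fun w => (ha.hasDerivAt w).continuousAt

theorem tendsto_exp_half_atBot :
    Tendsto (fun x : ℝ => Complex.exp x / 2) atBot (𝓝 0) := by
  have h : Tendsto (fun x : ℝ => ((Real.exp x : ℝ) : ℂ) / 2) atBot (𝓝 (((0:ℝ):ℂ) / 2)) :=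
    ((Complex.continuous_ofReal.tendsto 0).comp Real.tendsto_exp_atBot).div_const 2
  simpa using h

/-- The Wronskian of `K_n` and `I_n`. -/
theorem wronskian (κ : ℂ) (n : ℕ) (ζ : ℂ) :
    Complex.exp ζ * (logK κ n ζ * logI (n + 1) ζ + logK κ (n + 1) ζ * logI n ζ) = 1 := by
  set W : ℂ → ℂ := fun ζ =>
    Complex.exp ζ * (logK κ 0 ζ * logI 1 ζ + logK κ 1 ζ * logI 0 ζ) with hW
  have hd : ∀ ζ, HasDerivAt W 0 ζ := fun ζ => by
    have := (Complex.hasDerivAt_exp ζ).mul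
      (((hasDerivAt_logK κ 0 ζ).mul (hasDerivAt_logI_succ 0 ζ)).add
        ((hasDerivAt_logK_succ κ 0 ζ).mul (hasDerivAt_logI 0 ζ)))
    convert! this using 1
    simp only [zero_add, Pi.add_apply, Pi.mul_apply]
    push_cast
    ring
  have hc : ∀ x y, W x = W y := is_const_of_deriv_eq_zero
    (fun ζ => (hd ζ).differentiableAt) fun ζ => (hd ζ).deriv
  set P : ℂ → ℂ := fun u => pser (coefI 0) (u ^ 2) ^ 2
    - 2 * u ^ 2 * pser (dcoef coefS) (u ^ 2) * pser (coefI 0) (u ^ 2)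
    + 2 * u * pser coefS (u ^ 2) * (u * pser (coefI 1) (u ^ 2)) with hP
  have hWP : ∀ ζ, W ζ = P (Complex.exp ζ / 2) := fun ζ => by
    have he : Complex.exp (-ζ) * Complex.exp ζ = 1 := by rw [← Complex.exp_add]; simp
    simp only [hW, hP, logK, preK, preK₁, logI_one_eq, logI_zero_eq]
    linear_combination pser (coefI 0) ((Complex.exp ζ / 2) ^ 2) ^ 2 * he
  have hPc : Continuous P := by
    have h0 := (factBdd_coefI 0).continuous
    have h1 := (factBdd_coefI 1).continuous
    have h2 := factBdd_coefS.continuous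
    have h3 := factBdd_coefS.dcoef.continuous
    fun_prop
  have hP0 : P 0 = 1 := by simp [hP, pser_zero, coefI]
  have h1 : Tendsto (fun x : ℝ => W x) atBot (𝓝 (P 0)) := by
    simp only [hWP]
    exact (hPc.tendsto 0).comp tendsto_exp_half_atBot
  have h2 : Tendsto (fun x : ℝ => W x) atBot (𝓝 (W ζ)) := by
    simp only [fun x : ℝ => hc x ζ]; exact tendsto_const_nhds
  rw [logK_mul_logI_const, ← hP0]
  exact tendsto_nhds_unique h2 h1

/-- Solutions `(f, f₁)` on the real line of the system satisfied by `K_0 (exp x)` and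
`K_1 (exp x)`. -/
structure BesselPair (f f₁ : ℝ → ℂ) : Prop where
  left : ∀ x : ℝ, HasDerivAt f (-Complex.exp x * f₁ x) x
  right : ∀ x : ℝ, HasDerivAt f₁ (-f₁ x - Complex.exp x * f x) x

theorem BesselPair.const {f f₁ g g₁ : ℝ → ℂ} (hf : BesselPair f f₁) (hg : BesselPair g g₁)
    (x y : ℝ) : Complex.exp x * (f x * g₁ x - f₁ x * g x) =
      Complex.exp y * (f y * g₁ y - f₁ y * g y) := by
  have hd : ∀ x : ℝ, HasDerivAt
      (fun x : ℝ => Complex.exp x * (f x * g₁ x - f₁ x * g x)) 0 x := fun x => by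
    have := ((Complex.hasDerivAt_exp (x:ℂ)).comp_ofReal).mul
      (((hf.left x).mul (hg.right x)).sub ((hf.right x).mul (hg.left x)))
    convert! this using 1
    simp only [Pi.sub_apply, Pi.mul_apply]
    ring
  exact is_const_of_deriv_eq_zero (f := fun x : ℝ => Complex.exp x * (f x * g₁ x - f₁ x * g x))
    (fun ζ => (hd ζ).differentiableAt) (fun ζ => (hd ζ).deriv) x y

theorem besselPair_logI : BesselPair (fun x => logI 0 x) (fun x => -logI 1 x) where
  left x := by
    convert! (hasDerivAt_logI 0 (x:ℂ)).comp_ofReal using 1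
    push_cast; ring
  right x := by
    convert! (hasDerivAt_logI_succ 0 (x:ℂ)).comp_ofReal.neg using 1
    push_cast; ring

theorem besselPair_preK : BesselPair (fun x => preK x) (fun x => preK₁ x) where
  left x := (hasDerivAt_preK x).comp_ofReal
  right x := (hasDerivAt_preK₁ x).comp_ofReal

theorem besselPair_besselK : BesselPair (fun x => (besselK 0 (Real.exp x) : ℂ))
    (fun x => (besselK 1 (Real.exp x) : ℂ)) where
  left x := by
    have := ((hasDerivAt_besselK (Real.exp_pos x) 0).comp x (Real.hasDerivAt_exp x)).ofReal_comp
    convert! this using 1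
    push_cast; simp; ring
  right x := by
    have := ((hasDerivAt_besselK_succ (Real.exp_pos x) 0).comp x
      (Real.hasDerivAt_exp x)).ofReal_comp
    convert! this using 1
    have : Complex.exp x ≠ 0 := Complex.exp_ne_zero _
    push_cast
    simp
    field_simp
    ring

theorem wronskian_besselK (x : ℝ) :
    Complex.exp x * (besselK 0 (Real.exp x) * logI 1 x + besselK 1 (Real.exp x) * logI 0 x)
      = 1 := by
  set W : ℝ → ℂ := fun x => Complex.exp x *
    (besselK 0 (Real.exp x) * logI 1 x + besselK 1 (Real.exp x) * logI 0 x) with hW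
  have hc : ∀ y, W y = W x := fun y => by
    have := besselPair_besselK.const besselPair_logI y x
    simp only [hW]
    linear_combination -this
  have hexp : Tendsto Real.exp atBot (𝓝[>] 0) :=
    tendsto_nhdsWithin_iff.2 ⟨Real.tendsto_exp_atBot, Eventually.of_forall Real.exp_pos⟩
  have h1 : Tendsto (fun x => Real.exp x * besselK 1 (Real.exp x)) atBot (𝓝 1) :=
    tendsto_mul_besselK_one.comp hexp
  have h1c : Tendsto (fun x => ((Real.exp x * besselK 1 (Real.exp x) : ℝ) : ℂ)) atBot (𝓝 1) := by
    have := (Complex.continuous_ofReal.tendsto 1).comp h1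
    rwa [Complex.ofReal_one] at this
  have hI0 : Tendsto (fun x : ℝ => logI 0 x) atBot (𝓝 1) := by
    have hc : Continuous fun u : ℂ => pser (coefI 0) (u ^ 2) := by
      have := (factBdd_coefI 0).continuous
      fun_prop
    have := (hc.tendsto 0).comp tendsto_exp_half_atBot
    simpa [Function.comp_def, ← logI_zero_eq, pser_zero, coefI] using this
  have hI1 : Tendsto (fun x : ℝ => logI 1 x) atBot (𝓝 0) := by
    have hc : Continuous fun u : ℂ => u * pser (coefI 1) (u ^ 2) := by
      have := (factBdd_coefI 1).continuous
      fun_prop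
    have := (hc.tendsto 0).comp tendsto_exp_half_atBot
    simpa [Function.comp_def, ← logI_one_eq, pser_zero, coefI] using this
  have hb : ∀ᶠ x in atBot, ‖((Real.exp x * besselK 0 (Real.exp x) : ℝ) : ℂ)‖ ≤ 2 := by
    filter_upwards [h1.eventually (gt_mem_nhds one_lt_two)] with x hx
    rw [Complex.norm_real, Real.norm_eq_abs, abs_of_pos
      (mul_pos (Real.exp_pos _) (besselK_pos (Real.exp_pos _) _))]
    refine (mul_le_mul_of_nonneg_left (besselK_le_succ (Real.exp_pos _) 0)
      (Real.exp_pos _).le).trans hx.le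
  have h2 : Tendsto (fun x : ℝ => ((Real.exp x * besselK 0 (Real.exp x) : ℝ) : ℂ) * logI 1 x)
      atBot (𝓝 0) := by
    rw [tendsto_zero_iff_norm_tendsto_zero]
    refine squeeze_zero' (g := fun x : ℝ => 2 * ‖logI 1 x‖)
      (Eventually.of_forall fun _ => norm_nonneg _) ?_ (by simpa using hI1.norm.const_mul 2)
    filter_upwards [hb] with x hx
    rw [norm_mul]
    gcongr
  have h3 : Tendsto W atBot (𝓝 (0 + 1 * 1)) := by
    refine (h2.add (h1c.mul hI0)).congr fun x => ?_
    simp only [hW]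
    push_cast
    ring
  have h4 : Tendsto W atBot (𝓝 (W x)) := by
    rw [show W = fun _ => W x from funext hc]; exact tendsto_const_nhds
  simpa using tendsto_nhds_unique h4 h3

theorem exists_logK_eq_besselK :
    ∃ κ : ℂ, ∀ (n : ℕ) (x : ℝ), logK κ n x = (besselK n (Real.exp x) : ℂ) := by
  set V : ℝ → ℂ := fun x => Complex.exp x *
    (besselK 0 (Real.exp x) * preK₁ x - besselK 1 (Real.exp x) * preK x)
  have hV : ∀ x, V x = V 0 := fun x => besselPair_besselK.const besselPair_preK x 0
  refine ⟨V 0, fun n x => ?_⟩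
  have h1 := wronskian_besselK x
  have h2 := wronskian 0 0 (x:ℂ)
  simp only [logK, zero_mul, add_zero, sub_zero, zero_add] at h2
  have hVx : V 0 = Complex.exp x *
    (besselK 0 (Real.exp x) * preK₁ x - besselK 1 (Real.exp x) * preK x) := (hV x).symm
  induction n using Nat.twoStepInduction with
  | zero =>
    simp only [logK]
    rw [hVx]
    linear_combination (-preK x) * h1 + besselK 0 (Real.exp x) * h2
  | one =>
    simp only [logK]
    rw [hVx]
    linear_combination (-preK₁ x) * h1 + besselK 1 (Real.exp x) * h2
  | more n h0 h1 =>
    simp only [logK]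
    rw [h0, h1, besselK_add_two (Real.exp_pos x) n]
    push_cast
    rw [Complex.exp_neg]
    field_simp

/-- The entire function `ζ ↦ K_n (exp ζ)`. -/
noncomputable def logBesselK (n : ℕ) : ℂ → ℂ := logK exists_logK_eq_besselK.choose n

theorem logBesselK_ofReal (n : ℕ) (x : ℝ) : logBesselK n x = (besselK n (Real.exp x) : ℂ) :=
  exists_logK_eq_besselK.choose_spec n x

/-- The derivative of `logBesselK n`. -/
noncomputable def derivLogBesselK (n : ℕ) (ζ : ℂ) : ℂ :=
  n * logBesselK n ζ - Complex.exp ζ * logBesselK (n + 1) ζ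

theorem hasDerivAt_logBesselK (n : ℕ) (ζ : ℂ) :
    HasDerivAt (logBesselK n) (derivLogBesselK n ζ) ζ :=
  hasDerivAt_logK _ n ζ

theorem hasDerivAt_derivLogBesselK (n : ℕ) (ζ : ℂ) :
    HasDerivAt (derivLogBesselK n) ((Complex.exp ζ ^ 2 + n ^ 2) * logBesselK n ζ) ζ := by
  have := ((hasDerivAt_logK exists_logK_eq_besselK.choose n ζ).const_mul (n : ℂ)).sub
    ((Complex.hasDerivAt_exp ζ).mul (hasDerivAt_logK_succ exists_logK_eq_besselK.choose n ζ))
  convert! this using 1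
  simp only [logBesselK]
  ring

theorem logBesselK_wronskian (n : ℕ) (ζ : ℂ) :
    logBesselK n ζ * (n * logI n ζ + Complex.exp ζ * logI (n + 1) ζ)
      - derivLogBesselK n ζ * logI n ζ = 1 := by
  rw [← wronskian exists_logK_eq_besselK.choose n ζ, derivLogBesselK]
  simp only [logBesselK]
  ring

theorem logBesselK_ne_zero_or (n : ℕ) (ζ : ℂ) :
    logBesselK n ζ ≠ 0 ∨ derivLogBesselK n ζ ≠ 0 := by
  by_contra! h
  have := logBesselK_wronskian n ζ
  rw [h.1, h.2] at this
  simp at this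

/-- The logarithmic derivative of `ζ ↦ K_n (exp ζ)`. -/
noncomputable def logDerivK (n : ℕ) (ζ : ℂ) : ℂ := derivLogBesselK n ζ / logBesselK n ζ

theorem hasDerivAt_logDerivK {n : ℕ} {ζ : ℂ} (h : logBesselK n ζ ≠ 0) :
    HasDerivAt (logDerivK n) (Complex.exp ζ ^ 2 + n ^ 2 - logDerivK n ζ ^ 2) ζ := by
  convert! (hasDerivAt_derivLogBesselK n ζ).div (hasDerivAt_logBesselK n ζ) h using 1
  rw [logDerivK]
  field_simp

theorem logDerivK_ofReal (n : ℕ) (x : ℝ) : logDerivK n x =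
    ((n - Real.exp x * besselK (n + 1) (Real.exp x) / besselK n (Real.exp x) : ℝ) : ℂ) := by
  have h : (besselK n (Real.exp x) : ℂ) ≠ 0 := by
    exact_mod_cast (besselK_pos (Real.exp_pos x) n).ne'
  rw [logDerivK, derivLogBesselK, logBesselK_ofReal, logBesselK_ofReal]
  push_cast
  field_simp

/-- A barrier for linear equations with a small perturbation. -/
theorem norm_le_of_barrier {u a r : ℝ → ℂ} {T δ L : ℝ} (hδ : 0 < δ)
    (hu : ∀ θ ∈ Icc 0 T, HasDerivAt u (a θ * u θ + r θ) θ) (h0 : ‖u 0‖ ≤ δ)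
    (ha : ∀ θ ∈ Icc 0 T, (a θ).re ≤ 0)
    (hr : ∀ θ ∈ Icc 0 T, ‖u θ‖ = δ * Real.exp (L * θ) → ‖r θ‖ < L * ‖u θ‖) :
    ∀ θ ∈ Icc 0 T, ‖u θ‖ ≤ δ * Real.exp (L * θ) := by
  intro θ hθ
  have hB : ∀ θ, HasDerivAt (fun θ => (δ * Real.exp (L * θ)) ^ 2)
      (2 * L * (δ * Real.exp (L * θ)) ^ 2) θ := fun θ => by
    have := ((((hasDerivAt_id θ).const_mul L).exp).const_mul δ).pow 2
    convert! this using 1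
    simp
    ring
  have key := image_le_of_deriv_right_lt_deriv_boundary (f := fun θ => ‖u θ‖ ^ 2)
    (f' := fun θ => 2 * inner ℝ (u θ) (a θ * u θ + r θ)) (a := 0) (b := T)
    (B := fun θ => (δ * Real.exp (L * θ)) ^ 2)
    (B' := fun θ => 2 * L * (δ * Real.exp (L * θ)) ^ 2)
    (fun θ hθ => (hu θ hθ).continuousAt.continuousWithinAt.norm.pow 2)
    (fun θ hθ => (hu θ (Ico_subset_Icc_self hθ)).norm_sq.hasDerivWithinAt)
    (by simpa using pow_le_pow_left₀ (norm_nonneg _) h0 2) hB ?_ hθ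
  · exact (sq_le_sq₀ (norm_nonneg _) (by positivity)).1 key
  · intro θ hθ h
    have hθ' := Ico_subset_Icc_self hθ
    have h' : ‖u θ‖ = δ * Real.exp (L * θ) :=
      (sq_eq_sq₀ (norm_nonneg _) (by positivity)).1 h
    have hpos : 0 < ‖u θ‖ := by rw [h']; positivity
    have h1 := hr θ hθ' h'
    have h2 : inner ℝ (u θ) (a θ * u θ) = (a θ).re * ‖u θ‖ ^ 2 := by
      rw [Complex.inner, ← Complex.normSq_eq_norm_sq, Complex.normSq_apply]
      simp
      ring
    have h3 := real_inner_le_norm (u θ) (r θ)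
    rw [← h', inner_add_right, h2]
    have h4 := mul_nonpos_of_nonpos_of_nonneg (ha θ hθ') (sq_nonneg ‖u θ‖)
    nlinarith

/-- The closed strip `|Im ζ| ≤ π`. -/
def strip : Set ℂ := {ζ | |ζ.im| ≤ Real.pi}

/-- The filter of `Re ζ → ∞` in the closed strip. -/
def stripTop : Filter ℂ := comap Complex.re atTop ⊓ 𝓟 strip

/-- The filter of `Re ζ → -∞` in the closed strip. -/
def stripBot : Filter ℂ := comap Complex.re atBot ⊓ 𝓟 strip

theorem eventually_stripTop {p : ℂ → Prop} :
    (∀ᶠ ζ in stripTop, p ζ) ↔ ∃ X : ℝ, ∀ ζ ∈ strip, X ≤ ζ.re → p ζ := by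
  rw [stripTop, eventually_inf_principal, eventually_comap, eventually_atTop]
  exact ⟨fun ⟨X, h⟩ => ⟨X, fun ζ hζ hX => h _ hX ζ rfl hζ⟩,
    fun ⟨X, h⟩ => ⟨X, fun b hb ζ hζ hs => h ζ hs (hζ ▸ hb)⟩⟩

theorem eventually_stripBot {p : ℂ → Prop} :
    (∀ᶠ ζ in stripBot, p ζ) ↔ ∃ X : ℝ, ∀ ζ ∈ strip, ζ.re ≤ X → p ζ := by
  rw [stripBot, eventually_inf_principal, eventually_comap, eventually_atBot]
  exact ⟨fun ⟨X, h⟩ => ⟨X, fun ζ hζ hX => h _ hX ζ rfl hζ⟩,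
    fun ⟨X, h⟩ => ⟨X, fun b hb ζ hζ hs => h ζ hs (hζ ▸ hb)⟩⟩

/-- Propagation of smallness from the real axis along vertical segments. -/
theorem norm_le_of_vertical {f α ρ : ℂ → ℂ} {δ L x : ℝ} (hδ : 0 < δ) (hL : 0 ≤ L)
    (hf : ∀ ζ ∈ strip, ζ.re = x → HasDerivAt f (α ζ * f ζ + ρ ζ) ζ) (h0 : ‖f x‖ ≤ δ)
    (hα : ∀ ζ ∈ strip, ζ.re = x →
      (0 ≤ ζ.im → 0 ≤ (α ζ).im) ∧ (ζ.im ≤ 0 → (α ζ).im ≤ 0))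
    (hρ : ∀ ζ ∈ strip, ζ.re = x → δ ≤ ‖f ζ‖ → ‖f ζ‖ ≤ δ * Real.exp (L * Real.pi) →
      ‖ρ ζ‖ < L * ‖f ζ‖) :
    ∀ ζ ∈ strip, ζ.re = x → ‖f ζ‖ ≤ δ * Real.exp (L * Real.pi) := by
  have key : ∀ σ : ℝ, |σ| = 1 → ∀ θ ∈ Icc 0 Real.pi,
      ‖f (x + σ * θ * Complex.I)‖ ≤ δ * Real.exp (L * θ) := by
    intro σ hσ
    have hσ2 : σ * σ = 1 := by rw [← abs_mul_abs_self, hσ, one_mul]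
    have hmem : ∀ θ ∈ Icc 0 Real.pi, (x + σ * θ * Complex.I : ℂ) ∈ strip := fun θ hθ => by
      simp [strip, abs_mul, hσ, abs_of_nonneg hθ.1, hθ.2]
    have hre : ∀ θ : ℝ, (x + σ * θ * Complex.I : ℂ).re = x := fun θ => by simp
    have him : ∀ θ : ℝ, (x + σ * θ * Complex.I : ℂ).im = σ * θ := fun θ => by simp
    refine norm_le_of_barrier (u := fun θ : ℝ => f (x + σ * θ * Complex.I))
      (a := fun θ => σ * Complex.I * α (x + σ * θ * Complex.I))
      (r := fun θ => σ * Complex.I * ρ (x + σ * θ * Complex.I)) hδ ?_ (by simpa using h0) ?_ ?_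
    · intro θ hθ
      have hp : HasDerivAt (fun θ : ℝ => (x + σ * θ * Complex.I : ℂ)) (σ * Complex.I) θ := by
        have := (((hasDerivAt_id (θ:ℂ)).const_mul (σ:ℂ)).mul_const Complex.I).const_add (x:ℂ)
        simpa using! this.comp_ofReal
      convert! (hf _ (hmem θ hθ) (hre θ)).comp θ hp using 1
      ring
    · intro θ hθ
      obtain ⟨h1, h2⟩ := hα _ (hmem θ hθ) (hre θ)
      rw [him] at h1 h2
      have h3 := hθ.1
      rcases eq_or_eq_neg_of_abs_eq hσ with rfl | rfl
      · simpa using h1 (by linarith)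
      · simpa using h2 (by linarith)
    · intro θ hθ h
      have e : ‖((σ : ℂ) * Complex.I * ρ (x + σ * θ * Complex.I))‖ =
        ‖ρ (x + σ * θ * Complex.I)‖ := by simp [hσ]
      rw [e]
      refine hρ _ (hmem θ hθ) (hre θ) ?_ ?_
      · rw [h]
        exact le_mul_of_one_le_right hδ.le (Real.one_le_exp (mul_nonneg hL hθ.1))
      · rw [h]
        have := hθ.2
        gcongr
  intro ζ hζ hx
  have hmono : δ * Real.exp (L * |ζ.im|) ≤ δ * Real.exp (L * Real.pi) := by
    have : |ζ.im| ≤ Real.pi := hζ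
    gcongr
  refine le_trans ?_ hmono
  rcases le_total 0 ζ.im with h | h
  · have := key 1 (by simp) |ζ.im| ⟨abs_nonneg _, hζ⟩
    rw [← hx] at this
    convert this using 2
    congr 1
    apply Complex.ext <;> simp [abs_of_nonneg h]
  · have := key (-1) (by simp) |ζ.im| ⟨abs_nonneg _, hζ⟩
    rw [← hx] at this
    convert this using 2
    congr 1
    apply Complex.ext <;> simp [abs_of_nonpos h]

theorem tendsto_logDerivK_ofReal_atTop (n : ℕ) :
    Tendsto (fun x : ℝ => logDerivK n x + Complex.exp x + 1 / 2) atTop (𝓝 0) := by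
  have h := ((Complex.continuous_ofReal.tendsto 0).comp
    ((tendsto_ratio_atTop n).comp Real.tendsto_exp_atTop)).neg
  simp only [Complex.ofReal_zero, neg_zero] at h
  refine h.congr fun x => ?_
  rw [logDerivK_ofReal]
  simp only [Function.comp]
  push_cast
  ring

theorem im_exp_sign {ζ : ℂ} (hζ : ζ ∈ strip) :
    (0 ≤ ζ.im → 0 ≤ (Complex.exp ζ).im) ∧ (ζ.im ≤ 0 → (Complex.exp ζ).im ≤ 0) := by
  have h := abs_le.1 (show |ζ.im| ≤ Real.pi from hζ)
  rw [Complex.exp_im]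
  exact ⟨fun h0 => mul_nonneg (Real.exp_pos _).le (Real.sin_nonneg_of_nonneg_of_le_pi h0 h.2),
    fun h0 => mul_nonpos_of_nonneg_of_nonpos (Real.exp_pos _).le
      (Real.sin_nonpos_of_nonpos_of_neg_pi_le h0 h.1)⟩

theorem tendsto_logDerivK_stripTop {n : ℕ} (hne : ∀ᶠ ζ in stripTop, logBesselK n ζ ≠ 0) :
    Tendsto (fun ζ => logDerivK n ζ + Complex.exp ζ + 1 / 2) stripTop (𝓝 0) := by
  rw [Metric.tendsto_nhds]
  intro ε hε
  obtain ⟨X₀, hX₀⟩ := eventually_stripTop.1 hne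
  set ν : ℂ := n ^ 2 - 1 / 4 with hν
  set δ : ℝ := min (1 / 2) (ε / 2) * Real.exp (-(3 * Real.pi)) with hδ
  have hδ0 : 0 < δ := by positivity
  have hδe : δ * Real.exp (3 * Real.pi) = min (1 / 2) (ε / 2) := by
    rw [hδ, mul_assoc, ← Real.exp_add]; simp
  have hδε : δ ≤ ε / 2 := by
    refine (le_mul_of_one_le_right hδ0.le (Real.one_le_exp
      (show 0 ≤ 3 * Real.pi by positivity))).trans ?_
    rw [hδe]; exact min_le_right _ _
  have hlim : ∀ᶠ x : ℝ in atTop, ‖ν‖ / Real.exp x < δ / 2 :=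
    (Real.tendsto_exp_atTop.const_div_atTop ‖ν‖).eventually (gt_mem_nhds (by positivity))
  have hstart : ∀ᶠ x : ℝ in atTop, ‖logDerivK n x + Complex.exp x + 1 / 2‖ < δ / 2 := by
    simpa using (tendsto_logDerivK_ofReal_atTop n).norm.eventually
      (gt_mem_nhds (show ‖(0:ℂ)‖ < δ / 2 by simpa using hδ0))
  obtain ⟨X, hX⟩ := eventually_atTop.1 ((hlim.and hstart).and (eventually_ge_atTop X₀))
  rw [eventually_stripTop]
  refine ⟨X, fun ζ₀ hζ₀ hx => ?_⟩
  obtain ⟨⟨h1, h2⟩, h3⟩ := hX _ hx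
  set x := ζ₀.re with hxdef
  have hνz : ∀ ζ : ℂ, ζ.re = x → ‖ν / Complex.exp ζ‖ < δ / 2 := fun ζ h => by
    rwa [norm_div, Complex.norm_exp, h]
  have hν2 : ∀ ζ : ℂ, ζ.re = x → ‖ν / (2 * Complex.exp ζ)‖ < δ / 4 := fun ζ h => by
    have h' : ν / (2 * Complex.exp ζ) = ν / Complex.exp ζ / 2 := by
      rw [mul_comm, div_mul_eq_div_div]
    have := hνz ζ h
    rw [h', norm_div, Complex.norm_ofNat]
    linarith
  have key := norm_le_of_vertical
    (f := fun ζ => logDerivK n ζ + Complex.exp ζ + 1 / 2 + ν / (2 * Complex.exp ζ))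
    (α := fun ζ => 2 * Complex.exp ζ + 1)
    (ρ := fun ζ => -(logDerivK n ζ + Complex.exp ζ + 1 / 2) ^ 2 - ν / Complex.exp ζ)
    (x := x) hδ0 (L := 3) (by norm_num) ?_ ?_ ?_ ?_ ζ₀ hζ₀ rfl
  · rw [hδe] at key
    have e : logDerivK n ζ₀ + Complex.exp ζ₀ + 1 / 2 =
      (logDerivK n ζ₀ + Complex.exp ζ₀ + 1 / 2 + ν / (2 * Complex.exp ζ₀))
        - ν / (2 * Complex.exp ζ₀) := by ring
    rw [dist_zero_right, e]
    refine (norm_sub_le _ _).trans_lt ?_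
    have := hν2 ζ₀ rfl
    have := min_le_right (1 / 2) (ε / 2)
    linarith
  · intro ζ hζ hre
    have hG := hasDerivAt_logDerivK (hX₀ ζ hζ (by rw [hre]; exact h3))
    have := ((hG.add (Complex.hasDerivAt_exp ζ)).add_const (1 / 2)).add
      ((((Complex.hasDerivAt_exp ζ).const_mul 2).inv
        (mul_ne_zero two_ne_zero (Complex.exp_ne_zero ζ))).const_mul ν)
    convert! this using 1
    have := Complex.exp_ne_zero ζ
    simp only [hν]
    field_simp
    ring
  · refine (norm_add_le _ _).trans ?_
    have := hν2 x (by simp)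
    linarith
  · intro ζ hζ _
    obtain ⟨h4, h5⟩ := im_exp_sign hζ
    have h6 : (2 * Complex.exp ζ + 1).im = 2 * (Complex.exp ζ).im := by simp
    rw [h6]
    exact ⟨fun h => by linarith [h4 h], fun h => by linarith [h5 h]⟩
  · intro ζ hζ hre hl hu
    rw [hδe] at hu
    set m := ‖logDerivK n ζ + Complex.exp ζ + 1 / 2 + ν / (2 * Complex.exp ζ)‖ with hm
    have e : logDerivK n ζ + Complex.exp ζ + 1 / 2 =
      (logDerivK n ζ + Complex.exp ζ + 1 / 2 + ν / (2 * Complex.exp ζ))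
        - ν / (2 * Complex.exp ζ) := by ring
    have h4 : ‖logDerivK n ζ + Complex.exp ζ + 1 / 2‖ ≤ m + δ / 4 := by
      rw [e]; exact (norm_sub_le _ _).trans (by have := hν2 ζ hre; linarith)
    have h5 := norm_sub_le (-(logDerivK n ζ + Complex.exp ζ + 1 / 2) ^ 2) (ν / Complex.exp ζ)
    rw [norm_neg, norm_pow] at h5
    have h6 := hνz ζ hre
    have h7 : m ≤ 1 / 2 := hu.trans (min_le_left _ _)
    have h8 := pow_le_pow_left₀ (norm_nonneg _) h4 2
    have h9 : (m + δ / 4) ^ 2 ≤ 2 * m := by nlinarith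
    linarith

theorem tendsto_logDerivK_ofReal_atBot (n : ℕ) :
    Tendsto (fun x : ℝ => logDerivK n x + n) atBot (𝓝 0) := by
  have hexp : Tendsto Real.exp atBot (𝓝[>] 0) :=
    tendsto_nhdsWithin_iff.2 ⟨Real.tendsto_exp_atBot, Eventually.of_forall Real.exp_pos⟩
  have h : Tendsto (fun r => r * besselK (n + 1) r / besselK n r) (𝓝[>] 0) (𝓝 (2 * n)) := by
    rcases eq_or_ne n 0 with rfl | hn
    · simpa using tendsto_mul_besselK_one.div_atTop tendsto_besselK_zero_atTop
    · exact tendsto_ratio_zero hn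
  have h2 := (Complex.continuous_ofReal.tendsto _).comp (((h.comp hexp).const_sub (2 * n : ℝ)))
  rw [sub_self, Complex.ofReal_zero] at h2
  refine h2.congr fun x => ?_
  rw [logDerivK_ofReal]
  simp only [Function.comp]
  push_cast
  ring

theorem tendsto_logDerivK_stripBot {n : ℕ} (hne : ∀ᶠ ζ in stripBot, logBesselK n ζ ≠ 0) :
    Tendsto (fun ζ => logDerivK n ζ + n) stripBot (𝓝 0) := by
  rw [Metric.tendsto_nhds]
  intro ε hε
  obtain ⟨X₀, hX₀⟩ := eventually_stripBot.1 hne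
  set δ : ℝ := min (1 / 2) (ε / 2) * Real.exp (-(1 * Real.pi)) with hδ
  have hδ0 : 0 < δ := by positivity
  have hδe : δ * Real.exp (1 * Real.pi) = min (1 / 2) (ε / 2) := by
    rw [hδ, mul_assoc, ← Real.exp_add]; simp
  have hlim : ∀ᶠ x : ℝ in atBot, Real.exp x ^ 2 < δ / 4 := by
    have := Real.tendsto_exp_atBot.pow 2
    rw [zero_pow two_ne_zero] at this
    exact this.eventually (gt_mem_nhds (by positivity))
  have hstart : ∀ᶠ x : ℝ in atBot, ‖logDerivK n x + n‖ < δ := by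
    simpa using (tendsto_logDerivK_ofReal_atBot n).norm.eventually
      (gt_mem_nhds (show ‖(0:ℂ)‖ < δ by simpa using hδ0))
  obtain ⟨X, hX⟩ := eventually_atBot.1 ((hlim.and hstart).and (eventually_le_atBot X₀))
  rw [eventually_stripBot]
  refine ⟨X, fun ζ₀ hζ₀ hx => ?_⟩
  obtain ⟨⟨h1, h2⟩, h3⟩ := hX _ hx
  set x := ζ₀.re with hxdef
  have key := norm_le_of_vertical
    (f := fun ζ => logDerivK n ζ + n) (α := fun _ => (2 * n : ℝ))
    (ρ := fun ζ => Complex.exp ζ ^ 2 - (logDerivK n ζ + n) ^ 2)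
    (x := x) hδ0 (L := 1) (by norm_num) ?_ h2.le ?_ ?_ ζ₀ hζ₀ rfl
  · rw [hδe] at key
    rw [dist_zero_right]
    have := min_le_right (1 / 2) (ε / 2)
    linarith
  · intro ζ hζ hre
    have hG := hasDerivAt_logDerivK (hX₀ ζ hζ (by rw [hre]; exact h3))
    convert! hG.add_const (n : ℂ) using 1
    push_cast
    ring
  · intro ζ _ _
    simp
  · intro ζ hζ hre hl hu
    rw [hδe] at hu
    set m := ‖logDerivK n ζ + n‖ with hm
    have h5 := norm_sub_le (Complex.exp ζ ^ 2) ((logDerivK n ζ + n) ^ 2)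
    rw [norm_pow, norm_pow, Complex.norm_exp, hre] at h5
    have h7 : m ≤ 1 / 2 := hu.trans (min_le_left _ _)
    nlinarith

theorem summable_besselI (n : ℕ) (r : ℝ) : Summable fun k : ℕ =>
    (r / 2) ^ (n + 2 * k) / ((k.factorial : ℝ) * (n + k).factorial) := by
  rw [← Complex.summable_ofReal]
  refine (((factBdd_coefI n).summable (((r : ℂ) / 2) ^ 2)).mul_left (((r : ℂ) / 2) ^ n)).congr
    fun k => ?_
  rw [coefI]
  push_cast
  rw [pow_add, pow_mul]
  ring

theorem le_besselI {r : ℝ} (hr : 0 < r) (n k : ℕ) :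
    (r / 2) ^ (n + 2 * k) / ((k.factorial : ℝ) * (n + k).factorial) ≤ besselI n r :=
  (summable_besselI n r).le_tsum k fun _ _ => by positivity

theorem besselI_pos {r : ℝ} (hr : 0 < r) (n : ℕ) : 0 < besselI n r :=
  lt_of_lt_of_le (by positivity) (le_besselI hr n 0)

theorem logBesselK_add_pi (n : ℕ) (x : ℝ) : logBesselK n (x + Real.pi * Complex.I) =
    (-1) ^ n * besselK n (Real.exp x) - Real.pi * Complex.I * besselI n (Real.exp x) := by
  rw [← logBesselK_ofReal, ← logI_ofReal]
  exact logK_add_pi _ n x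

theorem logBesselK_sub_pi (n : ℕ) (x : ℝ) : logBesselK n (x - Real.pi * Complex.I) =
    (-1) ^ n * besselK n (Real.exp x) + Real.pi * Complex.I * besselI n (Real.exp x) := by
  rw [← logBesselK_ofReal, ← logI_ofReal]
  exact logK_sub_pi _ n x

theorem logBesselK_add_pi_ne_zero (n : ℕ) (x : ℝ) :
    logBesselK n (x + Real.pi * Complex.I) ≠ 0 := fun h => by
  have e : ((-1) ^ n : ℂ) = (((-1) ^ n : ℝ) : ℂ) := by push_cast; rfl
  have := congrArg Complex.im h
  rw [logBesselK_add_pi, e] at this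
  have hI := besselI_pos (Real.exp_pos x) n
  simp [-Complex.ofReal_exp, -Complex.ofReal_pow, Real.pi_ne_zero, hI.ne'] at this

theorem logBesselK_sub_pi_ne_zero (n : ℕ) (x : ℝ) :
    logBesselK n (x - Real.pi * Complex.I) ≠ 0 := fun h => by
  have e : ((-1) ^ n : ℂ) = (((-1) ^ n : ℝ) : ℂ) := by push_cast; rfl
  have := congrArg Complex.im h
  rw [logBesselK_sub_pi, e] at this
  have hI := besselI_pos (Real.exp_pos x) n
  simp [-Complex.ofReal_exp, -Complex.ofReal_pow, Real.pi_ne_zero, hI.ne'] at this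

theorem exp_mem_slitPlane {ζ : ℂ} (h : |ζ.im| < Real.pi) : Complex.exp ζ ∈ Complex.slitPlane := by
  obtain ⟨h1, h2⟩ := abs_lt.1 h
  rw [Complex.mem_slitPlane_iff_arg, ← Complex.log_im, Complex.log_exp h1 h2.le]
  exact ⟨h2.ne, Complex.exp_ne_zero _⟩

theorem logBesselK_differentiable (n : ℕ) : Differentiable ℂ (logBesselK n) :=
  fun ζ => (hasDerivAt_logBesselK n ζ).differentiableAt

theorem apply_exp_eq_logBesselK {n : ℕ} {K : ℂ → ℂ} (hK : AnalyticOnNhd ℂ K Complex.slitPlane)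
    (hKval : ∀ x : ℝ, 0 < x → K (x : ℂ) = (besselK n x : ℂ)) {ζ : ℂ} (hζ : |ζ.im| < Real.pi) :
    K (Complex.exp ζ) = logBesselK n ζ := by
  set U : Set ℂ := {ζ | |ζ.im| < Real.pi}
  have hU : IsPreconnected U := by
    have : U = Complex.imLm ⁻¹' Ioo (-Real.pi) Real.pi := by
      ext ζ; simp [U, abs_lt]
    rw [this]
    exact ((convex_Ioo _ _).linear_preimage _).isPreconnected
  refine AnalyticOnNhd.eqOn_of_preconnected_of_frequently_eq (f := fun ζ => K (Complex.exp ζ))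
    (z₀ := 0) (U := U) ?_ ?_ hU (by simp [U, Real.pi_pos]) ?_ hζ
  · intro ζ h
    exact (hK _ (exp_mem_slitPlane h)).fun_comp (Complex.differentiable_exp.analyticAt ζ)
  · exact fun ζ _ => (logBesselK_differentiable n).analyticAt ζ
  · have h1 : Tendsto (fun x : ℝ => (x : ℂ)) (𝓝[≠] 0) (𝓝[≠] 0) := by
      refine tendsto_nhdsWithin_iff.2 ⟨?_, ?_⟩
      · exact (Complex.continuous_ofReal.tendsto' 0 0 (by simp)).mono_left nhdsWithin_le_nhds
      · filter_upwards [self_mem_nhdsWithin] with x hx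
        simpa using hx
    refine h1.frequently (Eventually.frequently (Eventually.of_forall fun x => ?_))
    rw [logBesselK_ofReal, ← hKval _ (Real.exp_pos x)]
    push_cast
    rfl

theorem logBesselK_eq_zero_iff {n m : ℕ} {K : ℂ → ℂ} (hK : AnalyticOnNhd ℂ K Complex.slitPlane)
    (hKval : ∀ x : ℝ, 0 < x → K (x : ℂ) = (besselK n x : ℂ)) {Z : Fin m → ℂ}
    (hZ : Set.range Z = {z : ℂ | z ∈ Complex.slitPlane ∧ K z = 0}) {ζ : ℂ} (hζ : ζ ∈ strip) :
    logBesselK n ζ = 0 ↔ ∃ j, Complex.exp ζ = Z j := by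
  rcases lt_or_eq_of_le (show |ζ.im| ≤ Real.pi from hζ) with h | h
  · rw [← apply_exp_eq_logBesselK hK hKval h]
    have : (Complex.exp ζ ∈ Set.range Z) ↔ K (Complex.exp ζ) = 0 := by
      rw [hZ]
      exact ⟨fun h => h.2, fun h' => ⟨exp_mem_slitPlane h, h'⟩⟩
    rw [← this, mem_range]
    simp [eq_comm]
  · have key : logBesselK n ζ ≠ 0 ∧ Complex.exp ζ = ((-Real.exp ζ.re : ℝ) : ℂ) := by
      rcases eq_or_eq_neg_of_abs_eq h with h | h
      · have e : ζ = ζ.re + Real.pi * Complex.I := by apply Complex.ext <;> simp [h]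
        rw [e]
        refine ⟨logBesselK_add_pi_ne_zero n _, ?_⟩
        rw [exp_add_pi_mul_I']
        simp
      · have e : ζ = ζ.re - Real.pi * Complex.I := by apply Complex.ext <;> simp [h]
        rw [e]
        refine ⟨logBesselK_sub_pi_ne_zero n _, ?_⟩
        rw [Complex.exp_sub, Complex.exp_pi_mul_I]
        simp [div_neg]
    refine ⟨fun h => absurd h key.1, fun ⟨j, hj⟩ => ?_⟩
    have hs : Z j ∈ {z : ℂ | z ∈ Complex.slitPlane ∧ K z = 0} := hZ ▸ mem_range_self j
    have := hs.1
    rw [← hj, key.2, Complex.ofReal_mem_slitPlane] at this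
    linarith [Real.exp_pos ζ.re]

theorem eventually_stripTop_ne_zero {n m : ℕ} {Z : Fin m → ℂ}
    (hz : ∀ ζ ∈ strip, logBesselK n ζ = 0 ↔ ∃ j, Complex.exp ζ = Z j) :
    ∀ᶠ ζ in stripTop, logBesselK n ζ ≠ 0 := by
  have h : ∀ᶠ x in atTop, ∀ j, ‖Z j‖ < Real.exp x := eventually_all.2 fun j =>
    Real.tendsto_exp_atTop.eventually (eventually_gt_atTop _)
  obtain ⟨X, hX⟩ := eventually_atTop.1 h
  refine eventually_stripTop.2 ⟨X, fun ζ hζ hx h0 => ?_⟩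
  obtain ⟨j, hj⟩ := (hz ζ hζ).1 h0
  have := hX _ hx j
  rw [← hj, Complex.norm_exp] at this
  exact this.false

theorem eventually_stripBot_ne_zero {n m : ℕ} {Z : Fin m → ℂ}
    (hz : ∀ ζ ∈ strip, logBesselK n ζ = 0 ↔ ∃ j, Complex.exp ζ = Z j) :
    ∀ᶠ ζ in stripBot, logBesselK n ζ ≠ 0 := by
  have h : ∀ᶠ x in atBot, ∀ j, Z j ≠ 0 → Real.exp x < ‖Z j‖ := eventually_all.2 fun j => by
    by_cases hj : Z j = 0
    · simp [hj]
    · filter_upwards [Real.tendsto_exp_atBot.eventually (gt_mem_nhds (norm_pos_iff.2 hj))]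
        with x hx _ using hx
  obtain ⟨X, hX⟩ := eventually_atBot.1 h
  refine eventually_stripBot.2 ⟨X, fun ζ hζ hx h0 => ?_⟩
  obtain ⟨j, hj⟩ := (hz ζ hζ).1 h0
  have := hX _ hx j (hj ▸ Complex.exp_ne_zero _)
  rw [← hj, Complex.norm_exp] at this
  exact this.false

/-- `K_n` has no zeros in the right half-plane. -/
theorem logBesselK_ne_zero_of_abs_im_lt {n : ℕ} (hne : ∀ᶠ ζ in stripTop, logBesselK n ζ ≠ 0)
    {ζ : ℂ} (hζ : |ζ.im| < Real.pi / 2) : logBesselK n ζ ≠ 0 := by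
  intro h0
  set θ := ζ.im with hθ
  obtain ⟨hl, hu⟩ := abs_lt.1 hζ
  have hζe : ζ = ζ.re + θ * Complex.I := (Complex.re_add_im ζ).symm
  rcases eq_or_ne θ 0 with hz | hz
  · rw [hζe, hz, Complex.ofReal_zero, zero_mul, add_zero, logBesselK_ofReal] at h0
    exact (besselK_pos (Real.exp_pos _) n).ne' (by exact_mod_cast h0)
  have hsin : 0 < Real.sin (2 * θ) * Real.sin θ := by
    rw [Real.sin_two_mul]
    have h1 : Real.sin θ ≠ 0 := fun h => hz
      ((Real.sin_eq_zero_iff_of_lt_of_lt (by linarith) (by linarith)).1 h)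
    have h2 := Real.cos_pos_of_mem_Ioo ⟨by linarith, hu⟩
    have h3 : 2 * Real.sin θ * Real.cos θ * Real.sin θ = 2 * Real.cos θ * (Real.sin θ) ^ 2 := by
      ring
    rw [h3]; positivity
  set J : ℝ → ℝ := fun x => Real.sin (2 * θ) *
    ((starRingEnd ℂ) (logBesselK n (x + θ * Complex.I)) *
      derivLogBesselK n (x + θ * Complex.I)).im with hJ
  have hline : ∀ x : ℝ, HasDerivAt (fun x : ℝ => (x + θ * Complex.I : ℂ)) 1 x := fun x => by
    simpa using! (((hasDerivAt_id (x:ℂ)).add_const (θ * Complex.I)).comp_ofReal)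
  have hd : ∀ x : ℝ, HasDerivAt J (Real.sin (2 * θ) * (Complex.normSq
      (logBesselK n (x + θ * Complex.I)) * (Real.exp (2 * x) * Real.sin (2 * θ)))) x := fun x => by
    have h1 := (hasDerivAt_logBesselK n _).comp x (hline x)
    have h2 := (hasDerivAt_derivLogBesselK n _).comp x (hline x)
    have h3 := (Complex.imCLM.hasFDerivAt.comp_hasDerivAt x (h1.star.mul h2)).const_mul
      (Real.sin (2 * θ))
    convert! h3 using 1
    have he : Complex.exp (x + θ * Complex.I) ^ 2 =
        Real.exp (2 * x) * (Real.cos (2 * θ) + Real.sin (2 * θ) * Complex.I) := by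
      rw [← Complex.exp_nat_mul, Nat.cast_ofNat, mul_add, ← mul_assoc, Complex.exp_add]
      push_cast
      rw [Complex.exp_mul_I]
    congr 1
    rw [Complex.normSq_apply, he]
    simp [-Complex.ofReal_sin, -Complex.ofReal_cos, -Complex.ofReal_exp, ← Complex.ofReal_natCast,
      ← Complex.ofReal_pow]
    ring
  have hmono : Monotone J := monotone_of_deriv_nonneg (fun x => (hd x).differentiableAt)
    fun x => by
      rw [(hd x).deriv]
      have : Real.sin (2 * θ) * (Complex.normSq (logBesselK n (x + θ * Complex.I)) *
        (Real.exp (2 * x) * Real.sin (2 * θ))) = (Real.sin (2 * θ)) ^ 2 *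
        (Complex.normSq (logBesselK n (x + θ * Complex.I)) * Real.exp (2 * x)) := by ring
      rw [this]
      exact mul_nonneg (sq_nonneg _) (mul_nonneg (Complex.normSq_nonneg _) (Real.exp_pos _).le)
  have hJ0 : J ζ.re = 0 := by
    simp only [hJ]
    rw [← hζe, h0]; simp
  have hasym := eventually_stripTop.1 (((tendsto_logDerivK_stripTop hne).eventually
    (Metric.ball_mem_nhds 0 one_pos)).and hne)
  obtain ⟨X, hX⟩ := hasym
  have hbig : ∀ᶠ x : ℝ in atTop, |Real.sin (2 * θ)| <
      Real.exp x * (Real.sin (2 * θ) * Real.sin θ) :=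
    (Real.tendsto_exp_atTop.atTop_mul_const hsin).eventually (eventually_gt_atTop _)
  obtain ⟨x, hx1, hx2, hx3⟩ := (hbig.and ((eventually_ge_atTop X).and
    (eventually_ge_atTop ζ.re))).exists
  have hJx : 0 ≤ J x := hJ0 ▸ hmono hx3
  set η : ℂ := x + θ * Complex.I with hη
  have hηs : η ∈ strip := by
    show |η.im| ≤ Real.pi
    simp [hη]
    linarith [Real.pi_pos]
  obtain ⟨h1, h2⟩ := hX η hηs (by simpa [hη] using hx2)
  have hG : derivLogBesselK n η = logDerivK n η * logBesselK n η := by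
    rw [logDerivK]; field_simp
  have hJe : J x = Complex.normSq (logBesselK n η) *
      (Real.sin (2 * θ) * (logDerivK n η).im) := by
    simp only [hJ]
    rw [← hη, hG, Complex.normSq_apply]
    simp
    ring
  have him : |(logDerivK n η).im + Real.exp x * Real.sin θ| < 1 := by
    rw [dist_zero_right] at h1
    have h3 := (Complex.abs_im_le_norm _).trans_lt h1
    have h4 : (Complex.exp η).im = Real.exp x * Real.sin θ := by
      rw [Complex.exp_im]; simp [hη]
    simpa [h4] using h3
  have hpos := Complex.normSq_pos.2 h2
  have hneg : Real.sin (2 * θ) * (logDerivK n η).im < 0 := by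
    have h5 : Real.sin (2 * θ) * ((logDerivK n η).im + Real.exp x * Real.sin θ) ≤
        |Real.sin (2 * θ)| := by
      refine (le_abs_self _).trans ?_
      rw [abs_mul]
      exact mul_le_of_le_one_right (abs_nonneg _) him.le
    nlinarith
  have := mul_neg_of_pos_of_neg hpos hneg
  linarith

/-! ### The branch-cut density -/

/-- The density `1 / (K_n ^ 2 + π ^ 2 I_n ^ 2)` on the branch cut. -/
noncomputable def cutDensity (n : ℕ) (r : ℝ) : ℝ :=
  1 / (besselK n r ^ 2 + Real.pi ^ 2 * besselI n r ^ 2)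

theorem cutDensity_pos (n : ℕ) {r : ℝ} (hr : 0 < r) : 0 < cutDensity n r := by
  have := besselK_pos hr n
  rw [cutDensity]; positivity

theorem continuousAt_besselI (n : ℕ) {r : ℝ} (hr : 0 < r) : ContinuousAt (besselI n) r := by
  have h : ContinuousAt (fun r : ℝ => (logI n (Real.log r : ℝ)).re) r := by
    have h1 := (hasDerivAt_logI n (Real.log r : ℝ)).continuousAt
    have h2 : ContinuousAt (fun r : ℝ => ((Real.log r : ℝ) : ℂ)) r :=
      Complex.continuous_ofReal.continuousAt.comp (Real.continuousAt_log hr.ne')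
    exact Complex.continuous_re.continuousAt.comp (ContinuousAt.comp (f := fun r : ℝ =>
      ((Real.log r : ℝ) : ℂ)) h1 h2)
  refine h.congr ?_
  filter_upwards [lt_mem_nhds hr] with x hx
  rw [logI_ofReal, Complex.ofReal_re, Real.exp_log hx]

theorem continuousOn_cutDensity (n : ℕ) : ContinuousOn (cutDensity n) (Ioi 0) := by
  intro r hr
  have hr' : 0 < r := hr
  refine ContinuousAt.continuousWithinAt ?_
  have h1 := (hasDerivAt_besselK hr' n).continuousAt
  have h2 := continuousAt_besselI n hr'
  have h3 := besselK_pos hr' n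
  exact continuousAt_const.div ((h1.pow 2).add (continuousAt_const.mul (h2.pow 2)))
    (by positivity)

theorem integrableOn_cutDensity (n : ℕ) : IntegrableOn (cutDensity n) (Ioi 0) := by
  have hm : ∀ s ⊆ Ioi (0:ℝ), MeasurableSet s →
      AEStronglyMeasurable (cutDensity n) (volume.restrict s) := fun s hs hms =>
    ((continuousOn_cutDensity n).mono hs).aestronglyMeasurable hms
  rw [← Ioc_union_Ioi_eq_Ioi (zero_le_one' ℝ), integrableOn_union]
  constructor
  · refine IntegrableOn.of_bound (by simp) (hm _ Ioc_subset_Ioi_self measurableSet_Ioc)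
      (1 / besselK n 1 ^ 2) ?_
    refine (ae_restrict_iff' measurableSet_Ioc).2 (Eventually.of_forall fun r hr => ?_)
    rw [Real.norm_eq_abs, abs_of_pos (cutDensity_pos n hr.1), cutDensity]
    have h1 := besselK_pos one_pos n
    have h2 := besselK_anti hr.1 hr.2 n
    refine one_div_le_one_div_of_le (by positivity) ?_
    have := pow_le_pow_left₀ h1.le h2 2
    nlinarith [sq_nonneg (Real.pi * besselI n r)]
  · set C : ℝ := (2 ^ (n + 2) * (n + 1).factorial) ^ 2
    refine Integrable.mono' ((integrableOn_Ioi_rpow_of_lt (by norm_num : (-2:ℝ) < -1)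
      one_pos).const_mul C) (hm _ (Ioi_subset_Ioi zero_le_one) measurableSet_Ioi) ?_
    refine (ae_restrict_iff' measurableSet_Ioi).2 (Eventually.of_forall fun r hr => ?_)
    have hr1 : (1:ℝ) < r := hr
    have hr0 : (0:ℝ) < r := zero_lt_one.trans hr1
    rw [Real.norm_eq_abs, abs_of_pos (cutDensity_pos n hr0), cutDensity]
    have h1 := le_besselI hr0 n 1
    have h2 : r / (2 ^ (n + 2) * (n + 1).factorial) ≤ besselI n r := by
      refine le_trans ?_ h1
      rw [div_pow, Nat.factorial_one, Nat.cast_one, one_mul, mul_one, div_div]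
      gcongr
      exact le_self_pow₀ hr1.le (by omega)
    have h3 := pow_le_pow_left₀ (by positivity) h2 2
    have h4 : 1 ≤ Real.pi ^ 2 := by nlinarith [Real.pi_gt_three]
    have h5 : r ^ 2 / C ≤ besselK n r ^ 2 + Real.pi ^ 2 * besselI n r ^ 2 := by
      rw [div_pow] at h3
      nlinarith [sq_nonneg (besselK n r), sq_nonneg (besselI n r)]
    have hC : 0 < C := by positivity
    calc 1 / (besselK n r ^ 2 + Real.pi ^ 2 * besselI n r ^ 2) ≤ 1 / (r ^ 2 / C) :=
          one_div_le_one_div_of_le (by positivity) h5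
      _ = C * r ^ (-2:ℝ) := by
          rw [Real.rpow_neg hr0.le, Real.rpow_ofNat, one_div_div]; rfl

/-! ### Removable singularities -/

theorem exists_analytic_extension {Φ : ℂ → ℂ} {S : Set ℂ}
    (h : ∀ a ∈ S, ∃ g, AnalyticAt ℂ g a ∧ Φ =ᶠ[𝓝[≠] a] g) :
    ∃ Ψ : ℂ → ℂ, (∀ a ∈ S, AnalyticAt ℂ Ψ a) ∧ ∀ a ∈ S, ContinuousAt Φ a → Ψ a = Φ a := by
  have key : ∀ {a : ℂ} {g : ℂ → ℂ}, ContinuousAt g a → Φ =ᶠ[𝓝[≠] a] g →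
      limUnder (𝓝[≠] a) Φ = g a := fun hg hΦ =>
    ((hg.tendsto.mono_left nhdsWithin_le_nhds).congr' hΦ.symm).limUnder_eq
  refine ⟨fun a => limUnder (𝓝[≠] a) Φ, fun a ha => ?_, fun a _ hc => key hc EventuallyEq.rfl⟩
  obtain ⟨g, hg, hΦ⟩ := h a ha
  refine hg.congr ?_
  have h1 : ∀ᶠ b in 𝓝 a, b ≠ a → ∀ᶠ c in 𝓝 b, Φ c = g c := by
    refine eventually_nhdsWithin_iff (s := {a}ᶜ).1 ?_
    filter_upwards [eventually_eventually_nhdsWithin.2 hΦ, self_mem_nhdsWithin] with b hb hba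
    rwa [isOpen_compl_singleton.nhdsWithin_eq hba] at hb
  filter_upwards [h1, hg.eventually_analyticAt] with b hb hgb
  rcases eq_or_ne b a with rfl | hba
  · exact (key hg.continuousAt hΦ).symm
  · exact (key hgb.continuousAt ((hb hba).filter_mono nhdsWithin_le_nhds)).symm

theorem analyticAt_dslope {f : ℂ → ℂ} {a : ℂ} (hf : AnalyticAt ℂ f a) :
    AnalyticAt ℂ (dslope f a) a := by
  obtain ⟨p, hp⟩ := hf
  exact ⟨_, hp.has_fpower_series_dslope_fslope⟩

/-- The quotient of two functions vanishing at `a` is analytic if the denominator has a simple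
zero. -/
theorem exists_analytic_div {f g : ℂ → ℂ} {a : ℂ} (hf : AnalyticAt ℂ f a) (hg : AnalyticAt ℂ g a)
    (hf0 : f a = 0) (hg0 : g a = 0) (hg1 : deriv g a ≠ 0) :
    ∃ q, AnalyticAt ℂ q a ∧ (fun ζ => f ζ / g ζ) =ᶠ[𝓝[≠] a] q := by
  refine ⟨fun ζ => dslope f a ζ / dslope g a ζ,
    (analyticAt_dslope hf).div (analyticAt_dslope hg) (by rwa [dslope_same]), ?_⟩
  filter_upwards [self_mem_nhdsWithin] with ζ hζ
  have h1 := sub_smul_dslope f a ζ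
  have h2 := sub_smul_dslope g a ζ
  rw [hf0, sub_zero, smul_eq_mul] at h1
  rw [hg0, sub_zero, smul_eq_mul] at h2
  rw [← h1, ← h2, mul_div_mul_left _ _ (sub_ne_zero.2 hζ)]

/-- Principal part of the logarithmic derivative at a simple zero. -/
theorem exists_analytic_logDeriv {f : ℂ → ℂ} {a : ℂ} (hf : AnalyticAt ℂ f a)
    (hf0 : f a = 0) (hf1 : deriv f a ≠ 0) :
    ∃ q, AnalyticAt ℂ q a ∧ (fun ζ => deriv f ζ / f ζ - 1 / (ζ - a)) =ᶠ[𝓝[≠] a] q := by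
  have hd := analyticAt_dslope hf
  refine ⟨fun ζ => deriv (dslope f a) ζ / dslope f a ζ,
    hd.deriv.div hd (by rwa [dslope_same]), ?_⟩
  have h0 : ∀ᶠ ζ in 𝓝 a, dslope f a ζ ≠ 0 :=
    hd.continuousAt.eventually_ne (by rwa [dslope_same])
  filter_upwards [self_mem_nhdsWithin, h0.filter_mono nhdsWithin_le_nhds,
    hd.eventually_analyticAt.filter_mono nhdsWithin_le_nhds] with ζ hζ hne han
  have hζ' : ζ - a ≠ 0 := sub_ne_zero.2 hζ
  have h1 : f = fun ζ => (ζ - a) * dslope f a ζ := by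
    funext ζ
    have h1 := sub_smul_dslope f a ζ
    rw [hf0, sub_zero, smul_eq_mul] at h1
    exact h1.symm
  have h2 : deriv f ζ = dslope f a ζ + (ζ - a) * deriv (dslope f a) ζ := by
    conv_lhs => rw [h1]
    have := ((hasDerivAt_id ζ).sub_const a).mul han.differentiableAt.hasDerivAt
    simpa using! this.deriv
  have h3 : f ζ = (ζ - a) * dslope f a ζ := congrFun h1 ζ
  rw [h2, h3]
  field_simp
  ring

section

/-- `Z` lists without repetition the values of `exp` at the zeros of `logBesselK n` in the closed
strip. -/
structure IsZeroSet (n : ℕ) {m : ℕ} (Z : Fin m → ℂ) : Prop where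
  inj : Function.Injective Z
  ne_zero : ∀ j, Z j ≠ 0
  iff : ∀ ζ ∈ strip, logBesselK n ζ = 0 ↔ ∃ j, Complex.exp ζ = Z j

/-- The logarithmic derivative of `K_n` in the logarithmic variable, with the growth at infinity
and the poles removed. -/
noncomputable def regPart (n : ℕ) {m : ℕ} (Z : Fin m → ℂ) (ζ : ℂ) : ℂ :=
  logDerivK n ζ + Complex.exp ζ + 1 / 2 - ∑ j, Z j / (Complex.exp ζ - Z j)

/-- The integrand of the contour integral. -/
noncomputable def contourFun (n : ℕ) {m : ℕ} (Z : Fin m → ℂ) (w ζ : ℂ) : ℂ :=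
  (regPart n Z ζ - regPart n Z (Complex.log w)) * Complex.exp ζ / (Complex.exp ζ - w)

theorem deriv_logBesselK (n : ℕ) : deriv (logBesselK n) = derivLogBesselK n :=
  funext fun ζ => (hasDerivAt_logBesselK n ζ).deriv

theorem analyticAt_logBesselK (n : ℕ) (ζ : ℂ) : AnalyticAt ℂ (logBesselK n) ζ :=
  (logBesselK_differentiable n).analyticAt ζ

theorem analyticAt_derivLogBesselK (n : ℕ) (ζ : ℂ) : AnalyticAt ℂ (derivLogBesselK n) ζ := by
  rw [← deriv_logBesselK]
  exact (analyticAt_logBesselK n ζ).deriv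

theorem analyticAt_exp (a : ℂ) : AnalyticAt ℂ Complex.exp a :=
  Complex.differentiable_exp.analyticAt a

theorem log_mem_strip (w : ℂ) : Complex.log w ∈ strip := by
  show |(Complex.log w).im| ≤ Real.pi
  rw [Complex.log_im]; exact Complex.abs_arg_le_pi w

variable {n m : ℕ} {Z : Fin m → ℂ} {w : ℂ}

theorem IsZeroSet.log_ne_zero (h : IsZeroSet n Z) (hw : 0 < w.re) :
    logBesselK n (Complex.log w) ≠ 0 := by
  refine logBesselK_ne_zero_of_abs_im_lt (eventually_stripTop_ne_zero h.iff) ?_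
  rw [Complex.log_im]
  exact Complex.abs_arg_lt_pi_div_two_iff.2 (Or.inl hw)

theorem IsZeroSet.ne_of_re_pos (h : IsZeroSet n Z) (hw : 0 < w.re) (j : Fin m) : Z j ≠ w := by
  intro hj
  refine h.log_ne_zero hw ((h.iff _ (log_mem_strip w)).2 ⟨j, ?_⟩)
  rw [hj, Complex.exp_log]
  rintro rfl
  simp at hw

theorem IsZeroSet.analyticAt_regPart (h : IsZeroSet n Z) {a : ℂ} (ha : a ∈ strip)
    (hF : logBesselK n a ≠ 0) : AnalyticAt ℂ (regPart n Z) a := by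
  have h1 : ∀ j, Complex.exp a - Z j ≠ 0 := fun j hj =>
    hF ((h.iff a ha).2 ⟨j, sub_eq_zero.1 hj⟩)
  have h2 : AnalyticAt ℂ (logDerivK n) a :=
    (analyticAt_derivLogBesselK n a).div (analyticAt_logBesselK n a) hF
  refine ((h2.add (analyticAt_exp a)).add analyticAt_const).sub ?_
  exact Finset.analyticAt_fun_sum _ fun j _ =>
    analyticAt_const.div ((analyticAt_exp a).sub analyticAt_const) (h1 j)

theorem IsZeroSet.analyticAt_contourFun (h : IsZeroSet n Z) {a : ℂ} (ha : a ∈ strip)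
    (hF : logBesselK n a ≠ 0) (hw : Complex.exp a ≠ w) : AnalyticAt ℂ (contourFun n Z w) a :=
  (((h.analyticAt_regPart ha hF).sub analyticAt_const).mul (analyticAt_exp a)).div
    ((analyticAt_exp a).sub analyticAt_const) (sub_ne_zero.2 hw)

theorem IsZeroSet.exists_analytic_regPart (h : IsZeroSet n Z) {a : ℂ} (ha : a ∈ strip)
    (hF : logBesselK n a = 0) :
    ∃ g, AnalyticAt ℂ g a ∧ regPart n Z =ᶠ[𝓝[≠] a] g := by
  obtain ⟨i, hi⟩ := (h.iff a ha).1 hF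
  have hfd : ∀ ζ, HasDerivAt (fun ζ => Complex.exp ζ - Z i) (Complex.exp ζ) ζ := fun ζ =>
    (Complex.hasDerivAt_exp ζ).sub_const _
  obtain ⟨q₁, hq₁, he₁⟩ := exists_analytic_logDeriv (analyticAt_logBesselK n a) hF (by
    rw [deriv_logBesselK]
    exact (logBesselK_ne_zero_or n a).resolve_left (not_not.2 hF))
  obtain ⟨q₂, hq₂, he₂⟩ := exists_analytic_logDeriv (f := fun ζ => Complex.exp ζ - Z i)
    ((analyticAt_exp a).sub analyticAt_const) (by simp [hi])
    (by rw [(hfd a).deriv]; exact Complex.exp_ne_zero a)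
  refine ⟨fun ζ => q₁ ζ - q₂ ζ + 1 + Complex.exp ζ + 1 / 2
    - ∑ j ∈ Finset.univ.erase i, Z j / (Complex.exp ζ - Z j), ?_, ?_⟩
  · refine ((((hq₁.sub hq₂).add analyticAt_const).add (analyticAt_exp a)).add
      analyticAt_const).sub ?_
    refine Finset.analyticAt_fun_sum _ fun j hj =>
      analyticAt_const.div ((analyticAt_exp a).sub analyticAt_const) ?_
    rw [hi, sub_ne_zero]
    exact fun hij => (Finset.mem_erase.1 hj).1 (h.inj hij.symm)
  · have hne : ∀ᶠ ζ in 𝓝[≠] a, Complex.exp ζ - Z i ≠ 0 :=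
      (hfd a).eventually_ne (Complex.exp_ne_zero a)
    filter_upwards [he₁, he₂, hne] with ζ h1 h2 h3
    rw [regPart, ← h1, ← h2, ← Finset.add_sum_erase _ _ (Finset.mem_univ i), deriv_logBesselK,
      (hfd ζ).deriv, logDerivK]
    have h4 : Complex.exp ζ / (Complex.exp ζ - Z i) = 1 + Z i / (Complex.exp ζ - Z i) := by
      field_simp; ring
    rw [h4]
    ring

theorem eq_log_of_exp_eq {a : ℂ} (ha : a ∈ strip) (hw : 0 < w.re) (h : Complex.exp a = w) :
    a = Complex.log w := by
  obtain ⟨h1, h2⟩ := abs_le.1 (show |a.im| ≤ Real.pi from ha)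
  rcases h1.lt_or_eq with h1 | h1
  · rw [← h, Complex.log_exp h1 h2]
  · have : (Complex.exp a).re = Real.exp a.re * Real.cos a.im := Complex.exp_re a
    rw [h, ← h1, Real.cos_neg, Real.cos_pi] at this
    linarith [Real.exp_pos a.re]

theorem IsZeroSet.exists_analytic_contourFun (h : IsZeroSet n Z) (hw : 0 < w.re) {a : ℂ}
    (ha : a ∈ strip) : ∃ g, AnalyticAt ℂ g a ∧ contourFun n Z w =ᶠ[𝓝[≠] a] g := by
  by_cases hF : logBesselK n a = 0
  · obtain ⟨g, hg, he⟩ := h.exists_analytic_regPart ha hF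
    have hne : Complex.exp a ≠ w := by
      obtain ⟨i, hi⟩ := (h.iff a ha).1 hF
      rw [hi]
      exact h.ne_of_re_pos hw i
    refine ⟨fun ζ => (g ζ - regPart n Z (Complex.log w)) * Complex.exp ζ / (Complex.exp ζ - w),
      ((hg.sub analyticAt_const).mul (analyticAt_exp a)).div
        ((analyticAt_exp a).sub analyticAt_const) (sub_ne_zero.2 hne), ?_⟩
    filter_upwards [he] with ζ hζ
    rw [contourFun, hζ]
  · by_cases hew : Complex.exp a = w
    · have hal := eq_log_of_exp_eq ha hw hew
      have hd : HasDerivAt (fun ζ => Complex.exp ζ - w) (Complex.exp a) a :=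
        (Complex.hasDerivAt_exp a).sub_const _
      exact exists_analytic_div
        (((h.analyticAt_regPart ha hF).sub analyticAt_const).mul (analyticAt_exp a))
        ((analyticAt_exp a).sub analyticAt_const) (by simp [hal]) (by simp [hew])
        (by rw [hd.deriv]; exact Complex.exp_ne_zero a)
    · exact ⟨_, h.analyticAt_contourFun ha hF hew, EventuallyEq.rfl⟩

theorem tendsto_exp_stripTop : Tendsto Complex.exp stripTop (Bornology.cobounded ℂ) :=
  Complex.tendsto_exp_comap_re_atTop.mono_left inf_le_left

theorem tendsto_exp_stripBot : Tendsto Complex.exp stripBot (𝓝 0) :=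
  Complex.tendsto_exp_comap_re_atBot.mono_left inf_le_left

theorem tendsto_div_exp_sub_stripTop (z z' : ℂ) :
    Tendsto (fun ζ => z / (Complex.exp ζ - z')) stripTop (𝓝 0) := by
  have h : Tendsto (fun ζ => Complex.exp ζ - z') stripTop (Bornology.cobounded ℂ) := by
    simpa [sub_eq_add_neg, Function.comp_def] using
      (tendsto_add_const_cobounded (-z')).comp tendsto_exp_stripTop
  simpa [div_eq_mul_inv] using (tendsto_inv₀_cobounded.comp h).const_mul z

theorem IsZeroSet.tendsto_contourFun_stripTop (h : IsZeroSet n Z) :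
    Tendsto (contourFun n Z w) stripTop (𝓝 (-regPart n Z (Complex.log w))) := by
  have h1 : Tendsto (regPart n Z) stripTop (𝓝 0) := by
    have := (tendsto_logDerivK_stripTop (eventually_stripTop_ne_zero h.iff)).sub
      (tendsto_finsetSum Finset.univ fun j _ => tendsto_div_exp_sub_stripTop (Z j) (Z j))
    rw [Finset.sum_const_zero, sub_zero] at this
    exact this
  have h2 := (h1.sub_const (regPart n Z (Complex.log w))).mul
    ((tendsto_div_exp_sub_stripTop w w).const_add 1)
  rw [zero_sub, add_zero, mul_one] at h2
  refine h2.congr' ?_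
  have h3 : ∀ᶠ ζ in stripTop, Complex.exp ζ ≠ w :=
    tendsto_exp_stripTop.eventually (Bornology.eventually_ne_cobounded w)
  filter_upwards [h3] with ζ hζ
  have := sub_ne_zero.2 hζ
  rw [contourFun]
  field_simp
  ring

theorem IsZeroSet.tendsto_contourFun_stripBot (h : IsZeroSet n Z) (hw : w ≠ 0) :
    Tendsto (contourFun n Z w) stripBot (𝓝 0) := by
  have hj : ∀ j, Tendsto (fun ζ => Z j / (Complex.exp ζ - Z j)) stripBot
      (𝓝 (Z j / (0 - Z j))) := fun j =>
    tendsto_const_nhds.div (tendsto_exp_stripBot.sub_const _) (by simpa using h.ne_zero j)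
  have h1 : Tendsto (regPart n Z) stripBot
      (𝓝 (0 - n + 0 + 1 / 2 - ∑ j, Z j / (0 - Z j))) := by
    refine (((((tendsto_logDerivK_stripBot (eventually_stripBot_ne_zero h.iff)).sub_const
      (n : ℂ)).add tendsto_exp_stripBot).add_const (1 / 2)).sub
      (tendsto_finsetSum Finset.univ fun j _ => hj j)).congr fun ζ => ?_
    rw [regPart]
    ring
  have h2 := ((h1.sub_const (regPart n Z (Complex.log w))).mul tendsto_exp_stripBot).div
    (tendsto_exp_stripBot.sub_const w) (by simpa using hw)
  rw [mul_zero, zero_div] at h2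
  exact h2

end

section

variable {n m : ℕ} {Z : Fin m → ℂ} {w : ℂ}

theorem exp_sub_pi_mul_I' (ζ : ℂ) : Complex.exp (ζ - Real.pi * Complex.I) = -Complex.exp ζ := by
  rw [Complex.exp_sub, Complex.exp_pi_mul_I, div_neg, div_one]

theorem logDerivK_sub_pi_sub_add_pi (n : ℕ) (x : ℝ) :
    logDerivK n (x - Real.pi * Complex.I) - logDerivK n (x + Real.pi * Complex.I)
      = 2 * Real.pi * Complex.I * (-1) ^ n * cutDensity n (Real.exp x) := by
  have hp := logBesselK_add_pi_ne_zero n x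
  have hm := logBesselK_sub_pi_ne_zero n x
  have hd : ((besselK n (Real.exp x) ^ 2 + Real.pi ^ 2 * besselI n (Real.exp x) ^ 2 : ℝ) : ℂ)
      ≠ 0 := by
    have := besselK_pos (Real.exp_pos x) n
    exact_mod_cast (by positivity : 0 < besselK n (Real.exp x) ^ 2
      + Real.pi ^ 2 * besselI n (Real.exp x) ^ 2).ne'
  have hW := logBesselK_wronskian n x
  have he : ((-1 : ℂ) ^ n) * (-1) ^ n = 1 := by rw [← mul_pow]; simp
  rw [logDerivK, logDerivK, div_sub_div _ _ hm hp, div_eq_iff (mul_ne_zero hm hp)]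
  simp only [derivLogBesselK, exp_add_pi_mul_I', exp_sub_pi_mul_I', logBesselK_add_pi,
    logBesselK_sub_pi, cutDensity] at *
  rw [logBesselK_ofReal, logBesselK_ofReal, logI_ofReal, logI_ofReal] at hW
  push_cast at *
  generalize (besselK n (Real.exp x) : ℂ) = A at *
  generalize (besselI n (Real.exp x) : ℂ) = B at *
  generalize (besselK (n + 1) (Real.exp x) : ℂ) = A' at *
  generalize (besselI (n + 1) (Real.exp x) : ℂ) = B' at *
  generalize hε : (-1 : ℂ) ^ n = ε at *
  rw [pow_succ, hε]
  have hI := Complex.I_sq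
  generalize Complex.I = i at *
  generalize (Real.pi : ℂ) = p at *
  generalize Complex.exp x = r at *
  have h2 : (ε * A + p * i * B) * (ε * A - p * i * B) = A ^ 2 + p ^ 2 * B ^ 2 := by
    linear_combination A ^ 2 * he - p ^ 2 * B ^ 2 * hI
  rw [h2, mul_assoc _ (1 / _), one_div_mul_cancel hd]
  linear_combination 2 * p * i * ε * hW

theorem contourFun_sub_pi_sub_add_pi (hw : 0 < w.re) (x : ℝ) :
    contourFun n Z w (x - Real.pi * Complex.I) - contourFun n Z w (x + Real.pi * Complex.I)
      = 2 * Real.pi * Complex.I * (-1) ^ n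
        * (Real.exp x • ((cutDensity n (Real.exp x) : ℂ) / (Real.exp x + w))) := by
  have h : ((Real.exp x : ℝ) : ℂ) + w ≠ 0 := fun h => by
    have := congrArg Complex.re h
    rw [Complex.add_re, Complex.ofReal_re, Complex.zero_re] at this
    linarith [Real.exp_pos x]
  have h' : -((Real.exp x : ℝ) : ℂ) - w ≠ 0 := fun h0 => h (by linear_combination -h0)
  have hk := logDerivK_sub_pi_sub_add_pi n x
  simp only [contourFun, regPart, exp_add_pi_mul_I', exp_sub_pi_mul_I', ← Complex.ofReal_exp]
  rw [Complex.real_smul, div_sub_div_same, div_eq_iff h']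
  have h3 : ((Real.exp x : ℝ) : ℂ) * ((cutDensity n (Real.exp x) : ℂ) / (Real.exp x + w))
      * (-((Real.exp x : ℝ) : ℂ) - w) = -(Real.exp x : ℝ) * cutDensity n (Real.exp x) := by
    field_simp
    ring
  rw [mul_assoc, h3]
  linear_combination (-(Real.exp x : ℝ) : ℂ) * hk

theorem norm_inv_add_le (hw : 0 < w.re) {r : ℝ} (hr : 0 ≤ r) : ‖((r : ℂ) + w)⁻¹‖ ≤ w.re⁻¹ := by
  rw [norm_inv]
  refine inv_anti₀ hw (le_trans ?_ (Complex.re_le_norm _))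
  simpa using hr

theorem integrableOn_cutDensity_div (n : ℕ) (hw : 0 < w.re) :
    IntegrableOn (fun r : ℝ => (cutDensity n r : ℂ) / (r + w)) (Ioi 0) := by
  refine ((integrableOn_cutDensity n).ofReal (𝕜 := ℂ)).mul_bdd (c := w.re⁻¹) ?_ ?_
  · exact (((Complex.measurable_ofReal).add_const w).inv).aestronglyMeasurable
  · exact (ae_restrict_iff' measurableSet_Ioi).2 (Eventually.of_forall fun r hr =>
      norm_inv_add_le hw (le_of_lt hr))

theorem integrable_comp_exp {E : Type*} [NormedAddCommGroup E] [NormedSpace ℝ E] {f : ℝ → E}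
    (hf : IntegrableOn f (Ioi 0)) : Integrable fun x => Real.exp x • f (Real.exp x) := by
  have := (integrableOn_image_iff_integrableOn_abs_deriv_smul (f := Real.exp) (f' := Real.exp)
    MeasurableSet.univ (fun x _ => (Real.hasDerivAt_exp x).hasDerivWithinAt)
    Real.exp_injective.injOn f).1 (by rwa [image_univ, Real.range_exp])
  simpa using this

theorem integral_comp_exp {E : Type*} [NormedAddCommGroup E] [NormedSpace ℝ E] (f : ℝ → E) :
    ∫ x, Real.exp x • f (Real.exp x) = ∫ r in Ioi 0, f r := by
  have := integral_image_eq_integral_abs_deriv_smul (f := Real.exp) (f' := Real.exp)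
    MeasurableSet.univ (fun x _ => (Real.hasDerivAt_exp x).hasDerivWithinAt)
    Real.exp_injective.injOn f
  rw [image_univ, Real.range_exp] at this
  simpa using this.symm

/-- Integrals over vertical sides of the strip converge when the integrand does. -/
theorem tendsto_integral_vertical {f : ℂ → ℂ} {L : ℂ} {l : Filter ℂ} {x : ℝ → ℝ}
    (hf : ContinuousOn f strip) (hl : Tendsto f l (𝓝 L))
    (hx : ∀ p : ℂ → Prop, (∀ᶠ ζ in l, p ζ) →
      ∀ᶠ R in atTop, ∀ y ∈ Icc (-Real.pi) Real.pi, p ((x R : ℝ) + y * Complex.I)) :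
    Tendsto (fun R => ∫ y in (-Real.pi)..Real.pi, f ((x R : ℝ) + y * Complex.I)) atTop
      (𝓝 (2 * Real.pi * L)) := by
  have hpi : -Real.pi ≤ Real.pi := by linarith [Real.pi_pos]
  rw [Metric.tendsto_nhds]
  intro ε hε
  have hδ : 0 < ε / (4 * Real.pi) := by positivity
  filter_upwards [hx _ (Metric.tendsto_nhds.1 hl _ hδ)] with R hR
  have hc : IntervalIntegrable (fun y : ℝ => f ((x R : ℝ) + y * Complex.I)) volume
      (-Real.pi) Real.pi := by
    refine ContinuousOn.intervalIntegrable ?_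
    rw [uIcc_of_le hpi]
    refine hf.comp (by fun_prop) fun y hy => ?_
    show |(((x R : ℝ) : ℂ) + y * Complex.I).im| ≤ Real.pi
    simpa using abs_le.2 hy
  have h1 : (∫ y in (-Real.pi)..Real.pi, f ((x R : ℝ) + y * Complex.I)) - 2 * Real.pi * L
      = ∫ y in (-Real.pi)..Real.pi, (f ((x R : ℝ) + y * Complex.I) - L) := by
    rw [intervalIntegral.integral_sub hc intervalIntegrable_const, intervalIntegral.integral_const,
      Complex.real_smul]
    push_cast
    ring
  rw [dist_eq_norm, h1]
  refine (intervalIntegral.norm_integral_le_of_norm_le_const (C := ε / (4 * Real.pi))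
    fun y hy => ?_).trans_lt ?_
  · rw [uIoc_of_le hpi] at hy
    rw [← dist_eq_norm]
    exact (hR y (Ioc_subset_Icc_self hy)).le
  · rw [sub_neg_eq_add, abs_of_pos (by positivity)]
    field_simp
    linarith

theorem IsZeroSet.regPart_log (h : IsZeroSet n Z) (hw : 0 < w.re) :
    regPart n Z (Complex.log w)
      = (-1) ^ n * ∫ r in Ioi (0:ℝ), (cutDensity n r : ℂ) / (r + w) := by
  have hpi := Real.pi_pos
  have hw0 : w ≠ 0 := by rintro rfl; simp at hw
  obtain ⟨Ψ, hΨ, hΨΦ⟩ := exists_analytic_extension (Φ := contourFun n Z w) (S := strip)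
    fun a ha => h.exists_analytic_contourFun hw ha
  have heq : ∀ a ∈ strip, logBesselK n a ≠ 0 → Complex.exp a ≠ w → Ψ a = contourFun n Z w a :=
    fun a ha hF he => hΨΦ a ha (h.analyticAt_contourFun ha hF he).continuousAt
  have hcont : ContinuousOn Ψ strip := fun a ha => (hΨ a ha).continuousAt.continuousWithinAt
  have hstrip : ∀ (x y : ℝ), y ∈ Icc (-Real.pi) Real.pi → (x : ℂ) + y * Complex.I ∈ strip :=
    fun x y hy => by
      show |((x : ℂ) + y * Complex.I).im| ≤ Real.pi
      simpa using abs_le.2 hy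
  have htop : Tendsto Ψ stripTop (𝓝 (-regPart n Z (Complex.log w))) := by
    refine h.tendsto_contourFun_stripTop.congr' ?_
    have hs : ∀ᶠ ζ in stripTop, ζ ∈ strip := mem_inf_of_right (mem_principal_self _)
    filter_upwards [hs, eventually_stripTop_ne_zero h.iff,
      tendsto_exp_stripTop.eventually (Bornology.eventually_ne_cobounded w)] with ζ h1 h2 h3
    exact (heq ζ h1 h2 h3).symm
  have hbot : Tendsto Ψ stripBot (𝓝 0) := by
    refine (h.tendsto_contourFun_stripBot hw0).congr' ?_
    have hs : ∀ᶠ ζ in stripBot, ζ ∈ strip := mem_inf_of_right (mem_principal_self _)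
    filter_upwards [hs, eventually_stripBot_ne_zero h.iff,
      tendsto_exp_stripBot.eventually_ne hw0.symm] with ζ h1 h2 h3
    exact (heq ζ h1 h2 h3).symm
  have hright := tendsto_integral_vertical (x := fun R => R) hcont htop fun p hp => by
    obtain ⟨X, hX⟩ := eventually_stripTop.1 hp
    filter_upwards [eventually_ge_atTop X] with R hR y hy
    exact hX _ (hstrip R y hy) (by simpa using hR)
  have hleft := tendsto_integral_vertical (x := fun R => -R) hcont hbot fun p hp => by
    obtain ⟨X, hX⟩ := eventually_stripBot.1 hp
    filter_upwards [eventually_ge_atTop (-X)] with R hR y hy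
    exact hX _ (hstrip (-R) y hy) (by simpa using neg_le.1 hR)
  have hexp : ∀ x : ℝ, -Complex.exp x ≠ w := fun x hx => by
    rw [← hx, ← Complex.ofReal_exp, Complex.neg_re, Complex.ofReal_re] at hw
    linarith [Real.exp_pos x]
  have hmem : ∀ x : ℝ, (x : ℂ) - Real.pi * Complex.I ∈ strip
      ∧ (x : ℂ) + Real.pi * Complex.I ∈ strip := fun x => by
    constructor
    · simpa [sub_eq_add_neg] using hstrip x (-Real.pi) ⟨le_rfl, by linarith⟩
    · exact hstrip x Real.pi ⟨by linarith, le_rfl⟩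
  have hhor : ∀ x : ℝ, Ψ (x - Real.pi * Complex.I) - Ψ (x + Real.pi * Complex.I)
      = 2 * Real.pi * Complex.I * (-1) ^ n
        * (Real.exp x • ((cutDensity n (Real.exp x) : ℂ) / (Real.exp x + w))) := fun x => by
    rw [← contourFun_sub_pi_sub_add_pi (Z := Z) hw,
      heq _ (hmem x).1 (logBesselK_sub_pi_ne_zero n x),
      heq _ (hmem x).2 (logBesselK_add_pi_ne_zero n x)]
    · rw [exp_add_pi_mul_I']; exact hexp x
    · rw [exp_sub_pi_mul_I']; exact hexp x
  have hInt := integrable_comp_exp (integrableOn_cutDensity_div n hw)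
  have hJ := (intervalIntegral_tendsto_integral (l := atTop) hInt
    (tendsto_neg_atTop_atBot (G := ℝ)) tendsto_id).const_mul
    (2 * Real.pi * Complex.I * (-1) ^ n)
  have hzero : ∀ R : ℝ, 2 * Real.pi * Complex.I * (-1) ^ n
        * (∫ x in (-R)..R, Real.exp x • ((cutDensity n (Real.exp x) : ℂ) / (Real.exp x + w)))
      + Complex.I * (∫ y in (-Real.pi)..Real.pi, Ψ ((R : ℝ) + y * Complex.I))
      - Complex.I * (∫ y in (-Real.pi)..Real.pi, Ψ ((-R : ℝ) + y * Complex.I)) = 0 := fun R => by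
    have := Complex.integral_boundary_rect_eq_zero_of_differentiableOn Ψ
      ((-R : ℝ) + (-Real.pi : ℝ) * Complex.I) ((R : ℝ) + (Real.pi : ℝ) * Complex.I) fun a ha => by
        refine (hΨ a ?_).differentiableAt.differentiableWithinAt
        have h2 : a.im ∈ uIcc (-Real.pi) Real.pi := by simpa using ha.2
        rw [uIcc_of_le (by linarith)] at h2
        exact abs_le.2 h2
    simp only [Complex.add_re, Complex.add_im, Complex.ofReal_re, Complex.ofReal_im,
      Complex.re_ofReal_mul, Complex.im_ofReal_mul, Complex.I_re, Complex.I_im, mul_zero, mul_one,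
      add_zero, zero_add, smul_eq_mul] at this
    rw [← intervalIntegral.integral_sub] at this
    · rw [← this, ← intervalIntegral.integral_const_mul]
      congr 2
      refine intervalIntegral.integral_congr fun x _ => ?_
      simp only [← hhor, Complex.ofReal_neg, neg_mul, sub_eq_add_neg]
    · refine Continuous.intervalIntegrable (hcont.comp_continuous (by fun_prop) fun x => ?_) _ _
      exact hstrip x (-Real.pi) ⟨le_rfl, by linarith⟩
    · refine Continuous.intervalIntegrable (hcont.comp_continuous (by fun_prop) fun x => ?_) _ _
      exact hstrip x Real.pi ⟨by linarith, le_rfl⟩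
  have hlim := (hJ.add (hright.const_mul Complex.I)).sub (hleft.const_mul Complex.I)
  have hlim' := tendsto_nhds_unique hlim (tendsto_const_nhds.congr fun R => (hzero R).symm)
  rw [integral_comp_exp fun r : ℝ => (cutDensity n r : ℂ) / (r + w)] at hlim'
  have h2pi : (2 * Real.pi * Complex.I : ℂ) ≠ 0 := Complex.two_pi_I_ne_zero
  refine mul_left_cancel₀ h2pi ?_
  linear_combination -hlim'

theorem IsZeroSet.logDerivK_log (h : IsZeroSet n Z) (hw : 0 < w.re) :
    logDerivK n (Complex.log w) + w + 1 / 2 = ∑ j, Z j / (w - Z j)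
      + (-1) ^ n * ∫ r in Ioi (0:ℝ), (cutDensity n r : ℂ) / (r + w) := by
  have hw0 : w ≠ 0 := by rintro rfl; simp at hw
  rw [← h.regPart_log hw, regPart, Complex.exp_log hw0]
  ring

end

section

/-! ### Laplace transforms -/

theorem exp_neg_mul_mul_exp (s a : ℂ) (t : ℝ) :
    Complex.exp (-s * t) * Complex.exp (a * t) = Complex.exp ((a - s) * t) := by
  rw [← Complex.exp_add]; ring_nf

theorem integrableOn_laplace_exp {s a : ℂ} (h : a.re < s.re) :
    IntegrableOn (fun t : ℝ => Complex.exp (-s * t) * Complex.exp (a * t)) (Ioi 0) := by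
  simp only [exp_neg_mul_mul_exp]
  exact integrableOn_exp_mul_complex_Ioi (by simpa using h) 0

theorem laplace_exp {s a : ℂ} (h : a.re < s.re) :
    laplace (fun t => Complex.exp (a * t)) s = 1 / (s - a) := by
  simp only [laplace, exp_neg_mul_mul_exp]
  rw [integral_exp_mul_complex_Ioi (by simpa using h)]
  rw [Complex.ofReal_zero, mul_zero, Complex.exp_zero, ← neg_sub s a, neg_div_neg_eq]

section Stieltjes

variable {f : ℝ → ℝ} {κ : ℝ} {s : ℂ}

theorem integrable_laplace_kernel (hf : IntegrableOn f (Ioi 0)) (hκ : 0 < κ) (hs : 0 < s.re) :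
    Integrable (fun p : ℝ × ℝ => Complex.exp (-s * p.1) * (f p.2 : ℂ)
      * Complex.exp (-κ * p.1 * p.2))
      ((volume.restrict (Ioi 0)).prod (volume.restrict (Ioi 0))) := by
  have h1 : IntegrableOn (fun t : ℝ => Complex.exp (-s * t)) (Ioi 0) :=
    integrableOn_exp_mul_complex_Ioi (by simpa using hs) 0
  refine (h1.mul_prod hf.ofReal).mul_bdd (c := 1) ?_ ?_
  · exact Continuous.aestronglyMeasurable (by fun_prop)
  · rw [Measure.prod_restrict]
    refine (ae_restrict_iff' (measurableSet_Ioi.prod measurableSet_Ioi)).2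
      (Eventually.of_forall fun p hp => ?_)
    have h2 : (0:ℝ) < p.1 := hp.1
    have h3 : (0:ℝ) < p.2 := hp.2
    have e : (-κ * p.1 * p.2 : ℂ) = ((-(κ * p.1 * p.2) : ℝ) : ℂ) := by push_cast; ring
    rw [e, ← Complex.ofReal_exp, Complex.norm_real, Real.norm_eq_abs, Real.abs_exp,
      Real.exp_le_one_iff, neg_nonpos]
    positivity

theorem integral_laplace_kernel (f : ℝ → ℝ) (κ : ℝ) (s : ℂ) (t : ℝ) :
    ∫ r in Ioi (0:ℝ), Complex.exp (-s * t) * (f r : ℂ) * Complex.exp (-κ * t * r)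
      = Complex.exp (-s * t) * ((∫ r in Ioi (0:ℝ), Real.exp (-κ * t * r) * f r : ℝ) : ℂ) := by
  rw [← integral_complex_ofReal, ← integral_const_mul]
  refine integral_congr_ae (Eventually.of_forall fun r => ?_)
  push_cast
  ring

theorem integrableOn_laplace_integral_exp (hf : IntegrableOn f (Ioi 0)) (hκ : 0 < κ)
    (hs : 0 < s.re) :
    IntegrableOn (fun t : ℝ => Complex.exp (-s * t)
      * ((∫ r in Ioi (0:ℝ), Real.exp (-κ * t * r) * f r : ℝ) : ℂ)) (Ioi 0) := by
  have := (integrable_laplace_kernel hf hκ hs).integral_prod_left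
  simp only [integral_laplace_kernel] at this
  exact this

theorem laplace_integral_exp (hf : IntegrableOn f (Ioi 0)) (hκ : 0 < κ) (hs : 0 < s.re) :
    laplace (fun t => ((∫ r in Ioi (0:ℝ), Real.exp (-κ * t * r) * f r : ℝ) : ℂ)) s
      = ∫ r in Ioi (0:ℝ), (f r : ℂ) / (s + κ * r) := by
  simp only [laplace, ← integral_laplace_kernel]
  rw [integral_integral_swap (integrable_laplace_kernel hf hκ hs)]
  refine setIntegral_congr_fun measurableSet_Ioi fun r hr => ?_
  have h : (-(κ * r : ℝ) : ℂ).re < s.re := by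
    rw [Complex.neg_re, Complex.ofReal_re]
    linarith [mul_pos hκ hr]
  have h1 := laplace_exp h
  rw [laplace] at h1
  rw [sub_neg_eq_add, Complex.ofReal_mul] at h1
  calc ∫ t in Ioi (0:ℝ), Complex.exp (-s * t) * (f r : ℂ) * Complex.exp (-κ * t * r)
      = ∫ t in Ioi (0:ℝ), (f r : ℂ) * (Complex.exp (-s * t) * Complex.exp (-(κ * r) * t)) := by
        refine integral_congr_ae (Eventually.of_forall fun t => ?_)
        ring_nf
    _ = f r / (s + κ * r) := by rw [integral_const_mul, h1, mul_one_div]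

end Stieltjes

variable {n m : ℕ} {Z : Fin m → ℂ}

theorem IsZeroSet.re_nonpos (h : IsZeroSet n Z) (j : Fin m) : (Z j).re ≤ 0 := by
  by_contra! hj
  exact h.ne_of_re_pos hj j rfl

theorem sigma2_eq (n : ℕ) {m : ℕ} (Z : Fin m → ℂ) (b c t : ℝ) :
    sigma2 n b c Z t = ((c : ℂ) / (b : ℂ) ^ 2) * ((∑ j, Z j * Complex.exp (c * Z j / b * t))
      + (-1) ^ n * ((∫ r in Ioi (0:ℝ), Real.exp (-(c / b) * t * r) * cutDensity n r : ℝ) : ℂ)) := by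
  rw [sigma2]
  congr 2
  · refine Finset.sum_congr rfl fun j _ => ?_
    congr 2
    ring
  · congr 2
    refine integral_congr_ae (Eventually.of_forall fun r => ?_)
    simp only [cutDensity, mul_one_div]
    congr 2
    ring

theorem IsZeroSet.laplace_sigma2 (h : IsZeroSet n Z) {b c : ℝ} (hb : 0 < b) (hc : 0 < c) {s : ℂ}
    (hs : 0 < s.re) :
    IntegrableOn (fun t : ℝ => Complex.exp (-s * t) * sigma2 n b c Z t) (Ioi 0) ∧
      laplace (sigma2 n b c Z) s = 1 / b * (logDerivK n (Complex.log (s * b / c))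
        + s * b / c + 1 / 2) := by
  have hbC : (b : ℂ) ≠ 0 := by exact_mod_cast hb.ne'
  have hcC : (c : ℂ) ≠ 0 := by exact_mod_cast hc.ne'
  have hw : 0 < (s * b / c).re := by
    rw [Complex.div_ofReal_re, Complex.re_mul_ofReal]
    positivity
  have ha : ∀ j, (c * Z j / b : ℂ).re < s.re := fun j => by
    rw [Complex.div_ofReal_re, Complex.re_ofReal_mul]
    exact (div_nonpos_of_nonpos_of_nonneg
      (mul_nonpos_of_nonneg_of_nonpos hc.le (h.re_nonpos j)) hb.le).trans_lt hs
  have hI₁ : ∀ j ∈ Finset.univ, IntegrableOn (fun t : ℝ => Z j * (Complex.exp (-s * t)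
      * Complex.exp (c * Z j / b * t))) (Ioi 0) := fun j _ =>
    (integrableOn_laplace_exp (ha j)).const_mul (Z j)
  have hI₂ := (integrableOn_laplace_integral_exp (integrableOn_cutDensity n) (div_pos hc hb)
    hs).const_mul ((-1 : ℂ) ^ n)
  have hfun : ∀ t : ℝ, Complex.exp (-s * t) * sigma2 n b c Z t = ((c : ℂ) / (b : ℂ) ^ 2)
      * (∑ j, Z j * (Complex.exp (-s * t) * Complex.exp (c * Z j / b * t))
        + (-1) ^ n * (Complex.exp (-s * t) * ((∫ r in Ioi (0:ℝ),
          Real.exp (-(c / b) * t * r) * cutDensity n r : ℝ) : ℂ))) := fun t => by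
    rw [sigma2_eq]
    simp only [mul_left_comm _ (Complex.exp (-s * t)), ← Finset.mul_sum]
    ring
  refine ⟨?_, ?_⟩
  · simp only [hfun]
    exact ((integrable_finsetSum _ hI₁).add hI₂).const_mul _
  · have hsum : ∀ j, Z j * (1 / (s - c * Z j / b)) = b / c * (Z j / (s * b / c - Z j)) :=
        fun j => by
      have h1 := sub_ne_zero.2 (h.ne_of_re_pos hw j).symm
      have h2 : s - c * Z j / b ≠ 0 := fun h0 => h1 (by
        field_simp at h0 ⊢
        linear_combination h0)
      have h3 : s - c * Z j / b = c / b * (s * b / c - Z j) := by field_simp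
      rw [h3]
      field_simp
    have hInt : ∫ r in Ioi (0:ℝ), (cutDensity n r : ℂ) / (s + (c / b : ℝ) * r)
        = b / c * ∫ r in Ioi (0:ℝ), (cutDensity n r : ℂ) / (r + s * b / c) := by
      rw [← integral_const_mul]
      refine integral_congr_ae (Eventually.of_forall fun r => ?_)
      have h3 : s + (c / b : ℝ) * r = c / b * (r + s * b / c) := by
        push_cast
        field_simp
        ring
      simp only [h3]
      rw [div_mul_eq_div_div, div_div_eq_mul_div, mul_comm_div, mul_div_right_comm]
      ring
    rw [laplace]
    simp only [hfun]
    rw [integral_const_mul, integral_add (integrable_finsetSum _ hI₁) hI₂,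
      integral_finsetSum _ hI₁, integral_const_mul]
    simp only [integral_const_mul]
    have h1 := fun j => laplace_exp (ha j)
    have h2 := laplace_integral_exp (integrableOn_cutDensity n) (div_pos hc hb) hs
    simp only [laplace] at h1 h2
    simp only [h1]
    rw [h2, add_assoc, add_comm (s * b / c), ← add_assoc, add_right_comm, h.logDerivK_log hw, hInt]
    simp only [hsum, ← Finset.mul_sum]
    field_simp

theorem logDerivK_log_eq {K : ℂ → ℂ} (hK : AnalyticOnNhd ℂ K Complex.slitPlane)
    (hKval : ∀ x : ℝ, 0 < x → K (x : ℂ) = (besselK n x : ℂ)) {w : ℂ} (hw : 0 < w.re) :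
    logDerivK n (Complex.log w) = w * deriv K w / K w := by
  have hw0 : w ≠ 0 := by rintro rfl; simp at hw
  have him : |(Complex.log w).im| < Real.pi := by
    rw [Complex.log_im]
    exact (Complex.abs_arg_lt_pi_div_two_iff.2 (Or.inl hw)).trans (by linarith [Real.pi_pos])
  have hev : (fun ζ => K (Complex.exp ζ)) =ᶠ[𝓝 (Complex.log w)] logBesselK n := by
    have : ∀ᶠ ζ in 𝓝 (Complex.log w), |ζ.im| < Real.pi :=
      (Complex.continuous_im.abs.tendsto _).eventually_lt_const him
    filter_upwards [this] with ζ hζ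
    exact apply_exp_eq_logBesselK hK hKval hζ
  have hd : HasDerivAt K (deriv K w) (Complex.exp (Complex.log w)) := by
    rw [Complex.exp_log hw0]
    exact (hK w (Or.inl hw)).differentiableAt.hasDerivAt
  have h1 := (hd.comp _ (Complex.hasDerivAt_exp _)).congr_of_eventuallyEq hev.symm
  have h2 := h1.unique (hasDerivAt_logBesselK n _)
  rw [logDerivK, ← h2, ← hev.self_of_nhds, mul_comm]
  simp only [Complex.exp_log hw0]

end

end BesselKernel

/-- the Laplace transform of the 2-D nonreflecting boundary kernel `σ_n`
converges absolutely for `Re s > 0` and equals `s/c + 1/(2b) + (s/c) K̃_n'(sb/c)/K̃_n(sb/c)`. -/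
theorem stmt_3 (n : ℕ) (b c : ℝ) (hb : 0 < b) (hc : 0 < c)
    (K : ℂ → ℂ) (hK : AnalyticOnNhd ℂ K Complex.slitPlane)
    (hKval : ∀ x : ℝ, 0 < x → K (x : ℂ) = (besselK n x : ℂ))
    (Z : Fin (Mn n) → ℂ) (hZinj : Function.Injective Z)
    (hZ : Set.range Z = {z : ℂ | z ∈ Complex.slitPlane ∧ K z = 0}) :
    ∀ s : ℂ, 0 < s.re →
      IntegrableOn (fun t : ℝ => Complex.exp (-s * t) * sigma2 n b c Z t) (Set.Ioi 0) ∧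
      laplace (sigma2 n b c Z) s
        = s/(c:ℂ) + 1/(2*(b:ℂ)) + (s/(c:ℂ)) * deriv K (s*b/c) / K (s*b/c) := by
  intro s hs
  have hbC : (b : ℂ) ≠ 0 := by exact_mod_cast hb.ne'
  have hcC : (c : ℂ) ≠ 0 := by exact_mod_cast hc.ne'
  have hw : 0 < (s * b / c).re := by
    rw [Complex.div_ofReal_re, Complex.re_mul_ofReal]
    positivity
  have hzero : BesselKernel.IsZeroSet n Z :=
    { inj := hZinj
      ne_zero := fun j => by
        have : Z j ∈ {z : ℂ | z ∈ Complex.slitPlane ∧ K z = 0} := hZ ▸ Set.mem_range_self j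
        exact Complex.slitPlane_ne_zero this.1
      iff := fun ζ hζ => BesselKernel.logBesselK_eq_zero_iff hK hKval hZ hζ }
  obtain ⟨hInt, hval⟩ := hzero.laplace_sigma2 hb hc hs
  refine ⟨hInt, ?_⟩
  rw [hval, BesselKernel.logDerivK_log_eq hK hKval hw]
  have key : ∀ x y : ℂ, 1 / (b : ℂ) * (s * b / c * x / y + s * b / c + 1 / 2)
      = s / c + 1 / (2 * b) + s / c * x / y := fun x y => by
    rw [mul_div_assoc, mul_div_assoc (s / c : ℂ)]
    field_simp
    ring
  exact key _ _
end

section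
/- Let n ≥ 0 be an integer and let z_1,…,z_n be the roots of p_n (the zeros of K_{n+1/2}). Then for every nonzero z in the slit plane ℂ∖(−∞,0] with p_n(z) ≠ 0, one has 1 + k_n'(z)/k_n(z) = −(n+1)/z + Σ_{j=1}^n 1/(z − z_j). Consequently, for any b, c > 0 and every s ∈ ℂ with Re(s) > 0, the Laplace transform of ω_{n+1/2} satisfies L[ω_{n+1/2}](s) = 1 + k_n'(s b/c)/k_n(s b/c). -/
open MeasureTheory

/-- The coefficients `(n+k)! / (k! (n-k)!)` of the Bessel polynomial of degree `n`. -/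
noncomputable def besselPolyCoeff (n k : ℕ) : ℂ :=
  if k ≤ n then ((n+k).factorial : ℂ) / ((k.factorial : ℂ) * ((n-k).factorial : ℂ)) else 0

/-- The Bessel polynomial `∑_k (n+k)! / (k! (n-k)!) x^k`. -/
noncomputable def besselPolyFun (n : ℕ) (x : ℂ) : ℂ :=
  ∑ k ∈ Finset.range (n+1), besselPolyCoeff n k * x ^ k

lemma besselPolyCoeff_zero (n : ℕ) : besselPolyCoeff n 0 = 1 := by
  have : (n.factorial : ℂ) ≠ 0 := by exact_mod_cast n.factorial_ne_zero
  simp [besselPolyCoeff, this]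

lemma besselPolyCoeff_eq_zero {n k : ℕ} (h : n < k) : besselPolyCoeff n k = 0 :=
  if_neg h.not_ge

lemma besselPolyCoeff_succ (n k : ℕ) :
    besselPolyCoeff (n+2) (k+1) =
      2 * (2*n+3) * besselPolyCoeff (n+1) k + besselPolyCoeff n (k+1) := by
  have fact_ne (m : ℕ) : (m.factorial : ℂ) ≠ 0 := by exact_mod_cast m.factorial_ne_zero
  rcases lt_or_ge k n with h | h
  · obtain ⟨d, rfl⟩ := Nat.exists_eq_add_of_lt h
    have e1 : k + d + 1 + 2 + (k + 1) = 2 * k + d + 2 + 1 + 1 := by ring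
    have e2 : k + d + 1 + 1 + k = 2 * k + d + 2 := by ring
    have e3 : k + d + 1 + (k + 1) = 2 * k + d + 2 := by ring
    have e4 : k + d + 1 + 2 - (k + 1) = d + 1 + 1 := by omega
    have e5 : k + d + 1 + 1 - k = d + 1 + 1 := by omega
    have e6 : k + d + 1 - (k + 1) = d := by omega
    rw [besselPolyCoeff, besselPolyCoeff, besselPolyCoeff, if_pos (by omega), if_pos (by omega),
      if_pos (by omega), e1, e2, e3, e4, e5, e6, Nat.factorial_succ (2 * k + d + 2 + 1),
      Nat.factorial_succ (2 * k + d + 2), Nat.factorial_succ (d + 1), Nat.factorial_succ d,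
      Nat.factorial_succ k]
    have := fact_ne k
    have := fact_ne d
    have : (d : ℂ) + 1 ≠ 0 := by exact_mod_cast d.succ_ne_zero
    have : (d : ℂ) + 1 + 1 ≠ 0 := by exact_mod_cast (d + 1).succ_ne_zero
    have : (k : ℂ) + 1 ≠ 0 := by exact_mod_cast k.succ_ne_zero
    push_cast
    field_simp
    ring
  rw [besselPolyCoeff_eq_zero (show n < k + 1 by omega), add_zero]
  rcases h.eq_or_lt with rfl | h
  · have e1 : n + 2 + (n + 1) = 2 * n + 1 + 1 + 1 := by ring
    have e2 : n + 1 + n = 2 * n + 1 := by ring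
    have e3 : n + 2 - (n + 1) = 1 := by omega
    have e4 : n + 1 - n = 1 := by omega
    rw [besselPolyCoeff, besselPolyCoeff, if_pos (by omega), if_pos (by omega), e1, e2, e3, e4,
      Nat.factorial_succ (2 * n + 1 + 1), Nat.factorial_succ (2 * n + 1), Nat.factorial_succ n]
    have := fact_ne n
    have : (n : ℂ) + 1 ≠ 0 := by exact_mod_cast n.succ_ne_zero
    push_cast
    field_simp
    ring
  rcases (Nat.succ_le_of_lt h).eq_or_lt with h | h
  · obtain rfl : k = n + 1 := by omega
    have e1 : n + 2 + (n + 1 + 1) = 2 * n + 2 + 1 + 1 := by ring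
    have e2 : n + 1 + (n + 1) = 2 * n + 2 := by ring
    have e3 : n + 2 - (n + 1 + 1) = 0 := by omega
    rw [besselPolyCoeff, besselPolyCoeff, if_pos (by omega), if_pos (by omega), e1, e2, e3,
      Nat.sub_self, Nat.factorial_succ (2 * n + 2 + 1), Nat.factorial_succ (2 * n + 2),
      Nat.factorial_succ (n + 1)]
    have := fact_ne (n + 1)
    have : (n : ℂ) + 1 + 1 ≠ 0 := by exact_mod_cast (n + 1).succ_ne_zero
    push_cast
    field_simp
    ring
  · rw [besselPolyCoeff_eq_zero (by omega), besselPolyCoeff_eq_zero (by omega), mul_zero]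

lemma besselPolyFun_eq_sum_range {n N : ℕ} (h : n + 1 ≤ N) (x : ℂ) :
    besselPolyFun n x = ∑ k ∈ Finset.range N, besselPolyCoeff n k * x ^ k := by
  refine Finset.sum_subset (Finset.range_mono h) fun k _ hk ↦ ?_
  rw [besselPolyCoeff_eq_zero (by grind), zero_mul]

lemma besselPolyFun_add_two (n : ℕ) (x : ℂ) :
    besselPolyFun (n+2) x = 2 * (2*n+3) * x * besselPolyFun (n+1) x + besselPolyFun n x := by
  rw [besselPolyFun, besselPolyFun, besselPolyFun_eq_sum_range (show n + 1 ≤ n + 2 + 1 by omega),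
    Finset.sum_range_succ', Finset.sum_range_succ' _ (n + 2), besselPolyCoeff_zero,
    besselPolyCoeff_zero, ← add_assoc, Finset.mul_sum, ← Finset.sum_add_distrib]
  congr 1
  refine Finset.sum_congr rfl fun k _ ↦ ?_
  rw [besselPolyCoeff_succ]
  ring

/-- Consecutive Bessel polynomials have a quotient with positive real part in the right
half-plane. -/
lemma besselPolyFun_ne_zero_and_re_div_pos {x : ℂ} (hx : 0 < x.re) (n : ℕ) :
    besselPolyFun n x ≠ 0 ∧ 0 < (besselPolyFun (n+1) x / besselPolyFun n x).re := by
  induction n with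
  | zero =>
    have h0 : besselPolyFun 0 x = 1 := by simp [besselPolyFun, besselPolyCoeff]
    have h1 : besselPolyFun 1 x = 1 + 2 * x := by
      simp [besselPolyFun, besselPolyCoeff, Finset.sum_range_succ]
    rw [zero_add, h0, h1]
    refine ⟨one_ne_zero, ?_⟩
    simp only [div_one, Complex.add_re, Complex.one_re, Complex.mul_re, Complex.re_ofNat,
      Complex.im_ofNat]
    linarith
  | succ n ih =>
    obtain ⟨h0, hre⟩ := ih
    have h1 : besselPolyFun (n+1) x ≠ 0 := by
      intro h
      simp [h] at hre
    refine ⟨h1, ?_⟩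
    have key : besselPolyFun (n+1+1) x / besselPolyFun (n+1) x =
        ((2 * (2*n+3) : ℝ) : ℂ) * x + (besselPolyFun (n+1) x / besselPolyFun n x)⁻¹ := by
      rw [besselPolyFun_add_two]
      push_cast
      field_simp
    rw [key, Complex.add_re, Complex.re_ofReal_mul, Complex.inv_re]
    have : 0 < Complex.normSq (besselPolyFun (n+1) x / besselPolyFun n x) :=
      Complex.normSq_pos.2 (div_ne_zero h1 h0)
    positivity

lemma pPoly_eval (n : ℕ) {z : ℂ} (hz : z ≠ 0) :
    (pPoly n).eval z = (2*z)^n * besselPolyFun n (2*z)⁻¹ := by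
  rw [pPoly, Polynomial.eval_finsetSum, besselPolyFun, Finset.mul_sum]
  refine Finset.sum_congr rfl fun k hk ↦ ?_
  have hk : k ≤ n := Nat.lt_succ_iff.1 (Finset.mem_range.1 hk)
  have h2z : 2 * z ≠ 0 := mul_ne_zero two_ne_zero hz
  rw [besselPolyCoeff, if_pos hk, Polynomial.eval_mul, Polynomial.eval_C, Polynomial.eval_pow,
    nsmul_eq_mul, Polynomial.eval_mul, Polynomial.eval_X, Polynomial.eval_natCast,
    Nat.cast_ofNat, pow_sub₀ _ h2z hk, inv_pow]
  ring

lemma pPoly_eval_ne_zero_of_re_pos (n : ℕ) {z : ℂ} (hz : 0 < z.re) : (pPoly n).eval z ≠ 0 := by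
  have hz0 : z ≠ 0 := by
    rintro rfl
    simp at hz
  have h2z : 2 * z ≠ 0 := mul_ne_zero two_ne_zero hz0
  rw [pPoly_eval n hz0]
  refine mul_ne_zero (pow_ne_zero _ h2z) (besselPolyFun_ne_zero_and_re_div_pos ?_ n).1
  rw [Complex.inv_re]
  refine div_pos ?_ (Complex.normSq_pos.2 h2z)
  simpa using hz

lemma two_div_cpow_half_mul_pi_div_cpow_half {z : ℂ} (hz : z ≠ 0) :
    ((2:ℂ) / ((Real.pi : ℂ) * z)) ^ ((1:ℂ)/2) * ((Real.pi : ℂ) / (2*z)) ^ ((1:ℂ)/2) = z⁻¹ := by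
  have hpi : (Real.pi : ℂ) ≠ 0 := by exact_mod_cast Real.pi_ne_zero
  have e1 : (2:ℂ) / ((Real.pi : ℂ) * z) = ((2 / Real.pi : ℝ) : ℂ) * z⁻¹ := by
    push_cast
    field_simp
  have e2 : (Real.pi : ℂ) / (2*z) = ((Real.pi / 2 : ℝ) : ℂ) * z⁻¹ := by
    push_cast
    field_simp
  have hlog : Real.log (2 / Real.pi) = - Real.log (Real.pi / 2) := by
    rw [← Real.log_inv, inv_div]
  have h1 : (2:ℂ) / ((Real.pi : ℂ) * z) ≠ 0 :=
    div_ne_zero two_ne_zero (mul_ne_zero hpi hz)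
  have h2 : (Real.pi : ℂ) / (2*z) ≠ 0 := div_ne_zero hpi (mul_ne_zero two_ne_zero hz)
  rw [Complex.cpow_def_of_ne_zero h1, Complex.cpow_def_of_ne_zero h2, ← Complex.exp_add, e1, e2,
    Complex.log_ofReal_mul (by positivity) (inv_ne_zero hz),
    Complex.log_ofReal_mul (by positivity) (inv_ne_zero hz), hlog, ← add_mul]
  conv_rhs => rw [← Complex.exp_log (inv_ne_zero hz)]
  congr 1
  push_cast
  ring

lemma sphk_eq (n : ℕ) {z : ℂ} (hz : z ≠ 0) :
    sphk n z = Complex.exp (-z) * (pPoly n).eval z / (2 ^ n * z ^ (n+1)) := by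
  have hsum : ∑ k ∈ Finset.range (n+1),
      ((n+k).factorial : ℂ) / ((k.factorial : ℂ) * ((n-k).factorial : ℂ) * (2*z)^k)
      = besselPolyFun n (2*z)⁻¹ := by
    refine Finset.sum_congr rfl fun k hk ↦ ?_
    rw [besselPolyCoeff, if_pos (Nat.lt_succ_iff.1 (Finset.mem_range.1 hk)), inv_pow,
      ← div_eq_mul_inv, div_div]
  rw [sphk, Khalf, hsum, pPoly_eval n hz, ← mul_assoc, ← mul_assoc,
    two_div_cpow_half_mul_pi_div_cpow_half hz, mul_pow]
  field_simp
  ring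

/-- The logarithmic derivative of the modified spherical Bessel function. -/
lemma one_add_deriv_sphk_div (n : ℕ) {z : ℂ} (hz : z ≠ 0) (hp : (pPoly n).eval z ≠ 0) :
    1 + deriv (sphk n) z / sphk n z =
      -((n:ℂ)+1)/z + (pPoly n).derivative.eval z / (pPoly n).eval z := by
  have heq : sphk n =ᶠ[nhds z]
      fun w ↦ Complex.exp (-w) * (pPoly n).eval w / (2 ^ n * w ^ (n+1)) := by
    filter_upwards [isOpen_ne.mem_nhds hz] with w hw using sphk_eq n hw
  have hden : (2:ℂ) ^ n * z ^ (n+1) ≠ 0 :=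
    mul_ne_zero (pow_ne_zero n two_ne_zero) (pow_ne_zero _ hz)
  have hexp : logDeriv (fun w : ℂ ↦ Complex.exp (-w)) z = -1 := by
    have h : HasDerivAt (fun w : ℂ ↦ Complex.exp (-w)) (Complex.exp (-z) * -1) z :=
      (hasDerivAt_neg z).cexp
    rw [logDeriv_apply, h.deriv]
    field_simp
  rw [← logDeriv_apply, (logDeriv_congr_nhds heq).eq_of_nhds,
    logDeriv_div (f := fun w ↦ Complex.exp (-w) * (pPoly n).eval w)
      (g := fun w ↦ 2 ^ n * w ^ (n+1)) z (mul_ne_zero (Complex.exp_ne_zero _) hp) hden (by fun_prop) (by fun_prop),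
    logDeriv_mul (f := fun w ↦ Complex.exp (-w)) (g := fun w ↦ (pPoly n).eval w) z
      (Complex.exp_ne_zero _) hp (by fun_prop) (by fun_prop), hexp,
    logDeriv_const_mul z _ (pow_ne_zero n two_ne_zero), logDeriv_pow, logDeriv_apply,
    Polynomial.deriv]
  push_cast
  ring

lemma eval_derivative_div_eval_eq_sum_of_roots {m : ℕ} {p : Polynomial ℂ} {Z : Fin m → ℂ}
    (hZ : p.roots = ↑(List.ofFn Z)) {z : ℂ} (hp : p.eval z ≠ 0) :
    p.derivative.eval z / p.eval z = ∑ j, 1/(z - Z j) := by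
  rw [(IsAlgClosed.splits p).eval_derivative_div_eval_of_ne_zero hp, hZ, Multiset.map_coe,
    Multiset.sum_coe, List.map_ofFn, List.sum_ofFn]
  rfl

lemma laplace_omega3 {n : ℕ} {b c : ℝ} (hb : 0 < b) (hc : 0 < c) {Z : Fin n → ℂ}
    (hre : ∀ j, (Z j).re ≤ 0) {s : ℂ} (hs : 0 < s.re) :
    laplace (omega3 b c Z) s = -((n:ℂ)+1)/(s*b/c) + ∑ j, 1/(s*b/c - Z j) := by
  have hb' : (b : ℂ) ≠ 0 := by exact_mod_cast hb.ne'
  have hc' : (c : ℂ) ≠ 0 := by exact_mod_cast hc.ne'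
  have hs0 : s ≠ 0 := by
    rintro rfl
    simp at hs
  have hneg : (-s).re < 0 := by simpa using hs
  have hZneg (j : Fin n) : (-s + ((c / b : ℝ) : ℂ) * Z j).re < 0 := by
    rw [Complex.add_re, Complex.re_ofReal_mul]
    have := mul_nonpos_of_nonneg_of_nonpos (div_pos hc hb).le (hre j)
    linarith
  have hint0 := integrableOn_exp_mul_complex_Ioi hneg 0
  have hint (j : Fin n) := integrableOn_exp_mul_complex_Ioi (hZneg j) 0
  have hintsub (j : Fin n) : IntegrableOn (fun t : ℝ ↦
      Complex.exp ((-s + ((c / b : ℝ) : ℂ) * Z j) * t) - Complex.exp (-s * t)) (Set.Ioi 0) :=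
    (hint j).sub hint0
  have hfun (t : ℝ) : Complex.exp (-s * t) * omega3 b c Z t =
      (-(c:ℂ)/b) * Complex.exp (-s * t) + (c:ℂ)/b *
        ∑ j, (Complex.exp ((-s + ((c / b : ℝ) : ℂ) * Z j) * t) - Complex.exp (-s * t)) := by
    have (j : Fin n) : Complex.exp ((-s + ((c / b : ℝ) : ℂ) * Z j) * t) - Complex.exp (-s * t)
        = Complex.exp (-s * t) * (Complex.exp ((c:ℂ) * t * Z j / b) - 1) := by
      rw [mul_sub, mul_one, ← Complex.exp_add]
      congr 2
      push_cast
      ring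
    simp_rw [this, ← Finset.mul_sum, omega3]
    ring
  have hterm (j : Fin n) : (c:ℂ)/b * (-1 / (-s + ((c / b : ℝ) : ℂ) * Z j) - -1 / -s) =
      1/(s*b/c - Z j) - 1/(s*b/c) := by
    have h1 : -s + ((c / b : ℝ) : ℂ) * Z j = -((c:ℂ)/b) * (s*b/c - Z j) := by
      push_cast
      field_simp
      ring
    have h2 : s*b/c - Z j ≠ 0 := by
      intro h
      have := hZneg j
      rw [h1, h] at this
      simp at this
    rw [h1]
    field_simp
  rw [laplace]
  simp_rw [hfun]
  rw [integral_add (hint0.const_mul _)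
    ((integrable_finsetSum _ fun j _ ↦ hintsub j).const_mul _),
    integral_const_mul, integral_const_mul, integral_finsetSum _ fun j _ ↦ hintsub j,
    integral_exp_mul_complex_Ioi hneg]
  have hsub (j : Fin n) : ∫ t in Set.Ioi (0:ℝ),
      (Complex.exp ((-s + ((c / b : ℝ) : ℂ) * Z j) * t) - Complex.exp (-s * t)) =
      -1 / (-s + ((c / b : ℝ) : ℂ) * Z j) - -1 / -s := by
    rw [integral_sub (hint j) hint0, integral_exp_mul_complex_Ioi (hZneg j),
      integral_exp_mul_complex_Ioi hneg]
    simp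
  simp_rw [hsub, Finset.mul_sum, hterm]
  rw [Finset.sum_sub_distrib, Finset.sum_const, Finset.card_univ, Fintype.card_fin, nsmul_eq_mul,
    Complex.ofReal_zero, mul_zero, Complex.exp_zero]
  field_simp
  ring

/-- partial-fraction identity for `1 + k_n'/k_n` and the Laplace
transform of the 3-D nonreflecting boundary kernel `ω_{n+1/2}`. -/
theorem stmt_4 (n : ℕ) (Z : Fin n → ℂ)
    (hZ : (pPoly n).roots = ↑(List.ofFn Z)) :
    (∀ z ∈ Complex.slitPlane, z ≠ 0 → (pPoly n).eval z ≠ 0 →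
      1 + deriv (sphk n) z / sphk n z = -((n:ℂ)+1)/z + ∑ j, 1/(z - Z j)) ∧
    (∀ b c : ℝ, 0 < b → 0 < c → ∀ s : ℂ, 0 < s.re →
      laplace (omega3 b c Z) s = 1 + deriv (sphk n) (s*b/c) / sphk n (s*b/c)) := by
  have hlog (z : ℂ) (hz : z ≠ 0) (hp : (pPoly n).eval z ≠ 0) :
      1 + deriv (sphk n) z / sphk n z = -((n:ℂ)+1)/z + ∑ j, 1/(z - Z j) := by
    rw [one_add_deriv_sphk_div n hz hp, eval_derivative_div_eval_eq_sum_of_roots hZ hp]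
  refine ⟨fun z _ hz hp ↦ hlog z hz hp, fun b c hb hc s hs ↦ ?_⟩
  have hre (j : Fin n) : (Z j).re ≤ 0 := by
    by_contra! h
    have hmem : Z j ∈ (pPoly n).roots := by
      rw [hZ, Multiset.mem_coe, List.mem_ofFn]
      exact ⟨j, rfl⟩
    exact pPoly_eval_ne_zero_of_re_pos n h (Polynomial.isRoot_of_mem_roots hmem)
  have hpos : 0 < (s*b/c).re := by
    rw [Complex.div_ofReal_re, Complex.re_mul_ofReal]
    positivity
  have hne : s*b/c ≠ 0 := by
    intro h
    simp [h] at hpos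
  rw [laplace_omega3 hb hc hre hs, hlog _ hne (pPoly_eval_ne_zero_of_re_pos n hpos)]
end

section
/- For every integer n ≥ 0, the function G_n(r) = K_n(r)² + π²·I_n(r)² is strictly convex on (0,∞) (indeed G_n''(r) > 0 for all r > 0), and G_n(r) → +∞ both as r → 0⁺ and as r → +∞. Consequently, W_n(r) = 1/G_n(r) attains its maximum on (0,∞) at a unique point r_0 > 0. -/
open MeasureTheory

noncomputable section

/-- The entire function `∑ y ^ k / (k! (n + k)!)`, in terms of which
`I_n(x) = (x / 2) ^ n * besselSeries n (x ^ 2 / 4)`. -/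
def besselSeries (n : ℕ) (y : ℝ) : ℝ :=
  ∑' k : ℕ, y ^ k / (Nat.factorial k * Nat.factorial (n + k))

theorem summable_besselSeries (n : ℕ) (y : ℝ) :
    Summable fun k : ℕ => y ^ k / ((Nat.factorial k : ℝ) * Nat.factorial (n + k)) := by
  refine Summable.of_norm_bounded (Real.summable_pow_div_factorial |y|) fun k => ?_
  rw [Real.norm_eq_abs, abs_div, abs_pow, abs_of_pos (a := (_ : ℝ) * _) (by positivity)]
  have h : (1 : ℝ) ≤ Nat.factorial (n + k) := by exact_mod_cast Nat.factorial_pos _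
  gcongr
  exact le_mul_of_one_le_right (by positivity) h

theorem besselSeries_nonneg (n : ℕ) {y : ℝ} (hy : 0 ≤ y) : 0 ≤ besselSeries n y :=
  tsum_nonneg fun _ => by positivity

theorem hasDerivAt_besselSeries (n : ℕ) (y : ℝ) :
    HasDerivAt (besselSeries n) (besselSeries (n + 1) y) y := by
  set R : ℝ := |y| + 1
  set u : ℕ → ℝ := fun k => k * R ^ (k - 1) / Nat.factorial k
  have hu : Summable u := by
    rw [← summable_nat_add_iff 1]
    refine (Real.summable_pow_div_factorial R).congr fun k => ?_
    simp only [u, Nat.factorial_succ, Nat.add_sub_cancel]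
    push_cast
    field_simp
  have key := hasDerivAt_tsum_of_isPreconnected (u := u) (t := Metric.ball (0 : ℝ) R)
    (g := fun k z => z ^ k / ((Nat.factorial k : ℝ) * Nat.factorial (n + k)))
    (g' := fun k z => (k * z ^ (k - 1)) / ((Nat.factorial k : ℝ) * Nat.factorial (n + k)))
    (y₀ := y) (y := y) hu Metric.isOpen_ball (convex_ball _ _).isPreconnected
    (fun k z _ => (hasDerivAt_pow k z).div_const _)
    (fun k z hz => by
      have hz' : |z| ≤ R := by simpa using (Metric.mem_ball.1 hz).le
      have h : (1 : ℝ) ≤ Nat.factorial (n + k) := by exact_mod_cast Nat.factorial_pos _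
      rw [Real.norm_eq_abs, abs_div, abs_mul, abs_pow, Nat.abs_cast,
        abs_of_pos (a := (_ : ℝ) * _) (by positivity)]
      simp only [u]
      gcongr
      exact le_mul_of_one_le_right (by positivity) h)
    (by simp [R]) (summable_besselSeries n y) (by simp [R])
  refine key.congr_deriv ?_
  have hs : Summable fun k : ℕ =>
      (k * y ^ (k - 1)) / ((Nat.factorial k : ℝ) * Nat.factorial (n + k)) := by
    rw [← summable_nat_add_iff 1]
    refine (summable_besselSeries (n + 1) y).congr fun k => ?_
    rw [show n + 1 + k = n + (k + 1) by ring, Nat.factorial_succ k, Nat.add_sub_cancel]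
    push_cast
    field_simp
  rw [besselSeries, hs.tsum_eq_zero_add]
  simp only [CharP.cast_eq_zero, zero_mul, zero_div, zero_add]
  refine tsum_congr fun k => ?_
  rw [show n + 1 + k = n + (k + 1) by ring, Nat.factorial_succ k, Nat.add_sub_cancel]
  push_cast
  field_simp

/-- The products `(x / 2) ^ a * besselSeries m (x ^ 2 / 4)`, a family containing `I_m` (for `a = m`)
and closed under differentiation up to nonnegative linear combinations. -/
def besselMonomial (a m : ℕ) (x : ℝ) : ℝ := (x / 2) ^ a * besselSeries m (x ^ 2 / 4)

theorem besselI_eq_besselMonomial (n : ℕ) : besselI n = besselMonomial n n := by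
  funext x
  rw [besselI, besselMonomial, besselSeries, ← tsum_mul_left]
  refine tsum_congr fun k => ?_
  rw [pow_add, pow_mul, mul_div_assoc, div_pow x 2 2]
  norm_num

theorem besselMonomial_nonneg (a m : ℕ) {x : ℝ} (hx : 0 ≤ x) : 0 ≤ besselMonomial a m x :=
  mul_nonneg (by positivity) (besselSeries_nonneg m (by positivity))

theorem hasDerivAt_besselMonomial (a m : ℕ) (x : ℝ) :
    HasDerivAt (besselMonomial a m)
      (a / 2 * besselMonomial (a - 1) m x + besselMonomial (a + 1) (m + 1) x) x := by
  have h1 : HasDerivAt (fun x : ℝ => (x / 2) ^ a) (a * (x / 2) ^ (a - 1) * (1 / 2)) x :=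
    ((hasDerivAt_id x).div_const 2).pow a
  have h2 : HasDerivAt (fun x : ℝ => x ^ 2 / 4) (x / 2) x := by
    refine ((hasDerivAt_pow 2 x).div_const 4).congr_deriv ?_
    norm_num
    ring
  have h3 := h1.mul ((hasDerivAt_besselSeries m (x ^ 2 / 4)).comp x h2)
  refine h3.congr_deriv ?_
  simp only [besselMonomial, Function.comp]
  ring

theorem exists_hasDerivAt_besselI (n : ℕ) : ∃ I' I'' : ℝ → ℝ,
    (∀ x, HasDerivAt (besselI n) (I' x) x) ∧ (∀ x, HasDerivAt I' (I'' x) x) ∧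
      ∀ x, 0 ≤ x → 0 ≤ I'' x := by
  rw [besselI_eq_besselMonomial]
  refine ⟨_, _, hasDerivAt_besselMonomial n n, fun x =>
    ((hasDerivAt_besselMonomial (n - 1) n x).const_mul _).add
      (hasDerivAt_besselMonomial (n + 1) (n + 1) x), fun x hx => ?_⟩
  have h := fun a m => besselMonomial_nonneg a m hx
  exact add_nonneg
    (mul_nonneg (by positivity) (add_nonneg (mul_nonneg (by positivity) (h _ _)) (h _ _)))
    (add_nonneg (mul_nonneg (by positivity) (h _ _)) (h _ _))

theorem besselI_nonneg (n : ℕ) {x : ℝ} (hx : 0 ≤ x) : 0 ≤ besselI n x :=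
  tsum_nonneg fun _ => by positivity

theorem tendsto_besselI_atTop (n : ℕ) : Filter.Tendsto (besselI n) Filter.atTop Filter.atTop := by
  have h : Filter.Tendsto (fun x : ℝ => (x / 2) ^ (n + 1) * ((x / 2) / Nat.factorial (n + 1)))
      Filter.atTop Filter.atTop :=
    ((Filter.tendsto_pow_atTop n.succ_ne_zero).comp
      (Filter.tendsto_id.atTop_div_const two_pos)).atTop_mul_atTop₀
      ((Filter.tendsto_id.atTop_div_const two_pos).atTop_div_const (by positivity))
  refine Filter.tendsto_atTop_mono' _ ?_ h
  filter_upwards [Filter.eventually_ge_atTop 0] with x hx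
  have hs := (summable_besselSeries n (x ^ 2 / 4)).le_tsum 1 fun k _ => by positivity
  rw [besselI_eq_besselMonomial, besselMonomial]
  refine le_trans (le_of_eq ?_) (mul_le_mul_of_nonneg_left hs (by positivity))
  simp
  ring

/-- The integrand of `K_n`, differentiated `m` times in `-x`. -/
def besselKIntegrand (n m : ℕ) (x t : ℝ) : ℝ :=
  Real.exp (-x * Real.cosh t) * (Real.cosh t ^ m * Real.cosh (n * t))

theorem besselKIntegrand_pos (n m : ℕ) (x t : ℝ) : 0 < besselKIntegrand n m x t := by
  have := Real.cosh_pos t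
  have := Real.cosh_pos (n * t)
  unfold besselKIntegrand
  positivity

theorem continuous_besselKIntegrand (n m : ℕ) (x : ℝ) : Continuous (besselKIntegrand n m x) := by
  unfold besselKIntegrand
  fun_prop

theorem cosh_le_exp {t : ℝ} (ht : 0 ≤ t) : Real.cosh t ≤ Real.exp t := by
  rw [Real.cosh_eq]
  have : Real.exp (-t) ≤ Real.exp t := Real.exp_le_exp.2 (by linarith)
  linarith

theorem besselKIntegrand_le (n m : ℕ) {x t : ℝ} (hx : 0 < x) (ht : 0 ≤ t) :
    besselKIntegrand n m x t ≤
      Nat.factorial (m + n + 1) / (x / 2) ^ (m + n + 1) * Real.exp (-t) := by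
  have hc : Real.exp t / 2 ≤ Real.cosh t := by
    rw [Real.cosh_eq]
    have := Real.exp_pos (-t)
    linarith
  have h1 : Real.exp (-x * Real.cosh t) ≤
      Nat.factorial (m + n + 1) / (x / 2 * Real.exp t) ^ (m + n + 1) := by
    rw [neg_mul, Real.exp_neg, inv_le_comm₀ (Real.exp_pos _) (by positivity), inv_div]
    refine (Real.pow_div_factorial_le_exp (x / 2 * Real.exp t) (by positivity) _).trans ?_
    rw [Real.exp_le_exp]
    nlinarith
  have h2 : Real.cosh t ^ m * Real.cosh (n * t) ≤ Real.exp t ^ m * Real.exp t ^ n := by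
    rw [← Real.exp_nat_mul t n]
    have := Real.cosh_pos t
    have := Real.cosh_pos (n * t)
    gcongr
    · exact cosh_le_exp ht
    · exact cosh_le_exp (by positivity)
  have hc1 := Real.cosh_pos t
  have hc2 := Real.cosh_pos (n * t)
  refine (mul_le_mul h1 h2 (by positivity) (by positivity)).trans (le_of_eq ?_)
  rw [Real.exp_neg]
  have := Real.exp_pos t
  field_simp
  ring

theorem integrableOn_besselKIntegrand (n m : ℕ) {x : ℝ} (hx : 0 < x) :
    IntegrableOn (besselKIntegrand n m x) (Set.Ioi 0) := by
  refine Integrable.mono' ((integrableOn_exp_neg_Ioi 0).const_mul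
    (Nat.factorial (m + n + 1) / (x / 2) ^ (m + n + 1)))
    (continuous_besselKIntegrand n m x).aestronglyMeasurable ?_
  filter_upwards [ae_restrict_mem measurableSet_Ioi] with t ht
  rw [Real.norm_of_nonneg (besselKIntegrand_pos n m x t).le]
  exact besselKIntegrand_le n m hx (le_of_lt ht)

/-- The function `(-1) ^ m` times the `m`-th derivative of `K_n`. -/
def besselKDeriv (n m : ℕ) (x : ℝ) : ℝ := ∫ t in Set.Ioi (0 : ℝ), besselKIntegrand n m x t

theorem besselK_eq_besselKDeriv (n : ℕ) : besselK n = besselKDeriv n 0 := by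
  funext x
  simp [besselK, besselKDeriv, besselKIntegrand]

theorem besselKDeriv_pos (n m : ℕ) {x : ℝ} (hx : 0 < x) : 0 < besselKDeriv n m x := by
  refine (setIntegral_pos_iff_support_of_nonneg_ae
    (Filter.Eventually.of_forall fun t => (besselKIntegrand_pos n m x t).le)
    (integrableOn_besselKIntegrand n m hx)).2 ?_
  rw [Function.support_eq_univ fun t => (besselKIntegrand_pos n m x t).ne']
  simp

theorem hasDerivAt_besselKDeriv (n m : ℕ) {x : ℝ} (hx : 0 < x) :
    HasDerivAt (besselKDeriv n m) (-besselKDeriv n (m + 1) x) x := by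
  rw [besselKDeriv, ← integral_neg]
  refine (hasDerivAt_integral_of_dominated_loc_of_deriv_le
    (F' := fun y t => -besselKIntegrand n (m + 1) y t)
    (bound := besselKIntegrand n (m + 1) (x / 2)) (Ioi_mem_nhds (half_lt_self hx))
    (Filter.Eventually.of_forall fun y =>
      (continuous_besselKIntegrand n m y).aestronglyMeasurable)
    (integrableOn_besselKIntegrand n m hx)
    (continuous_besselKIntegrand n (m + 1) x).neg.aestronglyMeasurable
    (Filter.Eventually.of_forall fun t y hy => ?_)
    (integrableOn_besselKIntegrand n (m + 1) (half_pos hx))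
    (Filter.Eventually.of_forall fun t y _ => ?_)).2
  · have h1 := Real.cosh_pos t
    have h2 := Real.cosh_pos (n * t)
    have hy' : x / 2 ≤ y := le_of_lt hy
    rw [norm_neg, Real.norm_of_nonneg (besselKIntegrand_pos _ _ _ _).le]
    unfold besselKIntegrand
    gcongr
  · have h := (((hasDerivAt_id y).neg.mul_const (Real.cosh t)).exp).mul_const
      (Real.cosh t ^ m * Real.cosh (n * t))
    refine h.congr_deriv ?_
    simp only [besselKIntegrand, id, Pi.neg_apply]
    ring

theorem mul_exp_le_besselK (n : ℕ) {x T : ℝ} (hx : 0 < x) (hT : 0 ≤ T) :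
    T * Real.exp (-x * Real.cosh T) ≤ besselK n x := by
  rw [besselK_eq_besselKDeriv, besselKDeriv]
  have hint := integrableOn_besselKIntegrand n 0 hx
  calc T * Real.exp (-x * Real.cosh T)
      = ∫ _ in Set.Ioc (0 : ℝ) T, Real.exp (-x * Real.cosh T) := by simp [hT]
    _ ≤ ∫ t in Set.Ioc (0 : ℝ) T, besselKIntegrand n 0 x t := by
      refine setIntegral_mono_on (by simp) (hint.mono_set Set.Ioc_subset_Ioi_self)
        measurableSet_Ioc fun t ht => ?_
      have hc : Real.cosh t ≤ Real.cosh T := by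
        rw [Real.cosh_le_cosh, abs_of_pos ht.1, abs_of_nonneg hT]
        exact ht.2
      have h1 : Real.exp (-x * Real.cosh T) ≤ Real.exp (-x * Real.cosh t) := by
        rw [Real.exp_le_exp]
        nlinarith
      rw [besselKIntegrand, pow_zero, one_mul]
      exact h1.trans (le_mul_of_one_le_right (Real.exp_pos _).le (Real.one_le_cosh _))
    _ ≤ ∫ t in Set.Ioi (0 : ℝ), besselKIntegrand n 0 x t :=
      setIntegral_mono_set hint
        (Filter.Eventually.of_forall fun t => (besselKIntegrand_pos n 0 x t).le)
        Set.Ioc_subset_Ioi_self.eventuallyLE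

theorem tendsto_besselK_nhdsGT_zero (n : ℕ) :
    Filter.Tendsto (besselK n) (nhdsWithin 0 (Set.Ioi 0)) Filter.atTop := by
  rw [Filter.tendsto_atTop]
  intro M
  have hlim : Filter.Tendsto
      (fun x : ℝ => (|M| + 1) * Real.exp (-x * Real.cosh (|M| + 1)))
      (nhdsWithin 0 (Set.Ioi 0)) (nhds (|M| + 1)) := by
    have hcont : Continuous fun x : ℝ => (|M| + 1) * Real.exp (-x * Real.cosh (|M| + 1)) := by
      fun_prop
    have h := hcont.tendsto 0
    simp only [neg_zero, zero_mul, Real.exp_zero, mul_one] at h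
    exact h.mono_left nhdsWithin_le_nhds
  filter_upwards [hlim.eventually (lt_mem_nhds (show M < |M| + 1 by linarith [le_abs_self M])),
    self_mem_nhdsWithin] with x h1 h2
  exact h1.le.trans (mul_exp_le_besselK n h2 (by positivity))

theorem deriv_deriv_besselG_pos (n : ℕ) {r : ℝ} (hr : 0 < r) :
    0 < deriv (deriv fun r : ℝ => besselK n r ^ 2 + Real.pi ^ 2 * besselI n r ^ 2) r := by
  obtain ⟨I', I'', hI, hI', hI''⟩ := exists_hasDerivAt_besselI n
  rw [besselK_eq_besselKDeriv]
  have h1 : ∀ x, 0 < x → HasDerivAt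
      (fun r : ℝ => besselKDeriv n 0 r ^ 2 + Real.pi ^ 2 * besselI n r ^ 2)
      (2 * (besselKDeriv n 0 x * -besselKDeriv n 1 x) +
        Real.pi ^ 2 * (2 * (besselI n x * I' x))) x := fun x hx => by
    refine (((hasDerivAt_besselKDeriv n 0 hx).pow 2).add
      (((hI x).pow 2).const_mul (Real.pi ^ 2))).congr_deriv ?_
    norm_num
    ring
  have h2 : deriv (fun r : ℝ => besselKDeriv n 0 r ^ 2 + Real.pi ^ 2 * besselI n r ^ 2) =ᶠ[nhds r]
      fun x => 2 * (besselKDeriv n 0 x * -besselKDeriv n 1 x) +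
        Real.pi ^ 2 * (2 * (besselI n x * I' x)) := by
    filter_upwards [Ioi_mem_nhds hr] with x hx using (h1 x hx).deriv
  have h3 := (((hasDerivAt_besselKDeriv n 0 hr).mul
    (hasDerivAt_besselKDeriv n 1 hr).neg).const_mul 2).add
    ((((hI r).mul (hI' r)).const_mul 2).const_mul (Real.pi ^ 2))
  rw [h2.deriv_eq]
  refine lt_of_lt_of_eq ?_ h3.deriv.symm
  have hK0 := besselKDeriv_pos n 0 hr
  have hK2 := besselKDeriv_pos n 2 hr
  have hI0 := besselI_nonneg n hr.le
  have hI2 := hI'' r hr.le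
  have e1 : 0 < besselKDeriv n 0 r * besselKDeriv n 2 r := mul_pos hK0 hK2
  have e2 : 0 ≤ Real.pi ^ 2 * (2 * (I' r * I' r + besselI n r * I'' r)) :=
    mul_nonneg (by positivity) (mul_nonneg zero_le_two
      (add_nonneg (mul_self_nonneg _) (mul_nonneg hI0 hI2)))
  norm_num
  nlinarith [mul_self_nonneg (besselKDeriv n 1 r)]

theorem continuousOn_besselG (n : ℕ) :
    ContinuousOn (fun r : ℝ => besselK n r ^ 2 + Real.pi ^ 2 * besselI n r ^ 2) (Set.Ioi 0) := by
  obtain ⟨_, _, hI, -⟩ := exists_hasDerivAt_besselI n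
  have hK : ContinuousOn (besselK n) (Set.Ioi 0) := fun x hx => by
    rw [besselK_eq_besselKDeriv]
    exact (hasDerivAt_besselKDeriv n 0 hx).continuousAt.continuousWithinAt
  have hI' : Continuous (besselI n) := continuous_iff_continuousAt.2 fun x => (hI x).continuousAt
  exact (hK.pow 2).add (by fun_prop)

/-- A continuous function on `(0, ∞)` that blows up at both ends attains its minimum. -/
theorem exists_isMinOn_Ioi_of_tendsto_atTop {f : ℝ → ℝ} (hf : ContinuousOn f (Set.Ioi 0))
    (h0 : Filter.Tendsto f (nhdsWithin 0 (Set.Ioi 0)) Filter.atTop)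
    (h1 : Filter.Tendsto f Filter.atTop Filter.atTop) :
    ∃ r ∈ Set.Ioi (0 : ℝ), IsMinOn f (Set.Ioi 0) r := by
  obtain ⟨a, ha, hfa⟩ := mem_nhdsGT_iff_exists_Ioo_subset.1 (h0.eventually_ge_atTop (f 1))
  obtain ⟨b, hb⟩ := Filter.eventually_atTop.1 (h1.eventually_ge_atTop (f 1))
  have ha' : (0 : ℝ) < a := ha
  have hpos : ∀ x ∈ Set.Icc (min a 1) (max b 1), 0 < x := fun x hx =>
    (lt_min ha' one_pos).trans_le hx.1
  have hone : (1 : ℝ) ∈ Set.Icc (min a 1) (max b 1) := ⟨min_le_right _ _, le_max_right _ _⟩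
  obtain ⟨r, hr, hmin⟩ := isCompact_Icc.exists_isMinOn ⟨1, hone⟩ (hf.mono hpos)
  refine ⟨r, hpos r hr, fun x hx => ?_⟩
  have hr1 : f r ≤ f 1 := hmin hone
  by_cases h : x ∈ Set.Icc (min a 1) (max b 1)
  · exact hmin h
  · refine hr1.trans ?_
    by_cases hxa : x < min a 1
    · exact hfa ⟨hx, hxa.trans_le (min_le_left _ _)⟩
    · have hxb : max b 1 < x := by
        by_contra! hle
        exact h ⟨not_lt.1 hxa, hle⟩
      exact hb x ((le_max_left _ _).trans hxb.le)

end

/-- `G_n = K_n² + π² I_n²` is strictly convex on `(0,∞)` with `G_n'' > 0`,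
blows up at `0⁺` and `+∞`; hence `W_n = 1/G_n` attains its maximum at a unique point. -/
theorem stmt_5 (n : ℕ) :
    (∀ r : ℝ, 0 < r →
      0 < deriv (deriv (fun r : ℝ => (besselK n r)^2 + Real.pi^2 * (besselI n r)^2)) r) ∧
    StrictConvexOn ℝ (Set.Ioi 0) (fun r : ℝ => (besselK n r)^2 + Real.pi^2 * (besselI n r)^2) ∧
    Filter.Tendsto (fun r : ℝ => (besselK n r)^2 + Real.pi^2 * (besselI n r)^2)
      (nhdsWithin 0 (Set.Ioi 0)) Filter.atTop ∧
    Filter.Tendsto (fun r : ℝ => (besselK n r)^2 + Real.pi^2 * (besselI n r)^2)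
      Filter.atTop Filter.atTop ∧
    (∃! r0 : ℝ, 0 < r0 ∧ ∀ r : ℝ, 0 < r →
      1 / ((besselK n r)^2 + Real.pi^2 * (besselI n r)^2)
        ≤ 1 / ((besselK n r0)^2 + Real.pi^2 * (besselI n r0)^2)) := by
  have hpos : ∀ r : ℝ, 0 < r → 0 < besselK n r ^ 2 + Real.pi ^ 2 * besselI n r ^ 2 := fun r hr => by
    have : 0 < besselK n r := by
      rw [besselK_eq_besselKDeriv]
      exact besselKDeriv_pos n 0 hr
    positivity
  have hconv : StrictConvexOn ℝ (Set.Ioi 0)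
      (fun r : ℝ => besselK n r ^ 2 + Real.pi ^ 2 * besselI n r ^ 2) :=
    strictConvexOn_of_deriv2_pos' (convex_Ioi 0) (continuousOn_besselG n)
      fun r hr => deriv_deriv_besselG_pos n hr
  have h0 : Filter.Tendsto (fun r : ℝ => besselK n r ^ 2 + Real.pi ^ 2 * besselI n r ^ 2)
      (nhdsWithin 0 (Set.Ioi 0)) Filter.atTop :=
    Filter.tendsto_atTop_mono
      (fun r => le_add_of_nonneg_right (by positivity : 0 ≤ Real.pi ^ 2 * besselI n r ^ 2))
      ((Filter.tendsto_pow_atTop two_ne_zero).comp (tendsto_besselK_nhdsGT_zero n))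
  have h1 : Filter.Tendsto (fun r : ℝ => besselK n r ^ 2 + Real.pi ^ 2 * besselI n r ^ 2)
      Filter.atTop Filter.atTop :=
    Filter.tendsto_atTop_mono
      (fun r => le_add_of_nonneg_left (sq_nonneg (besselK n r)))
      (((Filter.tendsto_pow_atTop two_ne_zero).comp (tendsto_besselI_atTop n)).const_mul_atTop
        (by positivity))
  refine ⟨fun r hr => deriv_deriv_besselG_pos n hr, hconv, h0, h1, ?_⟩
  obtain ⟨r0, hr0, hmin⟩ := exists_isMinOn_Ioi_of_tendsto_atTop (continuousOn_besselG n) h0 h1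
  refine ⟨r0, ⟨hr0, fun r hr => one_div_le_one_div_of_le (hpos r0 hr0) (hmin hr)⟩, ?_⟩
  rintro r1 ⟨hr1, hmax⟩
  exact hconv.eq_of_isMinOn
    (fun r hr => (one_div_le_one_div (hpos r hr) (hpos r1 hr1)).1 (hmax r hr)) hmin hr1 hr0
end
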